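/- Let P_0 be a probability distribution supported on [-S,S] with ρ = E[X²], and let f_n^ws = -(1/n) E ln ∫∏_i dP_0(x_i) exp(-Σ_{i≤j}( x_i²x_j²/(2n) - x_ix_jX_iX_j/n - x_ix_jZ_ij/√n )) be the free energy of the Wigner spike model with i.i.d. signal X_i∼P_0 and i.i.d. Gaussian noise Z_ij∼N(0,1), i≤j. Then lim_{n→∞} f_n^ws = inf_{q∈[0,ρ]} f̃^pot(q), where f̃^pot(q) = q²/4 - E ln ∫dP_0(x) e^{-( q x²/2 - q xX - √q xZ )}, with X∼P_0 and Z∼N(0,1) independent. -/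

import Mathlib

open Finset MeasureTheory ProbabilityTheory

/-- The standard Gaussian measure `N(0,1)` on `ℝ`. -/
noncomputable def stdGauss : Measure ℝ := gaussianReal 0 1

instance : IsProbabilityMeasure stdGauss :=
  inferInstanceAs (IsProbabilityMeasure (gaussianReal 0 1))

/-- Hamiltonian of the Wigner spike model:
`H(x; X, Z) = Σ_{i≤j}( x_i²x_j²/(2n) - x_ix_jX_iX_j/n - x_ix_jZ_ij/√n )`. -/
noncomputable def Hws (n : ℕ) (X : Fin n → ℝ) (Z : Fin n × Fin n → ℝ)
    (x : Fin n → ℝ) : ℝ :=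
  ∑ i : Fin n, ∑ j ∈ Finset.univ.filter (fun j => i ≤ j),
    (x i ^ 2 * x j ^ 2 / (2 * n) - x i * x j * X i * X j / n
      - x i * x j * Z (i, j) / Real.sqrt n)

/-- Free energy of the Wigner spike model:
`f_n^ws = -(1/n) E ln ∫ ∏_i dP_0(x_i) e^{-H(x;X,Z)}`. -/
noncomputable def fws (P0 : Measure ℝ) (n : ℕ) : ℝ :=
  -(1 / n) * ∫ X : Fin n → ℝ,
      (∫ Z : Fin n × Fin n → ℝ,
          Real.log (∫ x : Fin n → ℝ, Real.exp (-Hws n X Z x)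
            ∂(Measure.pi fun _ : Fin n => P0))
        ∂(Measure.pi fun _ : Fin n × Fin n => stdGauss))
    ∂(Measure.pi fun _ : Fin n => P0)

/-- The one-parameter replica-symmetric potential of the Wigner spike model:
`f̃^pot(q) = q²/4 - E ln ∫ dP_0(x) e^{-( q x²/2 - q xX - √q xZ )}`. -/
noncomputable def ftpotWS (P0 : Measure ℝ) (q : ℝ) : ℝ :=
  q ^ 2 / 4 - ∫ X,
      (∫ z, Real.log (∫ x, Real.exp (-(q * x ^ 2 / 2 - q * x * X - Real.sqrt q * x * z)) ∂P0)
        ∂stdGauss) ∂P0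

/-- The standard Gaussian measure on `A → ℝ`. -/
noncomputable abbrev gaussPi (A : Type*) [Fintype A] : Measure (A → ℝ) :=
  Measure.pi fun _ : A => stdGauss

section Gaussian

variable {A : Type*} [Fintype A]

lemma integrable_exp_mul_sum_abs (K : ℝ) :
    Integrable (fun g : A → ℝ => Real.exp (K * ∑ a, |g a|)) (gaussPi A) := by
  have h1 : Integrable (fun x : ℝ => Real.exp (K * |x|)) stdGauss := by
    refine integrable_exp_mul_abs (X := id) ?_ ?_
    · exact integrable_exp_mul_gaussianReal K
    · exact integrable_exp_mul_gaussianReal (-K)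
  have := Integrable.fintype_prod (ι := A) (μ := fun _ => stdGauss)
    (f := fun _ x => Real.exp (K * |x|))
    (fun _ => h1)
  simpa only [← Real.exp_sum, ← Finset.mul_sum] using this

lemma integral_exp_dot (u : A → ℝ) :
    ∫ g : A → ℝ, Real.exp (∑ a, g a * u a) ∂(gaussPi A) = Real.exp ((∑ a, u a ^ 2) / 2) := by
  have h1 (t : ℝ) : ∫ x : ℝ, Real.exp (x * t) ∂stdGauss = Real.exp (t ^ 2 / 2) := by
    have := mgf_gaussianReal (p := stdGauss) (X := id) (μ := 0) (v := 1) (by simp [stdGauss]) t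
    simpa [mgf, mul_comm] using this
  simp_rw [Real.exp_sum]
  rw [integral_fintype_prod_eq_prod (μ := fun _ : A => stdGauss)
    (fun a (x : ℝ) => Real.exp (x * u a))]
  simp_rw [h1, ← Real.exp_sum, Finset.sum_div]

lemma map_add_stdGauss (t : ℝ) : stdGauss.map (· + t) =
    stdGauss.withDensity (fun x => ENNReal.ofReal (Real.exp (x * t - t ^ 2 / 2))) := by
  rw [stdGauss, gaussianReal_map_add_const, gaussianReal_of_var_ne_zero _ one_ne_zero,
    gaussianReal_of_var_ne_zero _ one_ne_zero]
  rw [← withDensity_mul _ (measurable_gaussianPDF _ _) (by fun_prop)]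
  congr 1
  ext x
  simp only [gaussianPDF, Pi.mul_apply]
  rw [← ENNReal.ofReal_mul (gaussianPDFReal_nonneg _ _ _)]
  simp only [gaussianPDFReal]
  rw [mul_assoc _ (Real.exp _) (Real.exp _), ← Real.exp_add]
  congr 2
  simp only [NNReal.coe_one]
  ring_nf

lemma map_add_gaussPi (u : A → ℝ) : (gaussPi A).map (· + u) =
    (gaussPi A).withDensity
      (fun g => ENNReal.ofReal (Real.exp (∑ a, g a * u a - (∑ a, u a ^ 2) / 2))) := by
  have h1 : (gaussPi A).map (· + u) = Measure.pi fun a => stdGauss.map (· + u a) := by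
    have : ∀ a, SigmaFinite (stdGauss.map (· + u a)) := by
      intro a
      have : IsProbabilityMeasure (stdGauss.map (· + u a)) :=
        Measure.isProbabilityMeasure_map (by fun_prop)
      infer_instance
    exact Measure.pi_map_pi (μ := fun _ : A => stdGauss) (f := fun a x => x + u a)
      (fun a => by fun_prop)
  rw [h1]
  have : ∀ a, SigmaFinite (stdGauss.map (· + u a)) := by
    intro a
    have : IsProbabilityMeasure (stdGauss.map (· + u a)) :=
      Measure.isProbabilityMeasure_map (by fun_prop)
    infer_instance
  refine Measure.pi_eq fun s hs => ?_
  have hpi : MeasurableSet (Set.univ.pi s) := MeasurableSet.univ_pi hs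
  rw [withDensity_apply _ hpi, ← lintegral_indicator hpi]
  let F : A → ℝ → ENNReal := fun a => (s a).indicator
    (fun x => ENNReal.ofReal (Real.exp (x * u a - u a ^ 2 / 2)))
  have hF : ∀ a, Measurable (F a) := fun a =>
    Measurable.indicator (by fun_prop) (hs a)
  have hind := iIndepFun_pi (μ := fun _ : A => stdGauss) (X := F) (fun a => (hF a).aemeasurable)
  have hprod := lintegral_prod_eq_prod_lintegral_of_indepFun Finset.univ _ hind
    (fun a => (hF a).comp (measurable_pi_apply a))
  have e1 : ∀ a, stdGauss.map (· + u a) (s a) = ∫⁻ g, F a (g a) ∂(gaussPi A) := by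
    intro a
    rw [map_add_stdGauss, withDensity_apply _ (hs a), ← lintegral_indicator (hs a)]
    exact ((measurePreserving_eval (fun _ : A => stdGauss) a).lintegral_comp (hF a)).symm
  simp_rw [e1]
  rw [← hprod]
  refine lintegral_congr fun g => ?_
  by_cases hg : g ∈ Set.univ.pi s
  · rw [Set.indicator_of_mem hg]
    have : ∀ a, F a (g a) = ENNReal.ofReal (Real.exp (g a * u a - u a ^ 2 / 2)) := fun a =>
      Set.indicator_of_mem (hg a (Set.mem_univ a)) _
    simp_rw [this]
    rw [← ENNReal.ofReal_prod_of_nonneg (fun _ _ => (Real.exp_pos _).le), ← Real.exp_sum,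
      Finset.sum_sub_distrib, Finset.sum_div]
  · rw [Set.indicator_of_notMem hg]
    simp only [Set.mem_pi, Set.mem_univ, true_imp_iff, not_forall] at hg
    obtain ⟨a, ha⟩ := hg
    exact (Finset.prod_eq_zero (Finset.mem_univ a) (Set.indicator_of_notMem ha _)).symm

lemma integral_shift (u : A → ℝ) (f : (A → ℝ) → ℝ) :
    ∫ g, f (g + u) ∂(gaussPi A) =
      ∫ g, Real.exp (∑ a, g a * u a - (∑ a, u a ^ 2) / 2) * f g ∂(gaussPi A) := by
  have h := (measurableEmbedding_addRight u).integral_map (μ := gaussPi A) f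
  rw [map_add_gaussPi] at h
  rw [← h, integral_withDensity_eq_integral_toReal_smul (by fun_prop) (by simp)]
  simp [ENNReal.toReal_ofReal (Real.exp_pos _).le]

lemma stdGauss_stable (a b c : ℝ) (h : a ^ 2 + b ^ 2 = c ^ 2) :
    (stdGauss.prod stdGauss).map (fun p : ℝ × ℝ => a * p.1 + b * p.2) = stdGauss.map (c * ·) := by
  have := gaussianReal_conv_gaussianReal (m₁ := 0) (m₂ := 0) (v₁ := ⟨a ^ 2, sq_nonneg _⟩)
    (v₂ := ⟨b ^ 2, sq_nonneg _⟩)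
  have ha : stdGauss.map (a * ·) = gaussianReal 0 ⟨a ^ 2, sq_nonneg _⟩ := by
    rw [stdGauss, gaussianReal_map_const_mul, mul_zero, mul_one]
    rfl
  have hb : stdGauss.map (b * ·) = gaussianReal 0 ⟨b ^ 2, sq_nonneg _⟩ := by
    rw [stdGauss, gaussianReal_map_const_mul, mul_zero, mul_one]
    rfl
  have hc : stdGauss.map (c * ·) = gaussianReal 0 ⟨c ^ 2, sq_nonneg _⟩ := by
    rw [stdGauss, gaussianReal_map_const_mul, mul_zero, mul_one]
    rfl
  rw [hc, ← (show (⟨a ^ 2, sq_nonneg _⟩ + ⟨b ^ 2, sq_nonneg _⟩ : NNReal) = ⟨c ^ 2, sq_nonneg _⟩ from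
    NNReal.eq h)]
  rw [add_zero] at this
  rw [← this, ← ha, ← hb, Measure.conv, Measure.map_prod_map _ _ (by fun_prop) (by fun_prop),
    Measure.map_map (by fun_prop) (by fun_prop)]
  rfl

lemma gaussPi_stable (a b c : ℝ) (h : a ^ 2 + b ^ 2 = c ^ 2) :
    ((gaussPi A).prod (gaussPi A)).map (fun p => a • p.1 + b • p.2) = (gaussPi A).map (c • ·) := by
  have h1 := measurePreserving_arrowProdEquivProdArrow ℝ ℝ A (fun _ => stdGauss) (fun _ => stdGauss)
  rw [← h1.map_eq, Measure.map_map (by fun_prop) (by fun_prop)]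
  have : ∀ f : ℝ → ℝ, Measurable f → SigmaFinite (stdGauss.map f) := by
    intro f hf
    have : IsProbabilityMeasure (stdGauss.map f) :=
      Measure.isProbabilityMeasure_map (by fun_prop)
    infer_instance
  have : SigmaFinite (stdGauss.map (c * ·)) := this _ (by fun_prop)
  have : SigmaFinite ((stdGauss.prod stdGauss).map (fun p : ℝ × ℝ => a * p.1 + b * p.2)) := by
    rwa [stdGauss_stable a b c h]
  have e1 := Measure.pi_map_pi (ι := A) (μ := fun _ => stdGauss.prod stdGauss)
    (f := fun _ (p : ℝ × ℝ) => a * p.1 + b * p.2) (fun _ => by fun_prop)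
  have e2 := Measure.pi_map_pi (ι := A) (μ := fun _ => stdGauss)
    (f := fun _ (p : ℝ) => c * p) (fun _ => by fun_prop)
  simp_rw [stdGauss_stable a b c h] at e1
  rw [← e2] at e1
  exact e1

lemma integral_stable {a b c : ℝ} (h : a ^ 2 + b ^ 2 = c ^ 2) {f : (A → ℝ) → ℝ}
    (hf : Measurable f) :
    ∫ g, f (c • g) ∂(gaussPi A) =
      ∫ p, f (a • p.1 + b • p.2) ∂((gaussPi A).prod (gaussPi A)) := by
  rw [← integral_map (μ := gaussPi A) (φ := (c • ·)) (by fun_prop) hf.aestronglyMeasurable,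
    ← gaussPi_stable a b c h, integral_map (by fun_prop) hf.aestronglyMeasurable]

end Gaussian

section Scalar

lemma log_lower_upper {p : ℝ} (hp : 0 < p) :
    Real.log p ≤ (p - 1) - (p - 1) ^ 2 / 2 + (p - 1) ^ 3 / 3 ∧
    (p - 1) - (p - 1) ^ 2 / 2 + (p - 1) ^ 3 / 3 - (p - 1) ^ 4 / p ≤ Real.log p := by
  have key : ∀ (f f' : ℝ → ℝ), (∀ x, 0 < x → HasDerivAt f (f' x) x) → f 1 = 0 →
      (∀ x, 0 < x → x ≤ 1 → f' x ≤ 0) → (∀ x, 1 ≤ x → 0 ≤ f' x) → ∀ x, 0 < x → 0 ≤ f x := by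
    intro f f' hd h1 hneg hpos x hx
    rcases le_total x 1 with h | h
    · have : AntitoneOn f (Set.Ioc 0 1) := by
        refine antitoneOn_of_deriv_nonpos (convex_Ioc 0 1) ?_ ?_ ?_
        · exact fun y hy => (hd y hy.1).continuousAt.continuousWithinAt
        · exact fun y hy => (hd y (interior_subset hy).1).differentiableAt.differentiableWithinAt
        · intro y hy
          rw [(hd y (interior_subset hy).1).deriv]
          exact hneg y (interior_subset hy).1 (interior_subset hy).2
      rw [← h1]
      exact this ⟨hx, h⟩ ⟨one_pos, le_rfl⟩ h
    · have : MonotoneOn f (Set.Ici 1) := by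
        have h0 : ∀ y ∈ Set.Ici (1 : ℝ), 0 < y := fun y hy => lt_of_lt_of_le one_pos hy
        refine monotoneOn_of_deriv_nonneg (convex_Ici 1) ?_ ?_ ?_
        · exact fun y hy => (hd y (h0 y hy)).continuousAt.continuousWithinAt
        · exact fun y hy =>
            (hd y (h0 y (interior_subset hy))).differentiableAt.differentiableWithinAt
        · intro y hy
          rw [(hd y (h0 y (interior_subset hy))).deriv]
          exact hpos y (interior_subset hy)
      rw [← h1]
      exact this Set.self_mem_Ici h h
  constructor
  · have := key (fun x => (x - 1) - (x - 1) ^ 2 / 2 + (x - 1) ^ 3 / 3 - Real.log x)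
      (fun x => (x - 1) ^ 3 / x) ?_ (by simp) ?_ ?_ p hp
    · linarith
    · intro x hx
      have h1 := (hasDerivAt_id x).sub_const 1
      convert! ((h1.sub ((h1.pow 2).div_const 2)).add ((h1.pow 3).div_const 3)).sub
        (Real.hasDerivAt_log hx.ne') using 1
      simp
      field_simp
      ring
    · intro x hx hx1
      exact div_nonpos_of_nonpos_of_nonneg (Odd.pow_nonpos (by decide) (by linarith)) hx.le
    · intro x hx1
      have : 0 ≤ x - 1 := by linarith
      positivity
  · have := key (fun x => Real.log x -
        ((x - 1) - (x - 1) ^ 2 / 2 + (x - 1) ^ 3 / 3 - (x - 1) ^ 4 / x))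
      (fun x => (x - 1) ^ 3 * (1 + 2 * x) / x ^ 2) ?_ (by simp) ?_ ?_ p hp
    · linarith
    · intro x hx
      have h1 := (hasDerivAt_id x).sub_const 1
      convert! (Real.hasDerivAt_log hx.ne').sub
        (((h1.sub ((h1.pow 2).div_const 2)).add ((h1.pow 3).div_const 3)).sub
        ((h1.pow 4).div (hasDerivAt_id x) hx.ne')) using 1
      simp
      field_simp
      ring
    · intro x hx hx1
      refine div_nonpos_of_nonpos_of_nonneg (mul_nonpos_of_nonpos_of_nonneg
        (Odd.pow_nonpos (by decide) (by linarith)) (by linarith)) (by positivity)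
    · intro x hx1
      have : 0 ≤ x - 1 := by linarith
      positivity

/-- Remainder of a second order expansion around `1`, blowing up at `0`. -/
noncomputable def expRem (p : ℝ) : ℝ := |p - 1| ^ 3 + (p - 1) ^ 4 + (p - 1) ^ 4 / p

lemma expRem_nonneg {p : ℝ} (hp : 0 < p) : 0 ≤ expRem p := by
  unfold expRem; positivity

lemma neg_log_expand {p : ℝ} (hp : 0 < p) :
    |-Real.log p + (p - 1) - (p - 1) ^ 2 / 2| ≤ expRem p := by
  obtain ⟨h1, h2⟩ := log_lower_upper hp
  have h3 : (0 : ℝ) ≤ (p - 1) ^ 4 / p := by positivity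
  have h4 : (0 : ℝ) ≤ (p - 1) ^ 4 := by positivity
  have h5 : |(p - 1) ^ 3| = |p - 1| ^ 3 := abs_pow _ _
  have h6 := abs_le.1 h5.le
  have h7 : (0 : ℝ) ≤ |p - 1| ^ 3 := by positivity
  unfold expRem
  rw [abs_le]
  constructor <;> linarith [h6.1, h6.2]

lemma mul_log_expand {p : ℝ} (hp : 0 < p) :
    |p * Real.log p - (p - 1) - (p - 1) ^ 2 / 2| ≤ expRem p := by
  obtain ⟨h1, h2⟩ := log_lower_upper hp
  have h1' := mul_le_mul_of_nonneg_left h1 hp.le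
  have h2' := mul_le_mul_of_nonneg_left h2 hp.le
  have e : p * ((p - 1) - (p - 1) ^ 2 / 2 + (p - 1) ^ 3 / 3 - (p - 1) ^ 4 / p) =
      p * ((p - 1) - (p - 1) ^ 2 / 2 + (p - 1) ^ 3 / 3) - (p - 1) ^ 4 := by
    field_simp
  have h3 : (0 : ℝ) ≤ (p - 1) ^ 4 / p := by positivity
  have h4 : (0 : ℝ) ≤ (p - 1) ^ 4 := by positivity
  have h5 : |(p - 1) ^ 3| = |p - 1| ^ 3 := abs_pow _ _
  have h6 := abs_le.1 h5.le
  have h7 : (0 : ℝ) ≤ |p - 1| ^ 3 := by positivity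
  rw [e] at h2'
  unfold expRem
  rw [abs_le]
  constructor <;> nlinarith [h6.1, h6.2]

/-- A convex majorant of `expRem`. -/
noncomputable def expMaj (t p : ℝ) : ℝ :=
  t * (p - 1) ^ 2 + (1 / t + 1) * (p - 1) ^ 4 + (p - 1) ^ 4 / p

lemma expRem_le_expMaj {t p : ℝ} (ht : 0 < t) : expRem p ≤ expMaj t p := by
  have h : |p - 1| ^ 3 ≤ t * (p - 1) ^ 2 + 1 / t * (p - 1) ^ 4 := by
    rw [← sq_abs (p - 1), ← (show Even 4 by decide).pow_abs (p - 1)]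
    have h0 := abs_nonneg (p - 1)
    generalize |p - 1| = y at *
    have e : t * y ^ 2 + 1 / t * y ^ 4 - y ^ 3 = y ^ 2 / t * ((t - y / 2) ^ 2 + 3 / 4 * y ^ 2) := by
      field_simp; ring
    have : 0 ≤ y ^ 2 / t * ((t - y / 2) ^ 2 + 3 / 4 * y ^ 2) := by positivity
    linarith
  unfold expRem expMaj
  linarith

lemma expMaj_tangent {t p : ℝ} (ht : 0 < t) (hp : 0 < p) :
    ∃ s : ℝ, ∀ L : ℝ, 0 < L → expMaj t p + s * (L - p) ≤ expMaj t L := by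
  refine ⟨t * (2 * (p - 1)) + (1 / t + 1) * (4 * (p - 1) ^ 3) +
    (3 * p ^ 2 - 8 * p + 6 - 1 / p ^ 2), fun L hL => ?_⟩
  have e1 : (L - 1) ^ 2 = (p - 1) ^ 2 + 2 * (p - 1) * (L - p) + (L - p) ^ 2 := by ring
  have e2 : (L - 1) ^ 4 = (p - 1) ^ 4 + 4 * (p - 1) ^ 3 * (L - p) +
      (L - p) ^ 2 * (((L - 1) + (p - 1)) ^ 2 + 2 * (p - 1) ^ 2) := by ring
  have e3 : (L - 1) ^ 4 / L = (p - 1) ^ 4 / p + (3 * p ^ 2 - 8 * p + 6 - 1 / p ^ 2) * (L - p) +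
      (L - p) ^ 2 * ((1 - p * L) ^ 2 / (p ^ 2 * L) + 2 * (p - 1) ^ 2 / p) := by
    field_simp
    ring
  have h1 : 0 ≤ t * (L - p) ^ 2 := by positivity
  have h2 : 0 ≤ (1 / t + 1) * ((L - p) ^ 2 * (((L - 1) + (p - 1)) ^ 2 + 2 * (p - 1) ^ 2)) := by
    positivity
  have h3 : 0 ≤ (L - p) ^ 2 * ((1 - p * L) ^ 2 / (p ^ 2 * L) + 2 * (p - 1) ^ 2 / p) := by
    positivity
  unfold expMaj
  rw [e3, e2, e1]
  nlinarith

lemma exp_le_quadratic {x : ℝ} (h0 : 0 ≤ x) (h1 : x ≤ 1) : Real.exp x ≤ 1 + x + x ^ 2 := by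
  have := Real.abs_exp_sub_one_sub_id_le (x := x) (by rw [abs_le]; constructor <;> linarith)
  linarith [(abs_le.1 this).2]

lemma expMaj_moment_bound {t a : ℝ} (ht : 0 < t) (ht1 : t ^ 2 ≤ 1 / 6) (ha : 0 ≤ a)
    (hat : a ≤ t ^ 2) :
    t * (Real.exp a - 1) + (1 / t + 1) *
      (Real.exp (6 * a) - 4 * Real.exp (3 * a) + 6 * Real.exp a - 3) +
      (Real.exp (3 * a) - 3 * Real.exp a + 2) ≤ 100 * t ^ 3 := by
  have h1 := exp_le_quadratic ha (by linarith)
  have h3 := exp_le_quadratic (x := 3 * a) (by linarith) (by linarith)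
  have h6 := exp_le_quadratic (x := 6 * a) (by linarith) (by linarith)
  have g1 := Real.add_one_le_exp a
  have g3 := Real.add_one_le_exp (3 * a)
  have ht2 : t ≤ 1 := by nlinarith
  have ha2 : a ^ 2 ≤ t ^ 4 := by nlinarith
  have b1 : Real.exp a - 1 ≤ 2 * t ^ 2 := by nlinarith
  have b2 : Real.exp (6 * a) - 4 * Real.exp (3 * a) + 6 * Real.exp a - 3 ≤ 42 * t ^ 4 := by
    nlinarith
  have b3 : Real.exp (3 * a) - 3 * Real.exp a + 2 ≤ 9 * t ^ 4 := by nlinarith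
  have c1 := mul_le_mul_of_nonneg_left b1 ht.le
  have c2 := mul_le_mul_of_nonneg_left b2 (show 0 ≤ 1 / t + 1 by positivity)
  have e : (1 / t + 1) * (42 * t ^ 4) = 42 * t ^ 3 + 42 * t ^ 4 := by field_simp
  have ht4 : t ^ 4 ≤ t ^ 3 := by
    have : 0 ≤ t ^ 3 := by positivity
    nlinarith
  have : 0 ≤ t ^ 3 := by positivity
  nlinarith

end Scalar

section Domination

variable {A : Type*} [Fintype A] {Ω : Type*} [MeasurableSpace Ω]

lemma integrable_of_gauss_dom {f : (A → ℝ) → ℝ} (hf : Measurable f) {C K : ℝ}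
    (h : ∀ g, |f g| ≤ C * Real.exp (K * ∑ a, |g a|)) : Integrable f (gaussPi A) :=
  ((integrable_exp_mul_sum_abs K).const_mul C).mono' hf.aestronglyMeasurable
    (Filter.Eventually.of_forall h)

lemma integrable_prod_of_gauss_dom {μ : Measure Ω} [IsFiniteMeasure μ]
    {f : (A → ℝ) × Ω → ℝ} (hf : Measurable f) {C K : ℝ}
    (h : ∀ᵐ σ ∂μ, ∀ g, |f (g, σ)| ≤ C * Real.exp (K * ∑ a, |g a|)) :
    Integrable f ((gaussPi A).prod μ) := by
  have h1 : Integrable (fun q : (A → ℝ) × Ω => C * Real.exp (K * ∑ a, |q.1 a|) * 1)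
      ((gaussPi A).prod μ) :=
    ((integrable_exp_mul_sum_abs K).const_mul C).mul_prod (integrable_const (1 : ℝ))
  refine h1.mono' hf.aestronglyMeasurable ?_
  have h2 := Measure.quasiMeasurePreserving_snd (μ := gaussPi A) (ν := μ) |>.ae h
  filter_upwards [h2] with q hq
  simpa using hq q.1

lemma integral_gauss_swap {μ : Measure Ω} [IsFiniteMeasure μ]
    {f : (A → ℝ) → Ω → ℝ} (hf : Measurable (Function.uncurry f)) {C K : ℝ}
    (h : ∀ᵐ σ ∂μ, ∀ g, |f g σ| ≤ C * Real.exp (K * ∑ a, |g a|)) :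
    ∫ g, ∫ σ, f g σ ∂μ ∂(gaussPi A) = ∫ σ, ∫ g, f g σ ∂(gaussPi A) ∂μ :=
  integral_integral_swap (integrable_prod_of_gauss_dom hf h)

/-- The exponential weight `exp(⟨g,u⟩ - |u|²/2)`. -/
noncomputable def gaussExp (u g : A → ℝ) : ℝ :=
  Real.exp (∑ a, g a * u a - (∑ a, u a ^ 2) / 2)

lemma gaussExp_pos (u g : A → ℝ) : 0 < gaussExp u g := Real.exp_pos _

lemma abs_dot_le {u g : A → ℝ} {B : ℝ} (hu : ∀ a, |u a| ≤ B) :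
    |∑ a, g a * u a| ≤ B * ∑ a, |g a| := by
  rw [Finset.mul_sum]
  refine (Finset.abs_sum_le_sum_abs _ _).trans (Finset.sum_le_sum fun a _ => ?_)
  rw [abs_mul, mul_comm]
  exact mul_le_mul_of_nonneg_right (hu a) (abs_nonneg _)

lemma sum_sq_le_card {u : A → ℝ} {B : ℝ} (hu : ∀ a, |u a| ≤ B) :
    ∑ a, u a ^ 2 ≤ Fintype.card A * B ^ 2 := by
  have : ∀ a ∈ Finset.univ, u a ^ 2 ≤ B ^ 2 := fun a _ => sq_le_sq' (abs_le.1 (hu a)).1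
    (abs_le.1 (hu a)).2
  simpa using Finset.sum_le_card_nsmul _ _ _ this

lemma abs_gaussExp_exponent_le {u g : A → ℝ} {B : ℝ} (hu : ∀ a, |u a| ≤ B) :
    |∑ a, g a * u a - (∑ a, u a ^ 2) / 2| ≤
      B * ∑ a, |g a| + Fintype.card A * B ^ 2 := by
  have h1 := abs_le.1 (abs_dot_le (g := g) hu)
  have h2 := sum_sq_le_card hu
  have h3 : 0 ≤ ∑ a, u a ^ 2 := Finset.sum_nonneg fun a _ => sq_nonneg _
  rw [abs_le]
  constructor <;> linarith [h1.1, h1.2]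

@[fun_prop]
lemma measurable_gaussExp_uncurry {u : Ω → A → ℝ} (hu : Measurable u) :
    Measurable (fun q : (A → ℝ) × Ω => gaussExp (u q.2) q.1) := by
  unfold gaussExp
  have : ∀ a, Measurable fun σ => u σ a := fun a => (measurable_pi_apply a).comp hu
  fun_prop

lemma gaussExp_rpow_bound {u : A → ℝ} {B : ℝ} (hu : ∀ a, |u a| ≤ B) (k : ℝ) (g : A → ℝ) :
    |Real.exp (k * (∑ a, g a * u a - (∑ a, u a ^ 2) / 2))| ≤
      Real.exp (|k| * (Fintype.card A * B ^ 2)) * Real.exp (|k| * B * ∑ a, |g a|) := by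
  rw [Real.abs_exp, ← Real.exp_add, Real.exp_le_exp]
  refine (le_abs_self _).trans ?_
  rw [abs_mul]
  nlinarith [mul_le_mul_of_nonneg_left (abs_gaussExp_exponent_le (g := g) hu) (abs_nonneg k)]

lemma integral_gaussExp_pow (u : A → ℝ) (k : ℝ) :
    ∫ g, Real.exp (k * (∑ a, g a * u a - (∑ a, u a ^ 2) / 2)) ∂(gaussPi A) =
      Real.exp ((k ^ 2 - k) / 2 * ∑ a, u a ^ 2) := by
  have h := integral_exp_dot (fun a => k * u a)
  have e : ∀ g : A → ℝ, Real.exp (k * (∑ a, g a * u a - (∑ a, u a ^ 2) / 2)) =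
      Real.exp (∑ a, g a * (k * u a)) * Real.exp (-(k * (∑ a, u a ^ 2) / 2)) := by
    intro g
    rw [← Real.exp_add]
    congr 1
    have : ∑ a, g a * (k * u a) = k * ∑ a, g a * u a := by
      rw [Finset.mul_sum]; exact Finset.sum_congr rfl fun _ _ => by ring
    rw [this]; ring
  simp_rw [e]
  rw [integral_mul_const, h, ← Real.exp_add]
  congr 1
  simp_rw [mul_pow, ← Finset.mul_sum]
  ring

lemma integrable_gaussExp_pow (u : A → ℝ) (k : ℝ) :
    Integrable (fun g => Real.exp (k * (∑ a, g a * u a - (∑ a, u a ^ 2) / 2))) (gaussPi A) := by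
  have hu : ∀ a, |u a| ≤ ∑ b, |u b| := fun a =>
    Finset.single_le_sum (f := fun b => |u b|) (fun _ _ => abs_nonneg _) (Finset.mem_univ a)
  exact integrable_of_gauss_dom (by fun_prop) (gaussExp_rpow_bound hu k)

lemma expMaj_gaussExp (t : ℝ) (u g : A → ℝ) :
    expMaj t (gaussExp u g) =
      ∑ i : Fin 6, ![1, t - 4 + (1 / t + 1),
        6 - 2 * t - 4 * (1 / t + 1), t - 4 + 6 * (1 / t + 1), 1 - 4 * (1 / t + 1), 1 / t + 1] i *
        Real.exp (((i : ℕ) - 1 : ℝ) * (∑ a, g a * u a - (∑ a, u a ^ 2) / 2)) := by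
  unfold gaussExp expMaj
  generalize (∑ a, g a * u a - (∑ a, u a ^ 2) / 2) = x
  have h : ∀ n : ℕ, Real.exp (n * x) = Real.exp x ^ n := fun n => Real.exp_nat_mul x n
  have h2 := h 2
  have h3 := h 3
  have h4 := h 4
  have hm : Real.exp (-1 * x) = (Real.exp x)⁻¹ := by rw [neg_one_mul, Real.exp_neg]
  push_cast at h2 h3 h4
  simp [Fin.sum_univ_six]
  norm_num
  rw [h2, h3, h4, Real.exp_neg]
  have := (Real.exp_pos x).ne'
  generalize t⁻¹ = s
  field_simp
  ring

lemma integral_expMaj_gaussExp (t : ℝ) (u : A → ℝ) :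
    ∫ g, expMaj t (gaussExp u g) ∂(gaussPi A) =
      t * (Real.exp (∑ a, u a ^ 2) - 1) + (1 / t + 1) *
      (Real.exp (6 * ∑ a, u a ^ 2) - 4 * Real.exp (3 * ∑ a, u a ^ 2) +
        6 * Real.exp (∑ a, u a ^ 2) - 3) +
      (Real.exp (3 * ∑ a, u a ^ 2) - 3 * Real.exp (∑ a, u a ^ 2) + 2) := by
  simp_rw [expMaj_gaussExp]
  rw [integral_finsetSum _ fun i _ => (integrable_gaussExp_pow u _).const_mul _]
  simp_rw [integral_const_mul, integral_gaussExp_pow]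
  simp [Fin.sum_univ_six]
  norm_num
  ring

end Domination

/-- A function with a second order expansion, with curvature `b z` at scale `z`, for which
Kahane's Gaussian comparison holds. -/
structure IsKahane (F b : ℝ → ℝ) : Prop where
  meas : Measurable F
  growth : ∀ x, 0 < x → |F x| ≤ 2 * (x ^ 2 + 1 / x)
  b_nonneg : ∀ z, 0 < z → 0 ≤ b z
  expand : ∀ z, 0 < z → ∃ α, ∀ p, 0 < p →
    |F (z * p) - F z - α * (p - 1) - b z / 2 * (p - 1) ^ 2| ≤ (1 + z) * expRem p

lemma isKahane_neg_log : IsKahane (fun x => -Real.log x) (fun _ => 1) where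
  meas := by fun_prop
  growth := by
    intro x hx
    have h1 := Real.log_le_sub_one_of_pos hx
    have h2 := Real.log_le_sub_one_of_pos (one_div_pos.2 hx)
    rw [Real.log_div one_ne_zero hx.ne', Real.log_one] at h2
    have h3 : 0 < 1 / x := by positivity
    rw [abs_neg, abs_le]
    constructor <;> nlinarith [sq_nonneg (x - 1)]
  b_nonneg := fun _ _ => zero_le_one
  expand := by
    intro z hz
    refine ⟨-1, fun p hp => ?_⟩
    have h := neg_log_expand hp
    rw [Real.log_mul hz.ne' hp.ne']
    have e : -(Real.log z + Real.log p) - -Real.log z - -1 * (p - 1) - 1 / 2 * (p - 1) ^ 2 =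
        -Real.log p + (p - 1) - (p - 1) ^ 2 / 2 := by ring
    rw [e]
    nlinarith [expRem_nonneg hp]

lemma isKahane_mul_log : IsKahane (fun x => x * Real.log x) (fun z => z) where
  meas := by fun_prop
  growth := by
    intro x hx
    have h1 := mul_le_mul_of_nonneg_left (Real.log_le_sub_one_of_pos hx) hx.le
    have h2 := mul_le_mul_of_nonneg_left (Real.log_le_sub_one_of_pos (one_div_pos.2 hx)) hx.le
    rw [Real.log_div one_ne_zero hx.ne', Real.log_one, mul_sub, mul_sub,
      mul_one_div_cancel hx.ne'] at h2
    have h3 : 0 < 1 / x := by positivity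
    have h4 : x * (1 / x) = 1 := mul_one_div_cancel hx.ne'
    rw [abs_le]
    constructor
    · nlinarith [sq_nonneg (x - 1 / x), sq_nonneg (x - 1)]
    · nlinarith [sq_nonneg (x - 1)]
  b_nonneg := fun _ h => h.le
  expand := by
    intro z hz
    refine ⟨z * Real.log z + z, fun p hp => ?_⟩
    have h := mul_log_expand hp
    rw [Real.log_mul hz.ne' hp.ne']
    have e : z * p * (Real.log z + Real.log p) - z * Real.log z -
        (z * Real.log z + z) * (p - 1) - z / 2 * (p - 1) ^ 2 =
        z * (p * Real.log p - (p - 1) - (p - 1) ^ 2 / 2) := by ring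
    rw [e, abs_mul, abs_of_pos hz]
    nlinarith [expRem_nonneg hp]

section Step

variable {A : Type*} [Fintype A] {Ω : Type*} [MeasurableSpace Ω]

lemma measurable_integral_param {X : Type*} [MeasurableSpace X] {μ : Measure Ω} [SFinite μ]
    {f : X → Ω → ℝ} (hf : Measurable (Function.uncurry f)) :
    Measurable (fun g => ∫ σ, f g σ ∂μ) :=
  (hf.stronglyMeasurable.integral_prod_right).measurable

lemma integrable_gaussExp_section {μ : Measure Ω} [IsFiniteMeasure μ] {u : Ω → A → ℝ}
    (hu : Measurable u) {B : ℝ} (hB : ∀ᵐ σ ∂μ, ∀ a, |u σ a| ≤ B) (g : A → ℝ) :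
    Integrable (fun σ => gaussExp (u σ) g) μ := by
  refine Integrable.of_bound
    ((measurable_gaussExp_uncurry hu).comp (measurable_prodMk_left (x := g))).aestronglyMeasurable
    (Real.exp (B * ∑ a, |g a| + Fintype.card A * B ^ 2)) ?_
  filter_upwards [hB] with σ hσ
  rw [Real.norm_eq_abs, gaussExp, Real.abs_exp, Real.exp_le_exp]
  exact (le_abs_self _).trans (abs_gaussExp_exponent_le hσ)

lemma partition_bounds {μ : Measure Ω} [IsProbabilityMeasure μ] {u : Ω → A → ℝ}
    (hu : Measurable u) {B : ℝ} (hB : ∀ᵐ σ ∂μ, ∀ a, |u σ a| ≤ B) (g : A → ℝ) :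
    Real.exp (-(B * ∑ a, |g a| + Fintype.card A * B ^ 2)) ≤ ∫ σ, gaussExp (u σ) g ∂μ ∧
      ∫ σ, gaussExp (u σ) g ∂μ ≤ Real.exp (B * ∑ a, |g a| + Fintype.card A * B ^ 2) := by
  have hi := integrable_gaussExp_section hu hB g
  constructor
  · have := integral_mono_ae (integrable_const (μ := μ)
      (Real.exp (-(B * ∑ a, |g a| + Fintype.card A * B ^ 2)))) hi (by
        filter_upwards [hB] with σ hσ
        exact Real.exp_le_exp.2 (abs_le.1 (abs_gaussExp_exponent_le hσ)).1)
    simpa using this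
  · have := integral_mono_ae hi (integrable_const (μ := μ)
      (Real.exp (B * ∑ a, |g a| + Fintype.card A * B ^ 2))) (by
        filter_upwards [hB] with σ hσ
        exact Real.exp_le_exp.2 (abs_le.1 (abs_gaussExp_exponent_le hσ)).2)
    simpa using this

lemma integrable_expMaj_prod {μ : Measure Ω} [IsFiniteMeasure μ] {u : Ω → A → ℝ}
    (hu : Measurable u) {B : ℝ} (hB : ∀ᵐ σ ∂μ, ∀ a, |u σ a| ≤ B) (t : ℝ) :
    Integrable (fun q : (A → ℝ) × Ω => expMaj t (gaussExp (u q.2) q.1)) ((gaussPi A).prod μ) := by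
  simp_rw [expMaj_gaussExp]
  have hm : ∀ a, Measurable fun σ => u σ a := fun a => (measurable_pi_apply a).comp hu
  refine integrable_finsetSum _ fun i _ => Integrable.const_mul ?_ _
  refine integrable_prod_of_gauss_dom (by fun_prop) ?_ (K := |((i : ℕ) - 1 : ℝ)| * B)
    (C := Real.exp (|((i : ℕ) - 1 : ℝ)| * (Fintype.card A * B ^ 2)))
  filter_upwards [hB] with σ hσ g
  exact gaussExp_rpow_bound hσ _ g

lemma integral_expRem_partition_le {μ : Measure Ω} [IsProbabilityMeasure μ] {u : Ω → A → ℝ}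
    (hu : Measurable u) {B : ℝ} (hB : ∀ᵐ σ ∂μ, ∀ a, |u σ a| ≤ B) {t : ℝ} (ht : 0 < t)
    (ht1 : t ^ 2 ≤ 1 / 6) (hut : ∀ᵐ σ ∂μ, ∑ a, u σ a ^ 2 ≤ t ^ 2) :
    Integrable (fun g => expRem (∫ σ, gaussExp (u σ) g ∂μ)) (gaussPi A) ∧
    ∫ g, expRem (∫ σ, gaussExp (u σ) g ∂μ) ∂(gaussPi A) ≤ 100 * t ^ 3 := by
  have hI := integrable_expMaj_prod hu hB t
  have hp : ∀ g, 0 < ∫ σ, gaussExp (u σ) g ∂μ := fun g =>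
    (Real.exp_pos _).trans_le (partition_bounds hu hB g).1
  have hle : ∀ᵐ g ∂(gaussPi A), expRem (∫ σ, gaussExp (u σ) g ∂μ) ≤
      ∫ σ, expMaj t (gaussExp (u σ) g) ∂μ := by
    filter_upwards [hI.prod_right_ae] with g hg
    refine (expRem_le_expMaj ht).trans ?_
    obtain ⟨s, hs⟩ := expMaj_tangent ht (hp g)
    have hi := integrable_gaussExp_section hu hB g
    have h1 : Integrable (fun σ => gaussExp (u σ) g - ∫ σ, gaussExp (u σ) g ∂μ) μ :=
      hi.sub (integrable_const _)
    have := integral_mono ((integrable_const (μ := μ)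
      (expMaj t (∫ σ, gaussExp (u σ) g ∂μ))).add (h1.const_mul s)) hg
      (fun σ => hs _ (gaussExp_pos _ _))
    refine le_trans (le_of_eq ?_) this
    simp only [Pi.add_apply]
    rw [integral_add (integrable_const _) (h1.const_mul s), integral_const_mul,
      integral_sub hi (integrable_const _)]
    simp
  have hmeas : Measurable (fun g => expRem (∫ σ, gaussExp (u σ) g ∂μ)) := by
    have h1 : Measurable expRem := by unfold expRem; fun_prop
    exact h1.comp (measurable_integral_param (measurable_gaussExp_uncurry hu))
  have hint : Integrable (fun g => expRem (∫ σ, gaussExp (u σ) g ∂μ)) (gaussPi A) := by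
    refine hI.integral_prod_left.mono' hmeas.aestronglyMeasurable ?_
    filter_upwards [hle] with g hg
    rwa [Real.norm_eq_abs, abs_of_nonneg (expRem_nonneg (hp g))]
  refine ⟨hint, (integral_mono_ae hint hI.integral_prod_left hle).trans ?_⟩
  rw [integral_integral_swap hI]
  have hb : ∀ᵐ σ ∂μ, ∫ g, expMaj t (gaussExp (u σ) g) ∂(gaussPi A) ≤ 100 * t ^ 3 := by
    filter_upwards [hut] with σ hσ
    rw [integral_expMaj_gaussExp]
    exact expMaj_moment_bound ht ht1 (Finset.sum_nonneg fun a _ => sq_nonneg _) hσ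
  have := integral_mono_ae hI.integral_prod_right (integrable_const (μ := μ) (100 * t ^ 3)) hb
  simpa using this

lemma integral_partition {μ : Measure Ω} [IsProbabilityMeasure μ] {u : Ω → A → ℝ}
    (hu : Measurable u) {B : ℝ} (hB : ∀ᵐ σ ∂μ, ∀ a, |u σ a| ≤ B) :
    ∫ g, ∫ σ, gaussExp (u σ) g ∂μ ∂(gaussPi A) = 1 := by
  rw [integral_gauss_swap (measurable_gaussExp_uncurry hu) (C := Real.exp (Fintype.card A * B ^ 2))
    (K := B)]
  · have : ∀ σ, ∫ g, gaussExp (u σ) g ∂(gaussPi A) = 1 := fun σ => by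
      have := integral_gaussExp_pow (u σ) 1
      simpa [gaussExp] using this
    simp [this]
  · filter_upwards [hB] with σ hσ g
    have := gaussExp_rpow_bound hσ 1 g
    simpa [gaussExp] using this

lemma integral_partition_sq {μ : Measure Ω} [IsProbabilityMeasure μ] {u : Ω → A → ℝ}
    (hu : Measurable u) {B : ℝ} (hB : ∀ᵐ σ ∂μ, ∀ a, |u σ a| ≤ B) :
    ∫ g, (∫ σ, gaussExp (u σ) g ∂μ) ^ 2 ∂(gaussPi A) =
      ∫ q : Ω × Ω, Real.exp (∑ a, u q.1 a * u q.2 a) ∂(μ.prod μ) := by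
  have e : ∀ g, (∫ σ, gaussExp (u σ) g ∂μ) ^ 2 =
      ∫ q : Ω × Ω, gaussExp (u q.1) g * gaussExp (u q.2) g ∂(μ.prod μ) := by
    intro g
    rw [sq, integral_prod_mul (μ := μ) (ν := μ) (fun σ => gaussExp (u σ) g)
      (fun σ => gaussExp (u σ) g)]
  simp_rw [e]
  have hm : ∀ a, Measurable fun σ => u σ a := fun a => (measurable_pi_apply a).comp hu
  rw [integral_gauss_swap (C := Real.exp (Fintype.card A * B ^ 2) *
    Real.exp (Fintype.card A * B ^ 2)) (K := 2 * B)]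
  · refine integral_congr_ae (Filter.Eventually.of_forall fun q => ?_)
    have h := integral_exp_dot (u q.1 + u q.2)
    have e : ∀ g, gaussExp (u q.1) g * gaussExp (u q.2) g =
        Real.exp (∑ a, g a * (u q.1 + u q.2) a) *
          Real.exp (-((∑ a, u q.1 a ^ 2) / 2 + (∑ a, u q.2 a ^ 2) / 2)) := by
      intro g
      rw [gaussExp, gaussExp, ← Real.exp_add, ← Real.exp_add]
      congr 1
      simp only [Pi.add_apply, mul_add, Finset.sum_add_distrib]
      ring
    simp_rw [e]
    rw [integral_mul_const, h, ← Real.exp_add]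
    congr 1
    have e2 : ∑ a, (u q.1 + u q.2) a ^ 2 =
        ∑ a, u q.1 a ^ 2 + 2 * ∑ a, u q.1 a * u q.2 a + ∑ a, u q.2 a ^ 2 := by
      rw [Finset.mul_sum, ← Finset.sum_add_distrib, ← Finset.sum_add_distrib]
      exact Finset.sum_congr rfl fun a _ => by simp only [Pi.add_apply]; ring
    rw [e2]; ring
  · unfold gaussExp Function.uncurry
    fun_prop
  · have h1 := Measure.quasiMeasurePreserving_fst (μ := μ) (ν := μ) |>.ae hB
    have h2 := Measure.quasiMeasurePreserving_snd (μ := μ) (ν := μ) |>.ae hB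
    filter_upwards [h1, h2] with q hq1 hq2 g
    have b1 := gaussExp_rpow_bound hq1 1 g
    have b2 := gaussExp_rpow_bound hq2 1 g
    simp only [abs_one, one_mul] at b1 b2
    rw [abs_mul]
    refine (mul_le_mul b1 b2 (abs_nonneg _) (by positivity)).trans (le_of_eq ?_)
    rw [show 2 * B * ∑ a, |g a| = B * ∑ a, |g a| + B * ∑ a, |g a| by ring, Real.exp_add]
    ring

lemma growth_bound {F : ℝ → ℝ} (hF : ∀ x, 0 < x → |F x| ≤ 2 * (x ^ 2 + 1 / x)) {x c : ℝ}
    (hc : 0 ≤ c) (h1 : Real.exp (-c) ≤ x) (h2 : x ≤ Real.exp c) :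
    |F x| ≤ 4 * Real.exp (2 * c) := by
  have hx := (Real.exp_pos _).trans_le h1
  refine (hF x hx).trans ?_
  have h3 : x ^ 2 ≤ Real.exp (2 * c) := by
    rw [two_mul, Real.exp_add, ← sq]; exact pow_le_pow_left₀ hx.le h2 2
  have h4 : 1 / x ≤ Real.exp (2 * c) := by
    rw [div_le_iff₀ hx]
    have : Real.exp (2 * c) * Real.exp (-c) ≤ Real.exp (2 * c) * x :=
      mul_le_mul_of_nonneg_left h1 (Real.exp_pos _).le
    rw [← Real.exp_add] at this
    have := Real.add_one_le_exp (2 * c + -c)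
    linarith
  linarith

lemma gauss_step {F b : ℝ → ℝ} (hF : IsKahane F b) {z : ℝ} (hz : 0 < z)
    {μ : Measure Ω} [IsProbabilityMeasure μ] {u : Ω → A → ℝ}
    (hu : Measurable u) {B : ℝ} (hB0 : 0 ≤ B) (hB : ∀ᵐ σ ∂μ, ∀ a, |u σ a| ≤ B) {t : ℝ} (ht : 0 < t)
    (ht1 : t ^ 2 ≤ 1 / 6) (hut : ∀ᵐ σ ∂μ, ∑ a, u σ a ^ 2 ≤ t ^ 2) :
    |∫ g, F (z * ∫ σ, gaussExp (u σ) g ∂μ) ∂(gaussPi A) - F z -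
      b z / 2 * (∫ q : Ω × Ω, Real.exp (∑ a, u q.1 a * u q.2 a) ∂(μ.prod μ) - 1)| ≤
      (1 + z) * (100 * t ^ 3) := by
  obtain ⟨α, hα⟩ := hF.expand z hz
  obtain ⟨hRi, hR⟩ := integral_expRem_partition_le hu hB ht ht1 hut
  have hpm : Measurable fun g => ∫ σ, gaussExp (u σ) g ∂μ :=
    measurable_integral_param (measurable_gaussExp_uncurry hu)
  have hbd := partition_bounds hu hB
  have h1 := integral_partition hu hB
  have h2 := integral_partition_sq hu hB
  set p : (A → ℝ) → ℝ := fun g => ∫ σ, gaussExp (u σ) g ∂μ with hp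
  set m := ∫ q : Ω × Ω, Real.exp (∑ a, u q.1 a * u q.2 a) ∂(μ.prod μ)
  set c : ℝ := Fintype.card A * B ^ 2
  have hpos : ∀ g, 0 < p g := fun g => (Real.exp_pos _).trans_le (hbd g).1
  have ip : Integrable p (gaussPi A) := by
    refine integrable_of_gauss_dom hpm (C := Real.exp c) (K := B) fun g => ?_
    rw [abs_of_pos (hpos g), ← Real.exp_add, add_comm]
    exact (hbd g).2
  have ip2 : Integrable (fun g => p g ^ 2) (gaussPi A) := by
    refine integrable_of_gauss_dom (hpm.pow_const 2) (C := Real.exp (2 * c)) (K := 2 * B)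
      fun g => ?_
    rw [abs_of_pos (pow_pos (hpos g) 2), ← Real.exp_add]
    refine (pow_le_pow_left₀ (hpos g).le (hbd g).2 2).trans (le_of_eq ?_)
    rw [← Real.exp_nat_mul]
    congr 1; push_cast; ring
  have hcn : 0 ≤ c := by positivity
  have iF : Integrable (fun g => F (z * p g)) (gaussPi A) := by
    refine integrable_of_gauss_dom (hF.meas.comp (hpm.const_mul z))
      (C := 4 * Real.exp (2 * (c + |Real.log z|))) (K := 2 * B) fun g => ?_
    have hS : 0 ≤ ∑ a, |g a| := Finset.sum_nonneg fun _ _ => abs_nonneg _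
    have := growth_bound hF.growth (x := z * p g) (c := B * ∑ a, |g a| + c + |Real.log z|)
      (by positivity) ?_ ?_
    · refine this.trans (le_of_eq ?_)
      rw [mul_assoc, ← Real.exp_add]
      congr 2; ring
    · have : Real.exp (Real.log z) * Real.exp (-(B * ∑ a, |g a| + c)) ≤ z * p g := by
        rw [Real.exp_log hz]
        exact mul_le_mul_of_nonneg_left (hbd g).1 hz.le
      rw [← Real.exp_add] at this
      refine le_trans (Real.exp_le_exp.2 ?_) this
      linarith [neg_abs_le (Real.log z)]
    · have : z * p g ≤ Real.exp (Real.log z) * Real.exp (B * ∑ a, |g a| + c) := by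
        rw [Real.exp_log hz]
        exact mul_le_mul_of_nonneg_left (hbd g).2 hz.le
      rw [← Real.exp_add] at this
      refine le_trans this (Real.exp_le_exp.2 ?_)
      linarith [le_abs_self (Real.log z)]
  have e : ∫ g, (F (z * p g) + -F z + (-α * p g + α) +
      (-(b z / 2) * p g ^ 2 + (b z * p g + -(b z / 2)))) ∂(gaussPi A) =
      ∫ g, F (z * p g) ∂(gaussPi A) - F z - b z / 2 * (m - 1) := by
    have i1 : Integrable (fun g => F (z * p g) + -F z) (gaussPi A) := iF.add (integrable_const _)
    have i2 : Integrable (fun g => -α * p g + α) (gaussPi A) :=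
      (ip.const_mul _).add (integrable_const _)
    have i3 : Integrable (fun g => b z * p g + -(b z / 2)) (gaussPi A) :=
      (ip.const_mul _).add (integrable_const _)
    have i4 : Integrable (fun g => -(b z / 2) * p g ^ 2 + (b z * p g + -(b z / 2))) (gaussPi A) :=
      (ip2.const_mul _).add i3
    have i5 : Integrable (fun g => F (z * p g) + -F z + (-α * p g + α)) (gaussPi A) := i1.add i2
    rw [integral_add i5 i4, integral_add i1 i2, integral_add (ip2.const_mul _) i3,
      integral_add iF (integrable_const _), integral_add (ip.const_mul _) (integrable_const _),
      integral_add (ip.const_mul _) (integrable_const _)]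
    simp only [integral_const_mul, integral_const, probReal_univ, smul_eq_mul, one_mul]
    rw [h1, h2]
    ring
  rw [← e, ← Real.norm_eq_abs]
  refine (norm_integral_le_of_norm_le (hRi.const_mul (1 + z)) (Filter.Eventually.of_forall
    fun g => ?_)).trans ?_
  · rw [Real.norm_eq_abs]
    refine le_trans (le_of_eq ?_) (hα (p g) (hpos g))
    congr 1; ring
  · rw [integral_const_mul]
    exact mul_le_mul_of_nonneg_left hR (by linarith)

end Step

section Kahane

variable {A A' : Type*} [Fintype A] [Fintype A'] {Ω : Type*} [MeasurableSpace Ω]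

lemma kahane_pointwise {F b : ℝ → ℝ} (hF : IsKahane F b) {ν : Measure Ω} [IsProbabilityMeasure ν]
    {W : Ω → ℝ} (hWi : Integrable (fun σ => Real.exp (W σ)) ν)
    {u : Ω → A → ℝ} {v : Ω → A' → ℝ} (hu : Measurable u) (hv : Measurable v) {B : ℝ} (hB0 : 0 ≤ B)
    (hBu : ∀ᵐ σ ∂ν, ∀ a, |u σ a| ≤ B) (hBv : ∀ᵐ σ ∂ν, ∀ a, |v σ a| ≤ B) {t : ℝ} (ht : 0 < t)
    (ht1 : t ^ 2 ≤ 1 / 6) (hut : ∀ᵐ σ ∂ν, ∑ a, u σ a ^ 2 ≤ t ^ 2)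
    (hvt : ∀ᵐ σ ∂ν, ∑ a, v σ a ^ 2 ≤ t ^ 2)
    (hcov : ∀ σ τ, ∑ a, v σ a * v τ a ≤ ∑ a, u σ a * u τ a) :
    ∫ h, F (∫ σ, Real.exp (W σ) * gaussExp (v σ) h ∂ν) ∂(gaussPi A') ≤
      ∫ g, F (∫ σ, Real.exp (W σ) * gaussExp (u σ) g ∂ν) ∂(gaussPi A) +
        (1 + ∫ σ, Real.exp (W σ) ∂ν) * (200 * t ^ 3) := by
  have hz : 0 < ∫ σ, Real.exp (W σ) ∂ν := integral_exp_pos hWi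
  have : IsProbabilityMeasure (ν.tilted W) := isProbabilityMeasure_tilted hWi
  have hac := tilted_absolutelyContinuous ν W
  have e : ∀ f : Ω → ℝ, ∫ σ, Real.exp (W σ) * f σ ∂ν =
      (∫ σ, Real.exp (W σ) ∂ν) * ∫ σ, f σ ∂(ν.tilted W) := by
    intro f
    rw [integral_tilted, ← integral_const_mul]
    refine integral_congr_ae (Filter.Eventually.of_forall fun σ => ?_)
    simp only [smul_eq_mul]
    field_simp
  simp_rw [e]
  have su := gauss_step hF hz (μ := ν.tilted W) hu hB0 (hac.ae_le hBu) ht ht1 (hac.ae_le hut)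
  have sv := gauss_step hF hz (μ := ν.tilted W) hv hB0 (hac.ae_le hBv) ht ht1 (hac.ae_le hvt)
  have hm : ∫ q : Ω × Ω, Real.exp (∑ a, v q.1 a * v q.2 a) ∂((ν.tilted W).prod (ν.tilted W)) ≤
      ∫ q : Ω × Ω, Real.exp (∑ a, u q.1 a * u q.2 a) ∂((ν.tilted W).prod (ν.tilted W)) := by
    have hmu : ∀ a, Measurable fun σ => u σ a := fun a => (measurable_pi_apply a).comp hu
    refine integral_mono_of_nonneg (Filter.Eventually.of_forall fun q => (Real.exp_pos _).le) ?_
      (Filter.Eventually.of_forall fun q => Real.exp_le_exp.2 (hcov _ _))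
    refine Integrable.of_bound (C := Real.exp (t ^ 2)) (by fun_prop) ?_
    have h1 := Measure.quasiMeasurePreserving_fst (μ := ν.tilted W) (ν := ν.tilted W)
      |>.ae (hac.ae_le hut)
    have h2 := Measure.quasiMeasurePreserving_snd (μ := ν.tilted W) (ν := ν.tilted W)
      |>.ae (hac.ae_le hut)
    filter_upwards [h1, h2] with q hq1 hq2
    rw [Real.norm_eq_abs, Real.abs_exp, Real.exp_le_exp]
    have : ∑ a, u q.1 a * u q.2 a ≤ ∑ a, (u q.1 a ^ 2 + u q.2 a ^ 2) / 2 :=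
      Finset.sum_le_sum fun a _ => by nlinarith [sq_nonneg (u q.1 a - u q.2 a)]
    rw [← Finset.sum_div, Finset.sum_add_distrib] at this
    linarith
  have hb := hF.b_nonneg _ hz
  have := mul_le_mul_of_nonneg_left hm hb
  rw [abs_le] at su sv
  nlinarith [su.1, sv.2]

/-- The functional interpolating between two Gaussian fields. -/
noncomputable def interp (F : ℝ → ℝ) (ν : Measure Ω) (w : Ω → ℝ) (u : Ω → A → ℝ) (v : Ω → A' → ℝ)
    (s r : ℝ) (x : A → ℝ) (y : A' → ℝ) : ℝ :=
  F (∫ σ, Real.exp (w σ + (∑ a, x a * u σ a - s * (∑ a, u σ a ^ 2) / 2) +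
    (∑ a, y a * v σ a - r * (∑ a, v σ a ^ 2) / 2)) ∂ν)

variable {F b : ℝ → ℝ} {ν : Measure Ω} [IsProbabilityMeasure ν]
    {w : Ω → ℝ} {u : Ω → A → ℝ} {v : Ω → A' → ℝ} {B : ℝ}

omit [MeasurableSpace Ω] in
lemma interp_exponent_le {s r : ℝ} (hs : s ∈ Set.Icc (0 : ℝ) 1) (hr : r ∈ Set.Icc (0 : ℝ) 1)
    {σ : Ω} (hw : |w σ| ≤ B)
    (hu : ∀ a, |u σ a| ≤ B) (hv : ∀ a, |v σ a| ≤ B) (x : A → ℝ) (y : A' → ℝ) :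
    |w σ + (∑ a, x a * u σ a - s * (∑ a, u σ a ^ 2) / 2) +
      (∑ a, y a * v σ a - r * (∑ a, v σ a ^ 2) / 2)| ≤
    (B + Fintype.card A * B ^ 2 + Fintype.card A' * B ^ 2) +
      B * ∑ a, |x a| + B * ∑ a, |y a| := by
  have h1 := abs_le.1 (abs_dot_le (g := x) hu)
  have h2 := sum_sq_le_card hu
  have h3 : 0 ≤ ∑ a, u σ a ^ 2 := Finset.sum_nonneg fun a _ => sq_nonneg _
  have h1' := abs_le.1 (abs_dot_le (g := y) hv)
  have h2' := sum_sq_le_card hv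
  have h3' : 0 ≤ ∑ a, v σ a ^ 2 := Finset.sum_nonneg fun a _ => sq_nonneg _
  have h4 := mul_le_of_le_one_left h3 hs.2
  have h4' := mul_le_of_le_one_left h3' hr.2
  have h5 := mul_nonneg hs.1 h3
  have h5' := mul_nonneg hr.1 h3'
  have h6 := abs_le.1 hw
  rw [abs_le]
  constructor <;> linarith [h1.1, h1.2, h1'.1, h1'.2, h6.1, h6.2]

lemma interp_integrable (hwm : Measurable w) (hum : Measurable u) (hvm : Measurable v)
    {s r : ℝ} (hs : s ∈ Set.Icc (0 : ℝ) 1) (hr : r ∈ Set.Icc (0 : ℝ) 1)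
    (hw : ∀ᵐ σ ∂ν, |w σ| ≤ B)
    (hu : ∀ᵐ σ ∂ν, ∀ a, |u σ a| ≤ B) (hv : ∀ᵐ σ ∂ν, ∀ a, |v σ a| ≤ B) (x : A → ℝ) (y : A' → ℝ) :
    Integrable (fun σ => Real.exp (w σ + (∑ a, x a * u σ a - s * (∑ a, u σ a ^ 2) / 2) +
      (∑ a, y a * v σ a - r * (∑ a, v σ a ^ 2) / 2))) ν := by
  have hmu : ∀ a, Measurable fun σ => u σ a := fun a => (measurable_pi_apply a).comp hum
  have hmv : ∀ a, Measurable fun σ => v σ a := fun a => (measurable_pi_apply a).comp hvm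
  refine Integrable.of_bound (by fun_prop) (Real.exp
    ((B + Fintype.card A * B ^ 2 + Fintype.card A' * B ^ 2) +
      B * ∑ a, |x a| + B * ∑ a, |y a|)) ?_
  filter_upwards [hw, hu, hv] with σ h1 h2 h3
  rw [Real.norm_eq_abs, Real.abs_exp, Real.exp_le_exp]
  exact (le_abs_self _).trans (interp_exponent_le hs hr h1 h2 h3 x y)

lemma interp_partition_bounds (hwm : Measurable w) (hum : Measurable u) (hvm : Measurable v)
    {s r : ℝ} (hs : s ∈ Set.Icc (0 : ℝ) 1) (hr : r ∈ Set.Icc (0 : ℝ) 1)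
    (hw : ∀ᵐ σ ∂ν, |w σ| ≤ B)
    (hu : ∀ᵐ σ ∂ν, ∀ a, |u σ a| ≤ B) (hv : ∀ᵐ σ ∂ν, ∀ a, |v σ a| ≤ B) (x : A → ℝ) (y : A' → ℝ) :
    Real.exp (-((B + Fintype.card A * B ^ 2 + Fintype.card A' * B ^ 2) +
      B * ∑ a, |x a| + B * ∑ a, |y a|)) ≤
      ∫ σ, Real.exp (w σ + (∑ a, x a * u σ a - s * (∑ a, u σ a ^ 2) / 2) +
      (∑ a, y a * v σ a - r * (∑ a, v σ a ^ 2) / 2)) ∂ν ∧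
    ∫ σ, Real.exp (w σ + (∑ a, x a * u σ a - s * (∑ a, u σ a ^ 2) / 2) +
      (∑ a, y a * v σ a - r * (∑ a, v σ a ^ 2) / 2)) ∂ν ≤
      Real.exp ((B + Fintype.card A * B ^ 2 + Fintype.card A' * B ^ 2) +
        B * ∑ a, |x a| + B * ∑ a, |y a|) := by
  have hi := interp_integrable hwm hum hvm hs hr hw hu hv x y
  constructor
  · have := integral_mono_ae (integrable_const (μ := ν) _) hi (by
        filter_upwards [hw, hu, hv] with σ h1 h2 h3
        exact Real.exp_le_exp.2 (abs_le.1 (interp_exponent_le hs hr h1 h2 h3 x y)).1)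
    simpa using this
  · have := integral_mono_ae hi (integrable_const (μ := ν) _) (by
        filter_upwards [hw, hu, hv] with σ h1 h2 h3
        exact Real.exp_le_exp.2 (abs_le.1 (interp_exponent_le hs hr h1 h2 h3 x y)).2)
    simpa using this

lemma abs_interp_le (hF : IsKahane F b) (hB0 : 0 ≤ B)
    (hwm : Measurable w) (hum : Measurable u) (hvm : Measurable v)
    {s r : ℝ} (hs : s ∈ Set.Icc (0 : ℝ) 1) (hr : r ∈ Set.Icc (0 : ℝ) 1)
    (hw : ∀ᵐ σ ∂ν, |w σ| ≤ B)
    (hu : ∀ᵐ σ ∂ν, ∀ a, |u σ a| ≤ B) (hv : ∀ᵐ σ ∂ν, ∀ a, |v σ a| ≤ B) (x : A → ℝ) (y : A' → ℝ) :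
    |interp F ν w u v s r x y| ≤
      4 * Real.exp (2 * (B + Fintype.card A * B ^ 2 + Fintype.card A' * B ^ 2)) *
        (Real.exp (2 * B * ∑ a, |x a|) * Real.exp (2 * B * ∑ a, |y a|)) := by
  obtain ⟨h1, h2⟩ := interp_partition_bounds hwm hum hvm hs hr hw hu hv x y
  have hx : 0 ≤ ∑ a, |x a| := Finset.sum_nonneg fun _ _ => abs_nonneg _
  have hy : 0 ≤ ∑ a, |y a| := Finset.sum_nonneg fun _ _ => abs_nonneg _
  refine (growth_bound hF.growth (by positivity) h1 h2).trans (le_of_eq ?_)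
  rw [mul_assoc, ← Real.exp_add, ← Real.exp_add]
  congr 2; ring

lemma measurable_interp (hF : IsKahane F b)
    (hwm : Measurable w) (hum : Measurable u) (hvm : Measurable v) (s r : ℝ) :
    Measurable (fun p : (A → ℝ) × (A' → ℝ) => interp F ν w u v s r p.1 p.2) := by
  have hmu : ∀ a, Measurable fun σ => u σ a := fun a => (measurable_pi_apply a).comp hum
  have hmv : ∀ a, Measurable fun σ => v σ a := fun a => (measurable_pi_apply a).comp hvm
  refine hF.meas.comp (measurable_integral_param ?_)
  unfold Function.uncurry
  fun_prop

lemma exp_sum_abs_smul_add_le {K a c : ℝ} (hK : 0 ≤ K) (ha : |a| ≤ 1) (hc : |c| ≤ 1)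
    (x y : A → ℝ) :
    Real.exp (K * ∑ i, |(a • x + c • y) i|) ≤
      Real.exp (K * ∑ i, |x i|) * Real.exp (K * ∑ i, |y i|) := by
  rw [← Real.exp_add, Real.exp_le_exp, ← mul_add, ← Finset.sum_add_distrib]
  refine mul_le_mul_of_nonneg_left (Finset.sum_le_sum fun i _ => ?_) hK
  simp only [Pi.add_apply, Pi.smul_apply, smul_eq_mul]
  refine (abs_add_le _ _).trans (add_le_add ?_ ?_) <;> rw [abs_mul]
  · exact mul_le_of_le_one_left (abs_nonneg _) ha
  · exact mul_le_of_le_one_left (abs_nonneg _) hc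

lemma exp_sum_abs_smul_le {K a : ℝ} (hK : 0 ≤ K) (ha : |a| ≤ 1) (x : A → ℝ) :
    Real.exp (K * ∑ i, |(a • x) i|) ≤ Real.exp (K * ∑ i, |x i|) := by
  refine Real.exp_le_exp.2 (mul_le_mul_of_nonneg_left (Finset.sum_le_sum fun i _ => ?_) hK)
  simp only [Pi.smul_apply, smul_eq_mul]
  rw [abs_mul]
  exact mul_le_of_le_one_left (abs_nonneg _) ha


end Kahane

section KahaneStep

variable {A A' : Type*} [Fintype A] [Fintype A'] {Ω : Type*} [MeasurableSpace Ω]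
  {F b : ℝ → ℝ} {ν : Measure Ω} [IsProbabilityMeasure ν]
    {w : Ω → ℝ} {u : Ω → A → ℝ} {v : Ω → A' → ℝ} {B : ℝ}

/-- Expectation of the interpolating functional at variances `s` and `r`. -/
noncomputable def interpMean (F : ℝ → ℝ) (ν : Measure Ω) (w : Ω → ℝ) (u : Ω → A → ℝ)
    (v : Ω → A' → ℝ) (s r : ℝ) : ℝ :=
  ∫ g, ∫ h, interp F ν w u v s r (√s • g) (√r • h) ∂(gaussPi A') ∂(gaussPi A)

lemma abs_sqrt_le_one {s : ℝ} (hs : s ≤ 1) : |√s| ≤ 1 := by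
  rw [abs_of_nonneg (Real.sqrt_nonneg _)]; exact Real.sqrt_le_one.2 hs

lemma interpMean_left (hF : IsKahane F b) (hB0 : 0 ≤ B)
    (hwm : Measurable w) (hum : Measurable u) (hvm : Measurable v)
    (hw : ∀ᵐ σ ∂ν, |w σ| ≤ B)
    (hu : ∀ᵐ σ ∂ν, ∀ a, |u σ a| ≤ B) (hv : ∀ᵐ σ ∂ν, ∀ a, |v σ a| ≤ B)
    {s r δ : ℝ} (hs : 0 ≤ s) (hr : 0 ≤ r) (hδ : 0 ≤ δ) (h1 : s + r + δ ≤ 1) :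
    Integrable (fun g : A → ℝ => ∫ h, ∫ g', interp F ν w u v (s + δ) r (√s • g + √δ • g') (√r • h)
      ∂(gaussPi A) ∂(gaussPi A')) (gaussPi A) ∧
    (∀ g : A → ℝ, Integrable (fun h => ∫ g', interp F ν w u v (s + δ) r (√s • g + √δ • g') (√r • h)
      ∂(gaussPi A)) (gaussPi A')) ∧
    interpMean F ν w u v (s + δ) r =
      ∫ g, ∫ h, ∫ g', interp F ν w u v (s + δ) r (√s • g + √δ • g') (√r • h)
      ∂(gaussPi A) ∂(gaussPi A') ∂(gaussPi A) := by
  have hsδ : s + δ ∈ Set.Icc (0 : ℝ) 1 := ⟨by linarith, by linarith⟩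
  have hr1 : r ∈ Set.Icc (0 : ℝ) 1 := ⟨hr, by linarith⟩
  have hQ := measurable_interp (ν := ν) hF hwm hum hvm (s + δ) r
  have hbd := abs_interp_le hF hB0 hwm hum hvm hsδ hr1 hw hu hv
  set C := 4 * Real.exp (2 * (B + Fintype.card A * B ^ 2 + Fintype.card A' * B ^ 2)) with hC
  have hC0 : 0 ≤ C := by positivity
  have hK : 0 ≤ 2 * B := by positivity
  have hsq : ∀ g g' : A → ℝ, ∀ h : A' → ℝ,
      |interp F ν w u v (s + δ) r (√s • g + √δ • g') (√r • h)| ≤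
      C * (Real.exp (2 * B * ∑ a, |g a|) * Real.exp (2 * B * ∑ a, |g' a|) *
        Real.exp (2 * B * ∑ a, |h a|)) := by
    intro g g' h
    refine (hbd _ _).trans (mul_le_mul_of_nonneg_left (mul_le_mul ?_ ?_ ?_ ?_) hC0)
    · exact exp_sum_abs_smul_add_le hK (abs_sqrt_le_one (by linarith))
        (abs_sqrt_le_one (by linarith)) _ _
    · exact exp_sum_abs_smul_le hK (abs_sqrt_le_one (by linarith)) _
    · positivity
    · positivity
  have ig := integrable_exp_mul_sum_abs (A := A) (2 * B)
  have ih := integrable_exp_mul_sum_abs (A := A') (2 * B)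
  have I2 : ∀ g : A → ℝ, Integrable (fun q : (A' → ℝ) × (A → ℝ) =>
      interp F ν w u v (s + δ) r (√s • g + √δ • q.2) (√r • q.1))
      ((gaussPi A').prod (gaussPi A)) := by
    intro g
    have := ((ih.mul_prod ig).const_mul (C * Real.exp (2 * B * ∑ a, |g a|)))
    refine this.mono' ?_ (Filter.Eventually.of_forall fun q => ?_)
    · exact (hQ.comp (f := fun q : (A' → ℝ) × (A → ℝ) => (√s • g + √δ • q.2, √r • q.1))
        (by fun_prop)).aestronglyMeasurable
    · refine (hsq _ _ _).trans (le_of_eq ?_)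
      ring
  have I3 : Integrable (fun q : (A → ℝ) × (A' → ℝ) × (A → ℝ) =>
      interp F ν w u v (s + δ) r (√s • q.1 + √δ • q.2.2) (√r • q.2.1))
      ((gaussPi A).prod ((gaussPi A').prod (gaussPi A))) := by
    have := ((ig.mul_prod (ih.mul_prod ig)).const_mul C)
    refine this.mono' ?_ (Filter.Eventually.of_forall fun q => ?_)
    · exact (hQ.comp (f := fun q : (A → ℝ) × (A' → ℝ) × (A → ℝ) =>
        (√s • q.1 + √δ • q.2.2, √r • q.2.1)) (by fun_prop)).aestronglyMeasurable
    · refine (hsq _ _ _).trans (le_of_eq ?_)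
      ring
  have E2 : ∀ g : A → ℝ, ∫ q, interp F ν w u v (s + δ) r (√s • g + √δ • q.2) (√r • q.1)
      ∂((gaussPi A').prod (gaussPi A)) =
      ∫ h, ∫ g', interp F ν w u v (s + δ) r (√s • g + √δ • g') (√r • h)
      ∂(gaussPi A) ∂(gaussPi A') := fun g => integral_prod _ (I2 g)
  refine ⟨?_, fun g => (I2 g).integral_prod_left, ?_⟩
  · have := I3.integral_prod_left
    simp_rw [E2] at this
    exact this
  · unfold interpMean
    have hmeas : Measurable fun x : A → ℝ =>
        ∫ h, interp F ν w u v (s + δ) r x (√r • h) ∂(gaussPi A') := by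
      refine measurable_integral_param ?_
      exact hQ.comp (f := fun q : (A → ℝ) × (A' → ℝ) => (q.1, √r • q.2)) (by fun_prop)
    rw [integral_stable (a := √s) (b := √δ)
      (by rw [Real.sq_sqrt hs, Real.sq_sqrt hδ, Real.sq_sqrt hsδ.1]) hmeas]
    have I4 : Integrable (fun q : ((A → ℝ) × (A → ℝ)) × (A' → ℝ) =>
        interp F ν w u v (s + δ) r (√s • q.1.1 + √δ • q.1.2) (√r • q.2))
        (((gaussPi A).prod (gaussPi A)).prod (gaussPi A')) := by
      have := (((ig.mul_prod ig).mul_prod ih).const_mul C)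
      refine this.mono' ?_ (Filter.Eventually.of_forall fun q => hsq _ _ _)
      exact (hQ.comp (f := fun q : ((A → ℝ) × (A → ℝ)) × (A' → ℝ) =>
        (√s • q.1.1 + √δ • q.1.2, √r • q.2)) (by fun_prop)).aestronglyMeasurable
    rw [integral_prod _ I4.integral_prod_left]
    refine integral_congr_ae (Filter.Eventually.of_forall fun g => ?_)
    exact (integral_integral_swap (I2 g)).symm

lemma interpMean_right (hF : IsKahane F b) (hB0 : 0 ≤ B)
    (hwm : Measurable w) (hum : Measurable u) (hvm : Measurable v)
    (hw : ∀ᵐ σ ∂ν, |w σ| ≤ B)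
    (hu : ∀ᵐ σ ∂ν, ∀ a, |u σ a| ≤ B) (hv : ∀ᵐ σ ∂ν, ∀ a, |v σ a| ≤ B)
    {s r δ : ℝ} (hs : 0 ≤ s) (hr : 0 ≤ r) (hδ : 0 ≤ δ) (h1 : s + r + δ ≤ 1) :
    Integrable (fun g : A → ℝ => ∫ h, ∫ h', interp F ν w u v s (r + δ) (√s • g) (√r • h + √δ • h')
      ∂(gaussPi A') ∂(gaussPi A')) (gaussPi A) ∧
    (∀ g : A → ℝ, Integrable (fun h => ∫ h', interp F ν w u v s (r + δ) (√s • g) (√r • h + √δ • h')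
      ∂(gaussPi A')) (gaussPi A')) ∧
    interpMean F ν w u v s (r + δ) =
      ∫ g, ∫ h, ∫ h', interp F ν w u v s (r + δ) (√s • g) (√r • h + √δ • h')
      ∂(gaussPi A') ∂(gaussPi A') ∂(gaussPi A) := by
  have hrδ : r + δ ∈ Set.Icc (0 : ℝ) 1 := ⟨by linarith, by linarith⟩
  have hs1 : s ∈ Set.Icc (0 : ℝ) 1 := ⟨hs, by linarith⟩
  have hQ := measurable_interp (ν := ν) hF hwm hum hvm s (r + δ)
  have hbd := abs_interp_le hF hB0 hwm hum hvm hs1 hrδ hw hu hv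
  set C := 4 * Real.exp (2 * (B + Fintype.card A * B ^ 2 + Fintype.card A' * B ^ 2)) with hC
  have hC0 : 0 ≤ C := by positivity
  have hK : 0 ≤ 2 * B := by positivity
  have hsq : ∀ g : A → ℝ, ∀ h h' : A' → ℝ,
      |interp F ν w u v s (r + δ) (√s • g) (√r • h + √δ • h')| ≤
      C * (Real.exp (2 * B * ∑ a, |g a|) * (Real.exp (2 * B * ∑ a, |h a|) *
        Real.exp (2 * B * ∑ a, |h' a|))) := by
    intro g h h'
    refine (hbd _ _).trans (mul_le_mul_of_nonneg_left (mul_le_mul ?_ ?_ ?_ ?_) hC0)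
    · exact exp_sum_abs_smul_le hK (abs_sqrt_le_one (by linarith)) _
    · exact exp_sum_abs_smul_add_le hK (abs_sqrt_le_one (by linarith))
        (abs_sqrt_le_one (by linarith)) _ _
    · positivity
    · positivity
  have ig := integrable_exp_mul_sum_abs (A := A) (2 * B)
  have ih := integrable_exp_mul_sum_abs (A := A') (2 * B)
  have I2 : ∀ g : A → ℝ, Integrable (fun q : (A' → ℝ) × (A' → ℝ) =>
      interp F ν w u v s (r + δ) (√s • g) (√r • q.1 + √δ • q.2))
      ((gaussPi A').prod (gaussPi A')) := by
    intro g
    have := ((ih.mul_prod ih).const_mul (C * Real.exp (2 * B * ∑ a, |g a|)))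
    refine this.mono' ?_ (Filter.Eventually.of_forall fun q => ?_)
    · exact (hQ.comp (f := fun q : (A' → ℝ) × (A' → ℝ) => (√s • g, √r • q.1 + √δ • q.2))
        (by fun_prop)).aestronglyMeasurable
    · refine (hsq _ _ _).trans (le_of_eq ?_)
      ring
  have I3 : Integrable (fun q : (A → ℝ) × (A' → ℝ) × (A' → ℝ) =>
      interp F ν w u v s (r + δ) (√s • q.1) (√r • q.2.1 + √δ • q.2.2))
      ((gaussPi A).prod ((gaussPi A').prod (gaussPi A'))) := by
    have := ((ig.mul_prod (ih.mul_prod ih)).const_mul C)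
    refine this.mono' ?_ (Filter.Eventually.of_forall fun q => hsq _ _ _)
    exact (hQ.comp (f := fun q : (A → ℝ) × (A' → ℝ) × (A' → ℝ) =>
      (√s • q.1, √r • q.2.1 + √δ • q.2.2)) (by fun_prop)).aestronglyMeasurable
  have E2 : ∀ g : A → ℝ, ∫ q, interp F ν w u v s (r + δ) (√s • g) (√r • q.1 + √δ • q.2)
      ∂((gaussPi A').prod (gaussPi A')) =
      ∫ h, ∫ h', interp F ν w u v s (r + δ) (√s • g) (√r • h + √δ • h')
      ∂(gaussPi A') ∂(gaussPi A') := fun g => integral_prod _ (I2 g)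
  refine ⟨?_, fun g => (I2 g).integral_prod_left, ?_⟩
  · have := I3.integral_prod_left
    simp_rw [E2] at this
    exact this
  · unfold interpMean
    refine integral_congr_ae (Filter.Eventually.of_forall fun g => ?_)
    simp only
    rw [← E2, integral_stable (a := √r) (b := √δ)
      (by rw [Real.sq_sqrt hr, Real.sq_sqrt hδ, Real.sq_sqrt hrδ.1])]
    exact hQ.comp (f := fun q : (A' → ℝ) => (√s • g, q)) (by fun_prop)

omit [IsProbabilityMeasure ν] in
lemma interp_add_left (s r δ : ℝ) (hδ : 0 ≤ δ) (x g : A → ℝ) (y : A' → ℝ) :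
    interp F ν w u v (s + δ) r (x + √δ • g) y =
      F (∫ σ, Real.exp (w σ + (∑ a, x a * u σ a - s * (∑ a, u σ a ^ 2) / 2) +
    (∑ a, y a * v σ a - r * (∑ a, v σ a ^ 2) / 2)) * gaussExp (√δ • u σ) g ∂ν) := by
  unfold interp gaussExp
  congr 2
  ext σ
  rw [← Real.exp_add]
  congr 1
  simp only [Pi.add_apply, Pi.smul_apply, smul_eq_mul, mul_pow, Real.sq_sqrt hδ, add_mul,
    Finset.sum_add_distrib, ← Finset.mul_sum]
  have : ∑ a, g a * (√δ * u σ a) = ∑ a, √δ * g a * u σ a :=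
    Finset.sum_congr rfl fun a _ => by ring
  rw [this]; ring

omit [IsProbabilityMeasure ν] in
lemma interp_add_right (s r δ : ℝ) (hδ : 0 ≤ δ) (x : A → ℝ) (y h : A' → ℝ) :
    interp F ν w u v s (r + δ) x (y + √δ • h) =
      F (∫ σ, Real.exp (w σ + (∑ a, x a * u σ a - s * (∑ a, u σ a ^ 2) / 2) +
    (∑ a, y a * v σ a - r * (∑ a, v σ a ^ 2) / 2)) * gaussExp (√δ • v σ) h ∂ν) := by
  unfold interp gaussExp
  congr 2
  ext σ
  rw [← Real.exp_add]
  congr 1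
  simp only [Pi.add_apply, Pi.smul_apply, smul_eq_mul, mul_pow, Real.sq_sqrt hδ, add_mul,
    Finset.sum_add_distrib, ← Finset.mul_sum]
  have : ∑ a, h a * (√δ * v σ a) = ∑ a, √δ * h a * v σ a :=
    Finset.sum_congr rfl fun a _ => by ring
  rw [this]; ring

/-- One infinitesimal step of the interpolation, with a uniform error of order `δ ^ (3/2)`. -/
lemma exists_interpMean_step (hF : IsKahane F b) (hB0 : 0 ≤ B)
    (hwm : Measurable w) (hum : Measurable u) (hvm : Measurable v)
    (hw : ∀ᵐ σ ∂ν, |w σ| ≤ B)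
    (hu : ∀ᵐ σ ∂ν, ∀ a, |u σ a| ≤ B) (hv : ∀ᵐ σ ∂ν, ∀ a, |v σ a| ≤ B)
    (hcov : ∀ σ τ, ∑ a, v σ a * v τ a ≤ ∑ a, u σ a * u τ a) :
    ∃ E K : ℝ, 0 < K ∧ ∀ s r δ : ℝ, 0 ≤ s → 0 ≤ r → 0 < δ → s + r + δ ≤ 1 → δ * K ≤ 1 / 6 →
      interpMean F ν w u v s (r + δ) ≤ interpMean F ν w u v (s + δ) r + E * √(δ * K) ^ 3 := by
  set D : ℝ := B + Fintype.card A * B ^ 2 + Fintype.card A' * B ^ 2 with hD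
  have ig := integrable_exp_mul_sum_abs (A := A) B
  have ih := integrable_exp_mul_sum_abs (A := A') B
  refine ⟨∫ g : A → ℝ, ∫ h : A' → ℝ, (1 + Real.exp D * (Real.exp (B * ∑ a, |g a|) *
    Real.exp (B * ∑ a, |h a|))) * 200 ∂(gaussPi A') ∂(gaussPi A),
    Fintype.card A * B ^ 2 + Fintype.card A' * B ^ 2 + 1, by positivity, ?_⟩
  intro s r δ hs hr hδ h1 hK
  set K : ℝ := Fintype.card A * B ^ 2 + Fintype.card A' * B ^ 2 + 1 with hKd
  have hK0 : 0 < K := by positivity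
  have ht2 : √(δ * K) ^ 2 = δ * K := Real.sq_sqrt (by positivity)
  have ht : 0 < √(δ * K) := Real.sqrt_pos.2 (by positivity)
  set t := √(δ * K)
  obtain ⟨L1, L2, L3⟩ := interpMean_left hF hB0 hwm hum hvm hw hu hv hs hr hδ.le h1
  obtain ⟨R1, R2, R3⟩ := interpMean_right hF hB0 hwm hum hvm hw hu hv hs hr hδ.le h1
  have hδ1 : |√δ| ≤ 1 := abs_sqrt_le_one (by linarith)
  have scale : ∀ x : ℝ, |x| ≤ B → |√δ * x| ≤ B := fun x hx => by
    rw [abs_mul]; exact (mul_le_of_le_one_left (abs_nonneg _) hδ1).trans hx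
  have pt : ∀ g h, ∫ h', interp F ν w u v s (r + δ) (√s • g) (√r • h + √δ • h') ∂(gaussPi A') ≤
      ∫ g', interp F ν w u v (s + δ) r (√s • g + √δ • g') (√r • h) ∂(gaussPi A) +
      t ^ 3 * ((1 + Real.exp D * (Real.exp (B * ∑ a, |g a|) * Real.exp (B * ∑ a, |h a|))) *
        200) := by
    intro g h
    have hs1 : s ∈ Set.Icc (0 : ℝ) 1 := ⟨hs, by linarith⟩
    have hr1 : r ∈ Set.Icc (0 : ℝ) 1 := ⟨hr, by linarith⟩
    have hi := interp_integrable hwm hum hvm hs1 hr1 hw hu hv (√s • g) (√r • h)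
    have hz := (interp_partition_bounds hwm hum hvm hs1 hr1 hw hu hv (√s • g) (√r • h)).2
    have := kahane_pointwise hF hi (u := fun σ => √δ • u σ) (v := fun σ => √δ • v σ)
      (by fun_prop) (by fun_prop) hB0 (by
        filter_upwards [hu] with σ hσ a using scale _ (hσ a)) (by
        filter_upwards [hv] with σ hσ a using scale _ (hσ a)) ht (by linarith) (by
        filter_upwards [hu] with σ hσ
        have := sum_sq_le_card hσ
        simp only [Pi.smul_apply, smul_eq_mul, mul_pow, Real.sq_sqrt hδ.le, ← Finset.mul_sum]
        rw [ht2]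
        refine mul_le_mul_of_nonneg_left (this.trans ?_) hδ.le
        have : 0 ≤ Fintype.card A' * B ^ 2 := by positivity
        linarith) (by
        filter_upwards [hv] with σ hσ
        have := sum_sq_le_card hσ
        simp only [Pi.smul_apply, smul_eq_mul, mul_pow, Real.sq_sqrt hδ.le, ← Finset.mul_sum]
        rw [ht2]
        refine mul_le_mul_of_nonneg_left (this.trans ?_) hδ.le
        have : 0 ≤ Fintype.card A * B ^ 2 := by positivity
        linarith) (by
        intro σ τ
        have e : ∀ x y : ℝ, √δ * x * (√δ * y) = δ * (x * y) := fun x y => by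
          rw [mul_mul_mul_comm, Real.mul_self_sqrt hδ.le]
        simp only [Pi.smul_apply, smul_eq_mul, e, ← Finset.mul_sum]
        exact mul_le_mul_of_nonneg_left (hcov σ τ) hδ.le)
    simp_rw [interp_add_left s r δ hδ.le, interp_add_right s r δ hδ.le]
    refine this.trans (add_le_add le_rfl ?_)
    have hz' := hz.trans (le_of_eq (Real.exp_add _ _))
    rw [Real.exp_add] at hz'
    have h3 := mul_le_mul (exp_sum_abs_smul_le hB0 (abs_sqrt_le_one hs1.2) g)
      (exp_sum_abs_smul_le hB0 (abs_sqrt_le_one hr1.2) h) (Real.exp_pos _).le (Real.exp_pos _).le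
    have h4 := mul_le_mul_of_nonneg_left h3 (Real.exp_pos D).le
    have h5 := hz'.trans ((mul_assoc _ _ _).le.trans h4)
    have h6 : 0 ≤ t ^ 3 := by positivity
    nlinarith [mul_le_mul_of_nonneg_left h5 h6]
  have IE1 : ∀ g : A → ℝ, Integrable (fun h : A' → ℝ => (1 + Real.exp D *
      (Real.exp (B * ∑ a, |g a|) * Real.exp (B * ∑ a, |h a|))) * 200) (gaussPi A') := fun g =>
    ((integrable_const _).add ((ih.const_mul _).const_mul _)).mul_const _
  have IE2 : Integrable (fun g : A → ℝ => ∫ h : A' → ℝ, (1 + Real.exp D *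
      (Real.exp (B * ∑ a, |g a|) * Real.exp (B * ∑ a, |h a|))) * 200 ∂(gaussPi A'))
      (gaussPi A) := by
    have : Integrable (fun q : (A → ℝ) × (A' → ℝ) => (1 + Real.exp D *
      (Real.exp (B * ∑ a, |q.1 a|) * Real.exp (B * ∑ a, |q.2 a|))) * 200)
      ((gaussPi A).prod (gaussPi A')) :=
      ((integrable_const _).add ((ig.mul_prod ih).const_mul _)).mul_const _
    exact this.integral_prod_left
  rw [L3, R3, mul_comm _ (t ^ 3), ← integral_const_mul, ← integral_add L1 (IE2.const_mul _)]
  refine integral_mono R1 (L1.add (IE2.const_mul _)) fun g => ?_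
  simp only
  rw [← integral_const_mul, ← integral_add (L2 g) ((IE1 g).const_mul _)]
  exact integral_mono (R2 g) ((L2 g).add ((IE1 g).const_mul _)) fun h => pt g h

/-- Kahane's comparison inequality. -/
theorem kahane_comparison (hF : IsKahane F b) (hB0 : 0 ≤ B)
    (hwm : Measurable w) (hum : Measurable u) (hvm : Measurable v)
    (hw : ∀ᵐ σ ∂ν, |w σ| ≤ B)
    (hu : ∀ᵐ σ ∂ν, ∀ a, |u σ a| ≤ B) (hv : ∀ᵐ σ ∂ν, ∀ a, |v σ a| ≤ B)
    (hcov : ∀ σ τ, ∑ a, v σ a * v τ a ≤ ∑ a, u σ a * u τ a) :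
    ∫ h, F (∫ σ, Real.exp (w σ) * gaussExp (v σ) h ∂ν) ∂(gaussPi A') ≤
      ∫ g, F (∫ σ, Real.exp (w σ) * gaussExp (u σ) g ∂ν) ∂(gaussPi A) := by
  obtain ⟨E, K, hK, hstep⟩ := exists_interpMean_step hF hB0 hwm hum hvm hw hu hv hcov
  have e0 : interpMean F ν w u v 0 1 =
      ∫ h, F (∫ σ, Real.exp (w σ) * gaussExp (v σ) h ∂ν) ∂(gaussPi A') := by
    unfold interpMean interp gaussExp
    simp [Real.exp_add]
  have e1 : interpMean F ν w u v 1 0 =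
      ∫ g, F (∫ σ, Real.exp (w σ) * gaussExp (u σ) g ∂ν) ∂(gaussPi A) := by
    unfold interpMean interp gaussExp
    simp [Real.exp_add]
  rw [← e0, ← e1]
  have main : ∀ N : ℕ, 6 * K ≤ N + 1 → interpMean F ν w u v 0 1 ≤
      interpMean F ν w u v 1 0 + E * K * √(K * (1 / ((N : ℝ) + 1))) := by
    intro N hN
    set δ : ℝ := 1 / (N + 1) with hδ
    have hδ0 : 0 < δ := by positivity
    have hNδ : ((N : ℝ) + 1) * δ = 1 := by rw [hδ]; field_simp
    have hδK : δ * K ≤ 1 / 6 := by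
      rw [hδ, one_div, inv_mul_le_iff₀ (by positivity)]; linarith
    have ind : ∀ k : ℕ, k ≤ N + 1 → interpMean F ν w u v 0 1 ≤
        interpMean F ν w u v (k * δ) (1 - k * δ) + k * (E * √(δ * K) ^ 3) := by
      intro k
      induction k with
      | zero => simp
      | succ k ih =>
        intro hk
        refine (ih (by omega)).trans ?_
        have hk' : ((k : ℝ) + 1) * δ ≤ 1 := by
          refine le_trans (mul_le_mul_of_nonneg_right ?_ hδ0.le) hNδ.le
          exact_mod_cast hk
        have := hstep (k * δ) (1 - (k + 1) * δ) δ (by positivity) (by linarith) hδ0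
          (by linarith) hδK
        rw [show 1 - ((k : ℝ) + 1) * δ + δ = 1 - k * δ by ring,
          show (k : ℝ) * δ + δ = (k + 1) * δ by ring] at this
        push_cast
        linarith
    have := ind (N + 1) le_rfl
    push_cast at this
    rw [hNδ, sub_self] at this
    refine this.trans (add_le_add le_rfl (le_of_eq ?_))
    rw [pow_succ, Real.sq_sqrt (by positivity), mul_comm δ K]
    linear_combination (E * K * √(K * δ)) * hNδ
  have lim : Filter.Tendsto (fun N : ℕ => interpMean F ν w u v 1 0 +
      E * K * √(K * (1 / ((N : ℝ) + 1)))) Filter.atTop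
      (nhds (interpMean F ν w u v 1 0 + E * K * √(K * 0))) := by
    exact (((tendsto_one_div_add_atTop_nhds_zero_nat.const_mul K).sqrt).const_mul _).const_add _
  simp only [mul_zero, Real.sqrt_zero, add_zero] at lim
  refine ge_of_tendsto lim ?_
  obtain ⟨N0, hN0⟩ := exists_nat_ge (6 * K)
  filter_upwards [Filter.eventually_ge_atTop N0] with N hN
  refine main N (hN0.trans ?_)
  have : (N0 : ℝ) ≤ N := by exact_mod_cast hN
  linarith

end KahaneStep

section Planted

variable {A A' : Type*} [Fintype A] [Fintype A'] {Ω : Type*} [MeasurableSpace Ω]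

lemma abs_log_le_of_exp_bounds {x c : ℝ} (h1 : Real.exp (-c) ≤ x) (h2 : x ≤ Real.exp c) :
    |Real.log x| ≤ c := by
  have hx := (Real.exp_pos _).trans_le h1
  exact abs_le.2 ⟨(Real.le_log_iff_exp_le hx).2 h1, (Real.log_le_iff_le_exp hx).2 h2⟩

lemma abs_log_partition_le {μ : Measure Ω} [IsProbabilityMeasure μ] {u : Ω → A → ℝ}
    (hu : Measurable u) {B : ℝ} (hB : ∀ᵐ σ ∂μ, ∀ a, |u σ a| ≤ B) (g : A → ℝ) :
    |Real.log (∫ σ, gaussExp (u σ) g ∂μ)| ≤ B * ∑ a, |g a| + Fintype.card A * B ^ 2 :=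
  abs_log_le_of_exp_bounds (partition_bounds hu hB g).1 (partition_bounds hu hB g).2

/-- Averaging over a planted signal tilts the noise by the partition function. -/
lemma integral_planted {μ : Measure Ω} [IsProbabilityMeasure μ] {u : Ω → A → ℝ}
    (hu : Measurable u) {B : ℝ} (hB : ∀ᵐ σ ∂μ, ∀ a, |u σ a| ≤ B) {f : (A → ℝ) → ℝ}
    (hf : Measurable f) {C K : ℝ} (hfb : ∀ g, |f g| ≤ C * Real.exp (K * ∑ a, |g a|)) :
    ∫ τ, ∫ g, f (g + u τ) ∂(gaussPi A) ∂μ =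
      ∫ g, (∫ σ, gaussExp (u σ) g ∂μ) * f g ∂(gaussPi A) := by
  have e : ∀ τ, ∫ g, f (g + u τ) ∂(gaussPi A) = ∫ g, gaussExp (u τ) g * f g ∂(gaussPi A) :=
    fun τ => integral_shift (u τ) f
  simp_rw [e]
  rw [← integral_gauss_swap (C := Real.exp (Fintype.card A * B ^ 2) * C) (K := B + K)]
  · simp_rw [integral_mul_const]
  · unfold Function.uncurry
    exact (measurable_gaussExp_uncurry hu).mul (hf.comp measurable_fst)
  · filter_upwards [hB] with τ hτ g
    have h1 := gaussExp_rpow_bound hτ 1 g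
    simp only [abs_one, one_mul] at h1
    rw [abs_mul]
    refine (mul_le_mul h1 (hfb g) (abs_nonneg _) (by positivity)).trans (le_of_eq ?_)
    rw [add_mul, Real.exp_add]
    ring

lemma abs_log_partition_le_exp {μ : Measure Ω} [IsProbabilityMeasure μ] {u : Ω → A → ℝ}
    (hu : Measurable u) {B : ℝ} (hB : ∀ᵐ σ ∂μ, ∀ a, |u σ a| ≤ B) (g : A → ℝ) :
    |Real.log (∫ σ, gaussExp (u σ) g ∂μ)| ≤
      Real.exp (Fintype.card A * B ^ 2) * Real.exp (B * ∑ a, |g a|) := by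
  rw [← Real.exp_add, add_comm]
  exact (abs_log_partition_le hu hB g).trans
      ((le_add_of_nonneg_right zero_le_one).trans (Real.add_one_le_exp _))

lemma measurable_log_partition {μ : Measure Ω} [IsProbabilityMeasure μ] {u : Ω → A → ℝ}
    (hu : Measurable u) : Measurable fun g => Real.log (∫ σ, gaussExp (u σ) g ∂μ) :=
  Real.measurable_log.comp (measurable_integral_param (measurable_gaussExp_uncurry hu))

lemma integral_log_planted {μ : Measure Ω} [IsProbabilityMeasure μ] {u : Ω → A → ℝ}
    (hu : Measurable u) {B : ℝ} (hB : ∀ᵐ σ ∂μ, ∀ a, |u σ a| ≤ B) :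
    ∫ τ, ∫ g, Real.log (∫ σ, gaussExp (u σ) (g + u τ) ∂μ) ∂(gaussPi A) ∂μ =
      ∫ g, (∫ σ, gaussExp (u σ) g ∂μ) * Real.log (∫ σ, gaussExp (u σ) g ∂μ) ∂(gaussPi A) :=
  integral_planted hu hB (measurable_log_partition hu) (abs_log_partition_le_exp hu hB)

lemma integrable_log_partition {μ : Measure Ω} [IsProbabilityMeasure μ] {u : Ω → A → ℝ}
    (hu : Measurable u) {B : ℝ} (hB : ∀ᵐ σ ∂μ, ∀ a, |u σ a| ≤ B) (x : A → ℝ) :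
    Integrable (fun g => Real.log (∫ σ, gaussExp (u σ) (g + x) ∂μ)) (gaussPi A) := by
  have hp : Measurable fun g => ∫ σ, gaussExp (u σ) g ∂μ :=
    measurable_integral_param (measurable_gaussExp_uncurry hu)
  refine integrable_of_gauss_dom
    (C := Real.exp (|B| * ∑ a, |x a| + Fintype.card A * B ^ 2)) (K := |B|)
    (Real.measurable_log.comp (hp.comp (by fun_prop))) fun g => ?_
  refine (abs_log_partition_le hu hB (g + x)).trans
      ((le_add_of_nonneg_right zero_le_one).trans ((Real.add_one_le_exp _).trans ?_))
  rw [← Real.exp_add, Real.exp_le_exp]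
  have h1 : ∑ a, |(g + x) a| ≤ ∑ a, |g a| + ∑ a, |x a| := by
    rw [← Finset.sum_add_distrib]
    exact Finset.sum_le_sum fun a _ => abs_add_le _ _
  have h2 : 0 ≤ ∑ a, |(g + x) a| := Finset.sum_nonneg fun _ _ => abs_nonneg _
  nlinarith [mul_le_mul_of_nonneg_right (le_abs_self B) h2,
    mul_le_mul_of_nonneg_left h1 (abs_nonneg B)]

lemma integrable_integral_log_planted {μ : Measure Ω} [IsProbabilityMeasure μ] {u : Ω → A → ℝ}
    (hu : Measurable u) {B : ℝ} (hB : ∀ᵐ σ ∂μ, ∀ a, |u σ a| ≤ B) :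
    Integrable (fun τ => ∫ g, Real.log (∫ σ, gaussExp (u σ) (g + u τ) ∂μ) ∂(gaussPi A)) μ := by
  have hp : Measurable fun g => ∫ σ, gaussExp (u σ) g ∂μ :=
    measurable_integral_param (measurable_gaussExp_uncurry hu)
  have hI : Integrable (fun q : (A → ℝ) × Ω =>
      Real.log (∫ σ, gaussExp (u σ) (q.1 + u q.2) ∂μ)) ((gaussPi A).prod μ) := by
    refine integrable_prod_of_gauss_dom
      (C := Real.exp (|B| * (Fintype.card A * |B|) + Fintype.card A * B ^ 2)) (K := |B|)
      (Real.measurable_log.comp (hp.comp (by fun_prop))) ?_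
    filter_upwards [hB] with τ hτ g
    refine (abs_log_partition_le hu hB (g + u τ)).trans
        ((le_add_of_nonneg_right zero_le_one).trans ((Real.add_one_le_exp _).trans ?_))
    rw [← Real.exp_add, Real.exp_le_exp]
    have h1 : ∑ a, |(g + u τ) a| ≤ ∑ a, |g a| + ∑ a, |u τ a| := by
      rw [← Finset.sum_add_distrib]
      exact Finset.sum_le_sum fun a _ => abs_add_le _ _
    have h2 : 0 ≤ ∑ a, |(g + u τ) a| := Finset.sum_nonneg fun _ _ => abs_nonneg _
    have h3 : ∑ a, |u τ a| ≤ Fintype.card A * |B| := by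
      simpa using Finset.sum_le_card_nsmul Finset.univ (fun a => |u τ a|) |B|
        fun a _ => (hτ a).trans (le_abs_self B)
    nlinarith [mul_le_mul_of_nonneg_right (le_abs_self B) h2,
      mul_le_mul_of_nonneg_left (h1.trans (add_le_add le_rfl h3)) (abs_nonneg B)]
  exact hI.integral_prod_right

lemma integral_gaussPi_sum (f : (A ⊕ A' → ℝ) → ℝ) :
    ∫ g, f g ∂(gaussPi (A ⊕ A')) =
      ∫ p, f (Sum.elim p.1 p.2) ∂((gaussPi A).prod (gaussPi A')) :=
  ((measurePreserving_sumPiEquivProdPi_symm (X := fun _ : A ⊕ A' => ℝ) fun _ => stdGauss)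
    |>.integral_comp' f).symm

end Planted

section Scalar

/-- The partition function of the scalar Gaussian channel. -/
noncomputable def scalarPart (P0 : Measure ℝ) (q m X z : ℝ) : ℝ :=
  ∫ x, Real.exp (√q * z * x - q * x ^ 2 / 2 + m * x * X) ∂P0

/-- The mean log-partition function of the scalar Gaussian channel. -/
noncomputable def scalarMean (P0 : Measure ℝ) (q m : ℝ) : ℝ :=
  ∫ X, ∫ z, Real.log (scalarPart P0 q m X z) ∂stdGauss ∂P0

lemma ftpotWS_eq (P0 : Measure ℝ) (q : ℝ) : ftpotWS P0 q = q ^ 2 / 4 - scalarMean P0 q q := by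
  have e : ∀ x X z : ℝ, -(q * x ^ 2 / 2 - q * x * X - √q * x * z) =
      √q * z * x - q * x ^ 2 / 2 + q * x * X := fun x X z => by ring
  unfold ftpotWS scalarMean scalarPart
  simp_rw [e]

lemma integrable_abs_stdGauss : Integrable (fun z : ℝ => |z|) stdGauss := by
  have : Integrable (fun z : ℝ => z) (gaussianReal 0 1) :=
    (memLp_id_gaussianReal (μ := 0) (v := 1) 1).integrable le_rfl
  exact this.abs

variable {P0 : Measure ℝ} [IsProbabilityMeasure P0] {S : ℝ}

lemma measurable_scalarPart (q m : ℝ) :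
    Measurable (fun p : ℝ × ℝ => scalarPart P0 q m p.1 p.2) := by
  refine measurable_integral_param ?_
  unfold Function.uncurry
  fun_prop

lemma scalarPart_bounds (hP : ∀ᵐ x ∂P0, |x| ≤ S) {q : ℝ} (hq : 0 ≤ q) (m X z : ℝ) :
    Real.exp (-(√q * S * |z| + q * S ^ 2 / 2 + |m| * S * |X|)) ≤ scalarPart P0 q m X z ∧
      scalarPart P0 q m X z ≤ Real.exp (√q * S * |z| + q * S ^ 2 / 2 + |m| * S * |X|) := by
  have key : ∀ᵐ x ∂P0, |√q * z * x - q * x ^ 2 / 2 + m * x * X| ≤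
      √q * S * |z| + q * S ^ 2 / 2 + |m| * S * |X| := by
    filter_upwards [hP] with x hx
    refine (abs_add_le _ _).trans (add_le_add ((abs_sub _ _).trans (add_le_add ?_ ?_)) ?_)
    · rw [abs_mul, abs_mul, abs_of_nonneg (Real.sqrt_nonneg q)]
      have := mul_le_mul_of_nonneg_left hx (mul_nonneg (Real.sqrt_nonneg q) (abs_nonneg z))
      linarith
    · rw [abs_of_nonneg (by positivity)]
      have := mul_le_mul_of_nonneg_left (sq_le_sq' (abs_le.1 hx).1 (abs_le.1 hx).2) hq
      linarith
    · rw [abs_mul, abs_mul]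
      have := mul_le_mul_of_nonneg_left hx (mul_nonneg (abs_nonneg m) (abs_nonneg X))
      linarith
  have hi : Integrable (fun x => Real.exp (√q * z * x - q * x ^ 2 / 2 + m * x * X)) P0 := by
    refine Integrable.of_bound (by fun_prop)
      (Real.exp (√q * S * |z| + q * S ^ 2 / 2 + |m| * S * |X|)) ?_
    filter_upwards [key] with x hx
    rw [Real.norm_eq_abs, Real.abs_exp, Real.exp_le_exp]
    exact (le_abs_self _).trans hx
  unfold scalarPart
  constructor
  · have := integral_mono_ae (integrable_const (μ := P0) _) hi (by
        filter_upwards [key] with x hx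
        exact Real.exp_le_exp.2 (abs_le.1 hx).1)
    simpa using this
  · have := integral_mono_ae hi (integrable_const (μ := P0) _) (by
        filter_upwards [key] with x hx
        exact Real.exp_le_exp.2 (abs_le.1 hx).2)
    simpa using this

lemma scalarPart_pos (hP : ∀ᵐ x ∂P0, |x| ≤ S) {q : ℝ} (hq : 0 ≤ q) (m X z : ℝ) :
    0 < scalarPart P0 q m X z :=
  (Real.exp_pos _).trans_le (scalarPart_bounds hP hq m X z).1

lemma abs_log_scalarPart_le (hP : ∀ᵐ x ∂P0, |x| ≤ S) {q : ℝ} (hq : 0 ≤ q)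
    (m X z : ℝ) : |Real.log (scalarPart P0 q m X z)| ≤
      √q * S * |z| + q * S ^ 2 / 2 + |m| * S * |X| :=
  abs_log_le_of_exp_bounds (scalarPart_bounds hP hq m X z).1
    (scalarPart_bounds hP hq m X z).2

lemma integrable_log_scalarPart (hP : ∀ᵐ x ∂P0, |x| ≤ S) {q : ℝ} (hq : 0 ≤ q)
    (m X : ℝ) : Integrable (fun z => Real.log (scalarPart P0 q m X z)) stdGauss := by
  have h1 : Integrable (fun z : ℝ => √q * S * |z| + q * S ^ 2 / 2 + |m| * S * |X|) stdGauss :=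
    ((integrable_abs_stdGauss.const_mul _).add (integrable_const _)).add (integrable_const _)
  refine h1.mono' (Real.measurable_log.comp ((measurable_scalarPart q m).comp
    (measurable_prodMk_left (x := X)))).aestronglyMeasurable ?_
  exact Filter.Eventually.of_forall fun z => abs_log_scalarPart_le hP hq m X z

lemma measurable_integral_log_scalarPart (q m : ℝ) :
    Measurable (fun X => ∫ z, Real.log (scalarPart P0 q m X z) ∂stdGauss) :=
  measurable_integral_param (Real.measurable_log.comp (measurable_scalarPart q m))

lemma integrable_log_scalarPart_prod (hS : 0 ≤ S) (hP : ∀ᵐ x ∂P0, |x| ≤ S) {q : ℝ} (hq : 0 ≤ q)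
    (m : ℝ) : Integrable (fun p : ℝ × ℝ => Real.log (scalarPart P0 q m p.1 p.2))
      (P0.prod stdGauss) := by
  have h1 : Integrable (fun p : ℝ × ℝ => √q * S * |p.2| + q * S ^ 2 / 2 + |m| * S * S)
      (P0.prod stdGauss) :=
    (((integrable_abs_stdGauss.comp_snd P0).const_mul _).add (integrable_const _)).add
      (integrable_const _)
  refine h1.mono' (Real.measurable_log.comp (measurable_scalarPart q m)).aestronglyMeasurable ?_
  filter_upwards [Measure.quasiMeasurePreserving_fst (μ := P0) (ν := stdGauss) |>.ae hP]
    with p hp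
  refine (abs_log_scalarPart_le hP hq m p.1 p.2).trans ?_
  have := mul_le_mul_of_nonneg_left hp (mul_nonneg (abs_nonneg m) hS)
  linarith

lemma integrable_integral_log_scalarPart (hS : 0 ≤ S) (hP : ∀ᵐ x ∂P0, |x| ≤ S) {q : ℝ}
    (hq : 0 ≤ q) (m : ℝ) :
    Integrable (fun X => ∫ z, Real.log (scalarPart P0 q m X z) ∂stdGauss) P0 :=
  (integrable_log_scalarPart_prod hS hP hq m).integral_prod_left

lemma integral_exp_sum_eq_prod {n : ℕ} (q m : ℝ) (X h : Fin n → ℝ) :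
    ∫ x, Real.exp (∑ i, (√q * h i * x i - q * x i ^ 2 / 2 + m * x i * X i))
      ∂(Measure.pi fun _ : Fin n => P0) = ∏ i, scalarPart P0 q m (X i) (h i) := by
  simp_rw [Real.exp_sum]
  exact integral_fintype_prod_eq_prod
    (fun i x => Real.exp (√q * h i * x - q * x ^ 2 / 2 + m * x * X i))

lemma integral_sum_log_scalarPart (hS : 0 ≤ S) (hP : ∀ᵐ x ∂P0, |x| ≤ S) {q : ℝ}
    (hq : 0 ≤ q) (m : ℝ) (n : ℕ) :
    ∫ X, ∫ h, ∑ i, Real.log (scalarPart P0 q m (X i) (h i)) ∂(gaussPi (Fin n))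
      ∂(Measure.pi fun _ : Fin n => P0) = n * scalarMean P0 q m := by
  have e : ∀ X : Fin n → ℝ, ∫ h, ∑ i, Real.log (scalarPart P0 q m (X i) (h i)) ∂(gaussPi (Fin n)) =
      ∑ i, ∫ z, Real.log (scalarPart P0 q m (X i) z) ∂stdGauss := by
    intro X
    rw [integral_finsetSum _ fun i _ => integrable_comp_eval (μ := fun _ : Fin n => stdGauss)
      (integrable_log_scalarPart hP hq m (X i))]
    exact Finset.sum_congr rfl fun i _ => integral_comp_eval (μ := fun _ : Fin n => stdGauss)
      (integrable_log_scalarPart hP hq m (X i)).aestronglyMeasurable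
  simp_rw [e]
  rw [integral_finsetSum _ fun i _ => integrable_comp_eval (μ := fun _ : Fin n => P0)
    (integrable_integral_log_scalarPart hS hP hq m)]
  have : ∀ i : Fin n, ∫ X : Fin n → ℝ, ∫ z, Real.log (scalarPart P0 q m (X i) z) ∂stdGauss
      ∂(Measure.pi fun _ : Fin n => P0) = scalarMean P0 q m := fun i =>
    integral_comp_eval (μ := fun _ : Fin n => P0)
      (measurable_integral_log_scalarPart q m).aestronglyMeasurable
  simp [this]

end Scalar

section Spike

/-- The symmetric rank-one field of the spiked Wigner model. -/
noncomputable def spikeVec (n : ℕ) (x : Fin n → ℝ) (p : Fin n × Fin n) : ℝ :=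
  if p.1 ≤ p.2 then x p.1 * x p.2 / √n else 0

@[fun_prop]
lemma measurable_spikeVec (n : ℕ) : Measurable (spikeVec n) := by
  refine measurable_pi_lambda _ fun p => ?_
  unfold spikeVec
  split_ifs <;> fun_prop

lemma sum_ordered_pairs {n : ℕ} (a : Fin n → ℝ) :
    ∑ p : Fin n × Fin n, (if p.1 ≤ p.2 then a p.1 * a p.2 else 0) =
      ((∑ i, a i) ^ 2 + ∑ i, a i ^ 2) / 2 := by
  have h1 : ∑ p : Fin n × Fin n, (if p.2 ≤ p.1 then a p.1 * a p.2 else 0) =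
      ∑ p : Fin n × Fin n, (if p.1 ≤ p.2 then a p.1 * a p.2 else 0) := by
    rw [← (Equiv.prodComm (Fin n) (Fin n)).sum_comp]
    exact Finset.sum_congr rfl fun p _ => by simp [mul_comm]
  have h2 : ∑ p : Fin n × Fin n, (if p.1 ≤ p.2 then a p.1 * a p.2 else 0) +
      ∑ p : Fin n × Fin n, (if p.2 ≤ p.1 then a p.1 * a p.2 else 0) =
      ∑ p : Fin n × Fin n, a p.1 * a p.2 +
        ∑ p : Fin n × Fin n, (if p.1 = p.2 then a p.1 * a p.2 else 0) := by
    rw [← Finset.sum_add_distrib, ← Finset.sum_add_distrib]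
    refine Finset.sum_congr rfl fun p _ => ?_
    rcases lt_trichotomy p.1 p.2 with h | h | h
    · simp [h.le, h.not_ge, h.ne]
    · simp [h]
    · simp [h.le, h.not_ge, h.ne']
  have h3 : ∑ p : Fin n × Fin n, a p.1 * a p.2 = (∑ i, a i) ^ 2 := by
    rw [sq, Finset.sum_mul_sum, Fintype.sum_prod_type]
  have h4 : ∑ p : Fin n × Fin n, (if p.1 = p.2 then a p.1 * a p.2 else 0) = ∑ i, a i ^ 2 := by
    rw [Fintype.sum_prod_type]
    simp [sq]
  rw [h1, h3, h4] at h2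
  linarith

lemma sum_spikeVec_mul {n : ℕ} (x y : Fin n → ℝ) :
    ∑ p, spikeVec n x p * spikeVec n y p =
      ((∑ i, x i * y i) ^ 2 + ∑ i, (x i * y i) ^ 2) / (2 * n) := by
  have h := sum_ordered_pairs (fun i => x i * y i)
  have e : ∀ p, spikeVec n x p * spikeVec n y p =
      (if p.1 ≤ p.2 then x p.1 * y p.1 * (x p.2 * y p.2) else 0) / n := by
    intro p
    unfold spikeVec
    split_ifs
    · rw [div_mul_div_comm, Real.mul_self_sqrt (Nat.cast_nonneg n)]
      ring
    · simp
  simp_rw [e]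
  rw [← Finset.sum_div, h, div_div]

lemma exp_neg_Hws (n : ℕ) (X : Fin n → ℝ) (Z : Fin n × Fin n → ℝ) (x : Fin n → ℝ) :
    Real.exp (-Hws n X Z x) = gaussExp (spikeVec n x) (Z + spikeVec n X) := by
  unfold Hws gaussExp
  congr 1
  rw [Finset.sum_div, ← Finset.sum_sub_distrib, ← Finset.sum_neg_distrib, Fintype.sum_prod_type]
  refine Finset.sum_congr rfl fun i _ => ?_
  rw [Finset.sum_filter, ← Finset.sum_neg_distrib]
  refine Finset.sum_congr rfl fun j _ => ?_
  simp only [Pi.add_apply, spikeVec]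
  split_ifs
  · have h1 : ∀ a b : ℝ, a / √n * (b / √n) = a * b / n := fun a b => by
      rw [div_mul_div_comm, Real.mul_self_sqrt (Nat.cast_nonneg n)]
    rw [add_mul, h1, sq (_ / √n), h1]
    rcases eq_or_ne (n : ℝ) 0 with h | h
    · simp [h]
    · field_simp
      ring
  · simp

lemma fws_eq (P0 : Measure ℝ) (n : ℕ) : fws P0 n = -(1 / n) *
    ∫ X, ∫ Z, Real.log (∫ x, gaussExp (spikeVec n x) (Z + spikeVec n X)
      ∂(Measure.pi fun _ : Fin n => P0)) ∂(gaussPi (Fin n × Fin n))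
      ∂(Measure.pi fun _ : Fin n => P0) := by
  unfold fws
  simp_rw [exp_neg_Hws]

variable {P0 : Measure ℝ} [IsProbabilityMeasure P0] {S : ℝ}

lemma ae_pi_abs_le (hP : ∀ᵐ x ∂P0, |x| ≤ S) (n : ℕ) :
    ∀ᵐ x ∂(Measure.pi fun _ : Fin n => P0), ∀ i, |x i| ≤ S := by
  rw [ae_all_iff]
  intro i
  exact (measurePreserving_eval (fun _ : Fin n => P0) i).quasiMeasurePreserving.ae hP

lemma abs_spikeVec_le {n : ℕ} (hn : 0 < n) (hS : 0 ≤ S) {x : Fin n → ℝ} (hx : ∀ i, |x i| ≤ S)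
    (p : Fin n × Fin n) : |spikeVec n x p| ≤ S ^ 2 := by
  unfold spikeVec
  split_ifs
  · have h1 : (1 : ℝ) ≤ √n := Real.one_le_sqrt.2 (by exact_mod_cast hn)
    rw [abs_div, abs_mul, abs_of_nonneg (Real.sqrt_nonneg _)]
    rw [sq]
    exact (div_le_self (by positivity) h1).trans (mul_le_mul (hx _) (hx _) (abs_nonneg _) hS)
  · simpa using sq_nonneg S

end Spike

section LowerBound

variable {P0 : Measure ℝ} [IsProbabilityMeasure P0] {S : ℝ}

lemma gaussExp_sqrt_smul_add {n : ℕ} {q : ℝ} (hq : 0 ≤ q) (x X h : Fin n → ℝ) :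
    gaussExp (√q • x) (h + √q • X) =
      Real.exp (∑ i, (√q * h i * x i - q * x i ^ 2 / 2 + q * x i * X i)) := by
  unfold gaussExp
  rw [Finset.sum_div, ← Finset.sum_sub_distrib]
  congr 1
  refine Finset.sum_congr rfl fun i _ => ?_
  simp only [Pi.add_apply, Pi.smul_apply, smul_eq_mul]
  have := Real.sq_sqrt hq
  linear_combination (x i * X i - x i ^ 2 / 2) * this

lemma integral_log_scalar_channel (hS : 0 ≤ S) (hP : ∀ᵐ x ∂P0, |x| ≤ S) {q : ℝ} (hq : 0 ≤ q)
    (n : ℕ) :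
    ∫ X, ∫ h, Real.log (∫ x, gaussExp (√q • x) (h + √q • X) ∂(Measure.pi fun _ : Fin n => P0))
      ∂(gaussPi (Fin n)) ∂(Measure.pi fun _ : Fin n => P0) = n * scalarMean P0 q q := by
  rw [← integral_sum_log_scalarPart hS hP hq q n]
  simp_rw [gaussExp_sqrt_smul_add hq, integral_exp_sum_eq_prod]
  simp_rw [Real.log_prod fun i _ => (scalarPart_pos hP hq q _ _).ne']

/-- The field of the spike model together with one additional independent component. -/
noncomputable def extSpikeVec (n : ℕ) (c : ℝ) (x : Fin n → ℝ) : (Fin n × Fin n) ⊕ Unit → ℝ :=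
  Sum.elim (spikeVec n x) fun _ => c

lemma gaussExp_sumElim {A A' : Type*} [Fintype A] [Fintype A'] (u g : A → ℝ) (v h : A' → ℝ) :
    gaussExp (Sum.elim u v) (Sum.elim g h) = gaussExp u g * gaussExp v h := by
  unfold gaussExp
  rw [← Real.exp_add]
  congr 1
  simp only [Fintype.sum_sum_type, Sum.elim_inl, Sum.elim_inr]
  ring

lemma integral_stdGauss_id : ∫ z, z ∂stdGauss = 0 := integral_id_gaussianReal

lemma integrable_id_stdGauss : Integrable (fun z : ℝ => z) stdGauss :=
  (memLp_id_gaussianReal (μ := 0) (v := 1) 1).integrable le_rfl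

theorem fws_le_ftpotWS (hS : 0 ≤ S) (hP : ∀ᵐ x ∂P0, |x| ≤ S) {q : ℝ} (hq : 0 ≤ q) {n : ℕ}
    (hn : 0 < n) : fws P0 n ≤ ftpotWS P0 q := by
  set π := Measure.pi fun _ : Fin n => P0 with hπ
  have hn' : (0 : ℝ) < n := by exact_mod_cast hn
  set c : ℝ := √(n / 2) * q with hc
  have hc2 : c * c = n / 2 * q ^ 2 := by
    rw [hc, mul_mul_mul_comm, Real.mul_self_sqrt (by positivity)]; ring
  have hae := ae_pi_abs_le hP n
  set B : ℝ := S ^ 2 + |c| + √q * S with hBd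
  have hB0 : 0 ≤ B := by positivity
  have hum : Measurable (extSpikeVec n c) := by
    refine measurable_pi_lambda _ fun p => ?_
    rcases p with p | p
    · exact (measurable_pi_apply p).comp (measurable_spikeVec n)
    · exact measurable_const
  have hvm : Measurable fun x : Fin n → ℝ => √q • x := by fun_prop
  have hu : ∀ᵐ x ∂π, ∀ p, |extSpikeVec n c x p| ≤ B := by
    filter_upwards [hae] with x hx p
    rcases p with p | p
    · have h1 := abs_spikeVec_le hn hS hx p
      have h2 : 0 ≤ |c| + √q * S := by positivity
      simp only [extSpikeVec, Sum.elim_inl]; linarith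
    · have h2 : 0 ≤ S ^ 2 + √q * S := by positivity
      simp only [extSpikeVec, Sum.elim_inr]; linarith
  have hv : ∀ᵐ x ∂π, ∀ i, |(√q • x) i| ≤ B := by
    filter_upwards [hae] with x hx i
    rw [Pi.smul_apply, smul_eq_mul, abs_mul, abs_of_nonneg (Real.sqrt_nonneg q)]
    have h1 := mul_le_mul_of_nonneg_left (hx i) (Real.sqrt_nonneg q)
    have h2 : 0 ≤ S ^ 2 + |c| := by positivity
    linarith
  have hs : ∀ᵐ x ∂π, ∀ p, |spikeVec n x p| ≤ S ^ 2 := by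
    filter_upwards [hae] with x hx p using abs_spikeVec_le hn hS hx p
  have hsm := measurable_spikeVec n
  have hcov : ∀ x y : Fin n → ℝ, ∑ i, (√q • x) i * (√q • y) i ≤
      ∑ p, extSpikeVec n c x p * extSpikeVec n c y p := by
    intro x y
    have e1 : ∑ i, (√q • x) i * (√q • y) i = q * ∑ i, x i * y i := by
      rw [Finset.mul_sum]
      refine Finset.sum_congr rfl fun i _ => ?_
      simp only [Pi.smul_apply, smul_eq_mul]
      rw [mul_mul_mul_comm, Real.mul_self_sqrt hq]
    rw [e1]
    simp only [extSpikeVec, Fintype.sum_sum_type, Sum.elim_inl, Sum.elim_inr, sum_spikeVec_mul,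
      hc2, Finset.univ_unique, Finset.sum_const, Finset.card_singleton, one_smul]
    have h3 : 0 ≤ ∑ i, (x i * y i) ^ 2 := Finset.sum_nonneg fun _ _ => sq_nonneg _
    set R := ∑ i, x i * y i
    have h4 : (R ^ 2 + ∑ i, (x i * y i) ^ 2) / (2 * n) + n / 2 * q ^ 2 - q * R =
        ((R - n * q) ^ 2 + ∑ i, (x i * y i) ^ 2) / (2 * n) := by
      field_simp; ring
    have h5 : 0 ≤ ((R - n * q) ^ 2 + ∑ i, (x i * y i) ^ 2) / (2 * n) := by positivity
    linarith
  have hK := kahane_comparison (ν := π) (w := fun _ => 0) isKahane_mul_log hB0 measurable_const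
    hum hvm (by simpa using hB0) hu hv hcov
  simp only [Real.exp_zero, one_mul] at hK
  rw [← integral_log_planted hum hu, ← integral_log_planted hvm hv,
    integral_log_scalar_channel hS hP hq n] at hK
  have e : ∀ X : Fin n → ℝ, ∫ g, Real.log (∫ x, gaussExp (extSpikeVec n c x)
      (g + extSpikeVec n c X) ∂π) ∂(gaussPi ((Fin n × Fin n) ⊕ Unit)) =
      ∫ g, Real.log (∫ x, gaussExp (spikeVec n x) (g + spikeVec n X) ∂π)
        ∂(gaussPi (Fin n × Fin n)) + n / 4 * q ^ 2 := by
    intro X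
    rw [integral_gaussPi_sum]
    have e1 : ∀ p : (Fin n × Fin n → ℝ) × (Unit → ℝ),
        Real.log (∫ x, gaussExp (extSpikeVec n c x) (Sum.elim p.1 p.2 + extSpikeVec n c X) ∂π) =
        Real.log (∫ x, gaussExp (spikeVec n x) (p.1 + spikeVec n X) ∂π) +
          (p.2 () * c + n / 4 * q ^ 2) := by
      intro p
      have e2 : ∀ x, gaussExp (extSpikeVec n c x) (Sum.elim p.1 p.2 + extSpikeVec n c X) =
          gaussExp (spikeVec n x) (p.1 + spikeVec n X) * Real.exp (p.2 () * c + n / 4 * q ^ 2) := by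
        intro x
        have : Sum.elim p.1 p.2 + extSpikeVec n c X =
            Sum.elim (p.1 + spikeVec n X) (p.2 + fun _ => c) := by
          ext a; rcases a with a | a <;> simp [extSpikeVec]
        rw [this, extSpikeVec, gaussExp_sumElim]
        congr 1
        unfold gaussExp
        congr 1
        simp only [Finset.univ_unique, Finset.sum_singleton, Pi.add_apply, PUnit.default_eq_unit]
        linear_combination hc2 / 2
      simp_rw [e2]
      rw [integral_mul_const, Real.log_mul _ (Real.exp_pos _).ne', Real.log_exp]
      exact ((Real.exp_pos _).trans_le (partition_bounds hsm hs _).1).ne'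
    simp_rw [e1]
    have i1 := (integrable_log_partition hsm hs (spikeVec n X)).comp_fst (gaussPi Unit)
    have i2 : Integrable (fun h : Unit → ℝ => h () * c + n / 4 * q ^ 2) (gaussPi Unit) :=
      ((integrable_comp_eval (μ := fun _ : Unit => stdGauss) (i := ())
        integrable_id_stdGauss).mul_const c).add (integrable_const _)
    rw [integral_add i1 (i2.comp_snd _), integral_fun_fst (fun g =>
      Real.log (∫ x, gaussExp (spikeVec n x) (g + spikeVec n X) ∂π)),
      integral_fun_snd (fun h : Unit → ℝ => h () * c + n / 4 * q ^ 2), integral_add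
      ((integrable_comp_eval (μ := fun _ : Unit => stdGauss) (i := ())
        integrable_id_stdGauss).mul_const c) (integrable_const _), integral_mul_const,
      integral_comp_eval (μ := fun _ : Unit => stdGauss) (i := ())
        integrable_id_stdGauss.aestronglyMeasurable, integral_stdGauss_id]
    simp
  simp_rw [e] at hK
  have hL := integrable_integral_log_planted hsm hs
  rw [integral_add hL (integrable_const _)] at hK
  simp only [integral_const, probReal_univ, smul_eq_mul, one_mul] at hK
  rw [fws_eq, ftpotWS_eq]
  rw [neg_mul, neg_le_iff_add_nonneg, one_div]
  have h6 := mul_le_mul_of_nonneg_left hK (inv_nonneg.2 hn'.le)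
  rw [mul_add] at h6
  have h7 : (n : ℝ)⁻¹ * (n * scalarMean P0 q q) = scalarMean P0 q q := by field_simp
  have h8 : (n : ℝ)⁻¹ * (n / 4 * q ^ 2) = q ^ 2 / 4 := by field_simp
  linarith

end LowerBound

section Gibbs

variable {A A' : Type*} [Fintype A] [Fintype A'] {Ω : Type*} [MeasurableSpace Ω]

lemma gaussPi_integral_neg {f : (A → ℝ) → ℝ} (hf : Measurable f) :
    ∫ g, f (-g) ∂(gaussPi A) = ∫ g, f g ∂(gaussPi A) := by
  have h := integral_stable (A := A) (a := -1) (b := 0) (c := 1) (by norm_num) hf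
  simp only [one_smul, neg_smul, zero_smul, add_zero] at h
  rw [h, integral_fun_fst (fun g => f (-g))]
  simp

lemma mul_log_sub_le {x y : ℝ} (hx : 0 < x) (hy : 0 < y) :
    x * Real.log y - x * Real.log x ≤ y - x := by
  have h := Real.log_le_sub_one_of_pos (div_pos hy hx)
  rw [Real.log_div hy.ne' hx.ne'] at h
  have := mul_le_mul_of_nonneg_left h hx.le
  rw [mul_sub, mul_sub, mul_div_cancel₀ _ hx.ne'] at this
  linarith

lemma integrable_partition {μ : Measure Ω} [IsProbabilityMeasure μ] {u : Ω → A → ℝ}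
    (hu : Measurable u) {B : ℝ} (hB : ∀ᵐ σ ∂μ, ∀ a, |u σ a| ≤ B) :
    Integrable (fun g => ∫ σ, gaussExp (u σ) g ∂μ) (gaussPi A) := by
  refine integrable_of_gauss_dom (measurable_integral_param (measurable_gaussExp_uncurry hu))
    (C := Real.exp (Fintype.card A * B ^ 2)) (K := B) fun g => ?_
  have h := partition_bounds hu hB g
  rw [abs_of_pos ((Real.exp_pos _).trans_le h.1), ← Real.exp_add, add_comm]
  exact h.2

lemma integrable_partition_mul {μ : Measure Ω} [IsProbabilityMeasure μ] {u : Ω → A → ℝ}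
    (hu : Measurable u) {B : ℝ} (hB : ∀ᵐ σ ∂μ, ∀ a, |u σ a| ≤ B) {f : (A → ℝ) → ℝ}
    (hf : Measurable f) {C K : ℝ} (hfb : ∀ g, |f g| ≤ C * Real.exp (K * ∑ a, |g a|)) :
    Integrable (fun g => (∫ σ, gaussExp (u σ) g ∂μ) * f g) (gaussPi A) := by
  refine integrable_of_gauss_dom
    ((measurable_integral_param (measurable_gaussExp_uncurry hu)).mul hf)
    (C := Real.exp (Fintype.card A * B ^ 2) * C) (K := B + K) fun g => ?_
  have h := partition_bounds hu hB g
  rw [abs_mul, abs_of_pos ((Real.exp_pos _).trans_le h.1)]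
  refine (mul_le_mul h.2 (hfb g) (abs_nonneg _) (Real.exp_pos _).le).trans (le_of_eq ?_)
  rw [add_mul, Real.exp_add, Real.exp_add]
  ring

/-- Decoding with the sign of the signal flipped is suboptimal. -/
lemma integral_log_planted_neg_le {μ : Measure Ω} [IsProbabilityMeasure μ] {u : Ω → A → ℝ}
    (hu : Measurable u) {B : ℝ} (hB : ∀ᵐ σ ∂μ, ∀ a, |u σ a| ≤ B) :
    ∫ τ, ∫ g, Real.log (∫ σ, gaussExp (u σ) (g - u τ) ∂μ) ∂(gaussPi A) ∂μ ≤
      ∫ τ, ∫ g, Real.log (∫ σ, gaussExp (u σ) (g + u τ) ∂μ) ∂(gaussPi A) ∂μ := by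
  have hm := measurable_log_partition (μ := μ) hu
  have hb := abs_log_partition_le_exp hu hB
  have hm' : Measurable fun g => Real.log (∫ σ, gaussExp (u σ) (-g) ∂μ) := hm.comp measurable_neg
  have hb' : ∀ g : A → ℝ, |Real.log (∫ σ, gaussExp (u σ) (-g) ∂μ)| ≤
      Real.exp (Fintype.card A * B ^ 2) * Real.exp (B * ∑ a, |g a|) := fun g => by
    simpa using hb (-g)
  have e : ∀ τ, ∫ g, Real.log (∫ σ, gaussExp (u σ) (g - u τ) ∂μ) ∂(gaussPi A) =
      ∫ g, Real.log (∫ σ, gaussExp (u σ) (-(g + u τ)) ∂μ) ∂(gaussPi A) := by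
    intro τ
    have h : Measurable fun g => Real.log (∫ σ, gaussExp (u σ) (g - u τ) ∂μ) :=
      hm.comp (measurable_id.sub_const (u τ))
    rw [← gaussPi_integral_neg h]
    simp only [neg_add']
  simp_rw [e]
  rw [integral_planted hu hB hm hb, integral_planted hu hB hm' hb', ← sub_nonpos,
    ← integral_sub (integrable_partition_mul hu hB hm' hb') (integrable_partition_mul hu hB hm hb)]
  have hp := integrable_partition hu hB
  have hp' : Integrable (fun g => ∫ σ, gaussExp (u σ) (-g) ∂μ) (gaussPi A) := by
    have h1 : Measurable fun g => ∫ σ, gaussExp (u σ) g ∂μ :=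
      measurable_integral_param (measurable_gaussExp_uncurry hu)
    have h0 : Measurable fun g => ∫ σ, gaussExp (u σ) (-g) ∂μ := h1.comp measurable_neg
    refine integrable_of_gauss_dom h0 (C := Real.exp (Fintype.card A * B ^ 2)) (K := B) fun g => ?_
    have h := partition_bounds hu hB (-g)
    rw [abs_of_pos ((Real.exp_pos _).trans_le h.1), ← Real.exp_add, add_comm]
    simpa using h.2
  have hpos : ∀ g, 0 < ∫ σ, gaussExp (u σ) g ∂μ := fun g =>
    (Real.exp_pos _).trans_le (partition_bounds hu hB g).1
  refine (integral_mono ((integrable_partition_mul hu hB hm' hb').sub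
    (integrable_partition_mul hu hB hm hb)) (hp'.sub hp)
    fun g => mul_log_sub_le (hpos g) (hpos (-g))).trans (le_of_eq ?_)
  rw [integral_sub' hp' hp, gaussPi_integral_neg (f := fun g => ∫ σ, gaussExp (u σ) g ∂μ)
    (measurable_integral_param (measurable_gaussExp_uncurry hu)), sub_self]

/-- The log-sum inequality. -/
lemma log_sum_inequality {μ : Measure Ω} {a L : Ω → ℝ} (hL : ∀ σ, 0 < L σ) (ha : ∀ σ, 0 ≤ a σ)
    (hia : Integrable a μ) (hiL : Integrable (fun σ => a σ * L σ) μ)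
    (hi : Integrable (fun σ => a σ * L σ * Real.log (L σ)) μ) (hpa : 0 < ∫ σ, a σ ∂μ)
    (hpL : 0 < ∫ σ, a σ * L σ ∂μ) :
    (∫ σ, a σ * L σ ∂μ) * Real.log (∫ σ, a σ * L σ ∂μ) ≤
      (∫ σ, a σ * L σ ∂μ) * Real.log (∫ σ, a σ ∂μ) +
        ∫ σ, a σ * L σ * Real.log (L σ) ∂μ := by
  set p := (∫ σ, a σ * L σ ∂μ) / ∫ σ, a σ ∂μ with hp
  have hp0 : 0 < p := div_pos hpL hpa
  have h := integral_mono ((hiL.const_mul (1 + Real.log p)).sub (hia.const_mul p)) hi fun σ => by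
    have h1 := mul_log_sub_le (hL σ) hp0
    have h2 := mul_le_mul_of_nonneg_left h1 (ha σ)
    simp only [Pi.sub_apply]
    linarith
  rw [integral_sub' (hiL.const_mul _) (hia.const_mul _), integral_const_mul, integral_const_mul,
    show p * ∫ σ, a σ ∂μ = ∫ σ, a σ * L σ ∂μ from div_mul_cancel₀ _ hpa.ne', hp,
    Real.log_div hpL.ne' hpa.ne'] at h
  linarith

omit [Fintype A] [Fintype A'] in
lemma measurable_sumElim {u : Ω → A → ℝ} {v : Ω → A' → ℝ} (hu : Measurable u)
    (hv : Measurable v) : Measurable fun σ => Sum.elim (u σ) (v σ) := by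
  refine measurable_pi_lambda _ fun p => ?_
  rcases p with p | p
  · exact (measurable_pi_apply p).comp hu
  · exact (measurable_pi_apply p).comp hv

/-- Adding observations with signal `v` increases the mean log-partition function by at most
half of the mean squared norm of `v`. -/
lemma integral_mul_log_sumElim_le {μ : Measure Ω} [IsProbabilityMeasure μ] {u : Ω → A → ℝ}
    {v : Ω → A' → ℝ} (hu : Measurable u) (hv : Measurable v) {B : ℝ} (hB0 : 0 ≤ B)
    (hBu : ∀ᵐ σ ∂μ, ∀ a, |u σ a| ≤ B) (hBv : ∀ᵐ σ ∂μ, ∀ a, |v σ a| ≤ B) :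
    ∫ g, (∫ σ, gaussExp (Sum.elim (u σ) (v σ)) g ∂μ) *
      Real.log (∫ σ, gaussExp (Sum.elim (u σ) (v σ)) g ∂μ) ∂(gaussPi (A ⊕ A')) ≤
    ∫ g, (∫ σ, gaussExp (u σ) g ∂μ) * Real.log (∫ σ, gaussExp (u σ) g ∂μ) ∂(gaussPi A) +
      ∫ σ, (∑ a, v σ a ^ 2) / 2 ∂μ := by
  set U : Ω → A ⊕ A' → ℝ := fun σ => Sum.elim (u σ) (v σ) with hU
  set W : Ω → A ⊕ A' → ℝ := fun σ => Sum.elim (u σ) 0 with hW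
  set V : Ω → A ⊕ A' → ℝ := fun σ => Sum.elim 0 (v σ) with hV
  have hUm : Measurable U := measurable_sumElim hu hv
  have hWm : Measurable W := measurable_sumElim hu measurable_const
  have hVm : Measurable V := measurable_sumElim measurable_const hv
  have hVa : ∀ a, Measurable fun σ => V σ a := fun a => (measurable_pi_apply a).comp hVm
  have hUB : ∀ᵐ σ ∂μ, ∀ a, |U σ a| ≤ B := by
    filter_upwards [hBu, hBv] with σ h1 h2 a
    rcases a with a | a
    · exact h1 a
    · exact h2 a
  have hWB : ∀ᵐ σ ∂μ, ∀ a, |W σ a| ≤ B := by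
    filter_upwards [hBu] with σ h1 a
    rcases a with a | a
    · exact h1 a
    · simpa [hW] using hB0
  have hVB : ∀ᵐ σ ∂μ, ∀ a, |V σ a| ≤ B := by
    filter_upwards [hBv] with σ h1 a
    rcases a with a | a
    · simpa [hV] using hB0
    · exact h1 a
  have split : ∀ (σ : Ω) (g : A ⊕ A' → ℝ),
      gaussExp (W σ) g * gaussExp (V σ) g = gaussExp (U σ) g := by
    intro σ g
    unfold gaussExp
    rw [← Real.exp_add]
    congr 1
    simp only [hU, hV, hW, Fintype.sum_sum_type, Sum.elim_inl, Sum.elim_inr, Pi.zero_apply]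
    simp
    ring
  have hlog : ∀ (σ : Ω) (g : A ⊕ A' → ℝ), Real.log (gaussExp (V σ) g) =
      ∑ a, g a * V σ a - (∑ a, V σ a ^ 2) / 2 := fun σ g => Real.log_exp _
  have hNm : Measurable (Function.uncurry fun (g : A ⊕ A' → ℝ) σ =>
      gaussExp (U σ) g * Real.log (gaussExp (V σ) g)) :=
    (measurable_gaussExp_uncurry hUm).mul
      (Real.measurable_log.comp (measurable_gaussExp_uncurry hVm))
  set c : ℝ := Fintype.card (A ⊕ A') * B ^ 2 with hc
  have hNb : ∀ᵐ σ ∂μ, ∀ g, |gaussExp (U σ) g * Real.log (gaussExp (V σ) g)| ≤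
      Real.exp (2 * c) * Real.exp (2 * B * ∑ a, |g a|) := by
    filter_upwards [hUB, hVB] with σ h1 h2 g
    have e1 : gaussExp (U σ) g ≤ Real.exp (B * ∑ a, |g a| + c) :=
      Real.exp_le_exp.2 (abs_le.1 (abs_gaussExp_exponent_le h1)).2
    have e2 : |Real.log (gaussExp (V σ) g)| ≤ Real.exp (B * ∑ a, |g a| + c) := by
      rw [hlog]
      exact (abs_gaussExp_exponent_le h2).trans
        ((le_add_of_nonneg_right zero_le_one).trans (Real.add_one_le_exp _))
    rw [abs_mul, abs_of_pos (gaussExp_pos _ _), ← Real.exp_add,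
      show 2 * c + 2 * B * ∑ a, |g a| = (B * ∑ a, |g a| + c) + (B * ∑ a, |g a| + c) by ring,
      Real.exp_add]
    exact mul_le_mul e1 e2 (abs_nonneg _) (Real.exp_pos _).le
  have hNi := integrable_prod_of_gauss_dom hNm hNb
  have hWlog := measurable_log_partition (μ := μ) hWm
  have key : ∀ g, (∫ σ, gaussExp (U σ) g ∂μ) * Real.log (∫ σ, gaussExp (U σ) g ∂μ) ≤
      (∫ σ, gaussExp (U σ) g ∂μ) * Real.log (∫ σ, gaussExp (W σ) g ∂μ) +
        ∫ σ, gaussExp (U σ) g * Real.log (gaussExp (V σ) g) ∂μ := by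
    intro g
    have hint : Integrable (fun σ => gaussExp (U σ) g * Real.log (gaussExp (V σ) g)) μ := by
      refine Integrable.of_bound (hNm.comp (measurable_prodMk_left (x := g))).aestronglyMeasurable
        (Real.exp (2 * c) * Real.exp (2 * B * ∑ a, |g a|)) ?_
      filter_upwards [hNb] with σ h using h g
    have := log_sum_inequality (μ := μ) (a := fun σ => gaussExp (W σ) g)
      (L := fun σ => gaussExp (V σ) g) (fun σ => gaussExp_pos _ _)
      (fun σ => (gaussExp_pos _ _).le) (integrable_gaussExp_section hWm hWB g)
    simp only [split] at this
    exact this (integrable_gaussExp_section hUm hUB g) hint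
      ((Real.exp_pos _).trans_le (partition_bounds hWm hWB g).1)
      ((Real.exp_pos _).trans_le (partition_bounds hUm hUB g).1)
  have hWexp := abs_log_partition_le_exp hWm hWB
  have hUexp := abs_log_partition_le_exp hUm hUB
  refine (integral_mono (integrable_partition_mul hUm hUB (measurable_log_partition hUm) hUexp)
    ((integrable_partition_mul hUm hUB hWlog hWexp).add hNi.integral_prod_left) key).trans ?_
  rw [integral_add' (integrable_partition_mul hUm hUB hWlog hWexp) hNi.integral_prod_left]
  refine add_le_add (le_of_eq ?_) (le_of_eq ?_)
  · rw [← integral_planted hUm hUB hWlog hWexp, ← integral_log_planted hu hBu]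
    refine integral_congr_ae (.of_forall fun τ => ?_)
    simp only
    rw [integral_gaussPi_sum]
    have e : ∀ (p : (A → ℝ) × (A' → ℝ)) σ,
        gaussExp (W σ) (Sum.elim p.1 p.2 + U τ) = gaussExp (u σ) (p.1 + u τ) := by
      intro p σ
      have : (Sum.elim p.1 p.2 + U τ) = Sum.elim (p.1 + u τ) (p.2 + v τ) := by
        ext a; rcases a with a | a <;> rfl
      rw [this, gaussExp_sumElim]
      simp [gaussExp]
    simp only [e]
    rw [integral_fun_fst (fun g => Real.log (∫ σ, gaussExp (u σ) (g + u τ) ∂μ))]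
    simp
  · refine (integral_gauss_swap hNm hNb).trans ?_
    refine integral_congr_ae (.of_forall fun σ => ?_)
    have h := integral_shift (U σ) fun g => Real.log (gaussExp (V σ) g)
    change ∫ g, gaussExp (U σ) g * Real.log (gaussExp (V σ) g) ∂(gaussPi (A ⊕ A')) = _
    refine h.symm.trans ?_
    simp only [hlog, Pi.add_apply, add_mul, Finset.sum_add_distrib, add_sub_assoc]
    have hi : ∀ a, Integrable (fun g : A ⊕ A' → ℝ => g a * V σ a) (gaussPi (A ⊕ A')) := fun a =>
      (integrable_comp_eval (μ := fun _ : A ⊕ A' => stdGauss) (i := a)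
        integrable_id_stdGauss).mul_const _
    have h0 : ∀ a, ∫ g : A ⊕ A' → ℝ, g a * V σ a ∂(gaussPi (A ⊕ A')) = 0 := by
      intro a
      rw [integral_mul_const, gaussPi, integral_comp_eval (μ := fun _ : A ⊕ A' => stdGauss)
        (i := a) integrable_id_stdGauss.aestronglyMeasurable, integral_stdGauss_id, zero_mul]
    rw [integral_add (integrable_finsetSum _ fun a _ => hi a) (integrable_const _),
      integral_finsetSum _ fun a _ => hi a]
    simp only [h0]
    simp [hU, hV, Fintype.sum_sum_type]
    simp only [← sq]
    ring

end Gibbs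

section ScalarChannel

variable {P0 : Measure ℝ} [IsProbabilityMeasure P0] {S : ℝ}

lemma ae_abs_sqrt_smul_le (hP : ∀ᵐ x ∂P0, |x| ≤ S) (q : ℝ) (n : ℕ) :
    ∀ᵐ x ∂(Measure.pi fun _ : Fin n => P0), ∀ i, |(√q • x) i| ≤ √q * S := by
  filter_upwards [ae_pi_abs_le hP n] with x hx i
  rw [Pi.smul_apply, smul_eq_mul, abs_mul, abs_of_nonneg (Real.sqrt_nonneg q)]
  exact mul_le_mul_of_nonneg_left (hx i) (Real.sqrt_nonneg q)

lemma scalarMean_neg_le (hS : 0 ≤ S) (hP : ∀ᵐ x ∂P0, |x| ≤ S) {q : ℝ} (hq : 0 ≤ q) :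
    scalarMean P0 q (-q) ≤ scalarMean P0 q q := by
  have hm : Measurable fun x : Fin 1 → ℝ => √q • x := by fun_prop
  have h := integral_log_planted_neg_le hm (ae_abs_sqrt_smul_le hP q 1)
  have e1 := integral_log_scalar_channel hS hP hq 1
  have e2 := integral_sum_log_scalarPart hS hP hq (-q) 1
  rw [Nat.cast_one, one_mul] at e1 e2
  rw [e1] at h
  refine le_trans (le_of_eq ?_) h
  have e3 : ∀ x X g : Fin 1 → ℝ, gaussExp (√q • x) (g - √q • X) =
      Real.exp (∑ i, (√q * g i * x i - q * x i ^ 2 / 2 + -q * x i * X i)) := by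
    intro x X g
    have := gaussExp_sqrt_smul_add hq x (-X) g
    rw [smul_neg, ← sub_eq_add_neg] at this
    simpa using this
  rw [← e2]
  simp_rw [e3, integral_exp_sum_eq_prod,
    Real.log_prod fun i _ => (scalarPart_pos hP hq (-q) _ _).ne']

/-- The mean log-partition function grows at most linearly in the signal-to-noise ratio. -/
lemma scalarMean_add_le (hS : 0 ≤ S) (hP : ∀ᵐ x ∂P0, |x| ≤ S) {q r : ℝ} (hq : 0 ≤ q)
    (hr : 0 ≤ r) : scalarMean P0 (q + r) (q + r) ≤
      scalarMean P0 q q + r / 2 * ∫ x, x ^ 2 ∂P0 := by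
  set π := Measure.pi fun _ : Fin 1 => P0
  have hm : ∀ q : ℝ, Measurable fun x : Fin 1 → ℝ => √q • x := fun q => by fun_prop
  set B : ℝ := √(q + r) * S + √q * S + √r * S
  have h1 : 0 ≤ √(q + r) * S := by positivity
  have h2 : 0 ≤ √q * S := by positivity
  have h3 : 0 ≤ √r * S := by positivity
  have hB0 : 0 ≤ B := by positivity
  have hBqr : ∀ᵐ x ∂π, ∀ i, |(√(q + r) • x) i| ≤ B := by
    filter_upwards [ae_abs_sqrt_smul_le hP (q + r) 1] with x hx i
    exact (hx i).trans (by simp only [B]; linarith)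
  have hBq : ∀ᵐ x ∂π, ∀ i, |(√q • x) i| ≤ B := by
    filter_upwards [ae_abs_sqrt_smul_le hP q 1] with x hx i
    exact (hx i).trans (by simp only [B]; linarith)
  have hBr : ∀ᵐ x ∂π, ∀ i, |(√r • x) i| ≤ B := by
    filter_upwards [ae_abs_sqrt_smul_le hP r 1] with x hx i
    exact (hx i).trans (by simp only [B]; linarith)
  have hcov : ∀ x y : Fin 1 → ℝ, ∑ i, (√(q + r) • x) i * (√(q + r) • y) i ≤
      ∑ a, (Sum.elim (√q • x) (√r • x) : Fin 1 ⊕ Fin 1 → ℝ) a * Sum.elim (√q • y) (√r • y) a := by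
    intro x y
    simp only [Fintype.sum_sum_type, Sum.elim_inl, Sum.elim_inr, Pi.smul_apply, smul_eq_mul,
      Finset.univ_unique, Finset.sum_singleton]
    have e1 := Real.mul_self_sqrt hq
    have e2 := Real.mul_self_sqrt hr
    have e3 := Real.mul_self_sqrt (add_nonneg hq hr)
    apply le_of_eq
    linear_combination x default * y default * (e3 - e1 - e2)
  have hK := kahane_comparison (ν := π) (w := fun _ => 0)
    (u := fun x => (Sum.elim (√q • x) (√r • x) : Fin 1 ⊕ Fin 1 → ℝ))
    isKahane_mul_log hB0 measurable_const
    (measurable_sumElim (hm q) (hm r)) (hm (q + r)) (by simpa using hB0)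
    (by
      filter_upwards [hBq, hBr] with x h1 h2 a
      rcases a with a | a
      · exact h1 a
      · exact h2 a) hBqr hcov
  simp only [Real.exp_zero, one_mul] at hK
  rw [← integral_log_planted (hm (q + r)) hBqr,
    integral_log_scalar_channel hS hP (add_nonneg hq hr) 1] at hK
  have hE := integral_mul_log_sumElim_le (hm q) (hm r) hB0 hBq hBr
  rw [← integral_log_planted (hm q) hBq, integral_log_scalar_channel hS hP hq 1] at hE
  have e : ∫ x, (∑ i, (√r • x) i ^ 2) / 2 ∂π = r / 2 * ∫ x, x ^ 2 ∂P0 := by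
    rw [← integral_const_mul, ← integral_comp_eval (μ := fun _ : Fin 1 => P0) (i := 0)
      (f := fun x => r / 2 * x ^ 2) (by fun_prop)]
    refine integral_congr_ae (.of_forall fun x => ?_)
    simp [mul_pow, Real.sq_sqrt hr]
    ring
  rw [e] at hE
  simp only [Nat.cast_one, one_mul] at hK hE
  exact hK.trans hE

lemma scalarMean_sub_le (hS : 0 ≤ S) (hP : ∀ᵐ x ∂P0, |x| ≤ S) {M : ℝ}
    (hM : ∀ q ∈ Set.Icc 0 (∫ x, x ^ 2 ∂P0), scalarMean P0 q q - q ^ 2 / 4 ≤ M) (m : ℝ) :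
    scalarMean P0 |m| m - m ^ 2 / 4 ≤ M := by
  set ρ := ∫ x, x ^ 2 ∂P0 with hρ
  have hρ0 : 0 ≤ ρ := integral_nonneg fun x => sq_nonneg x
  have h1 : ∀ q, 0 ≤ q → scalarMean P0 q q - q ^ 2 / 4 ≤ M := by
    intro q hq
    rcases le_total q ρ with h | h
    · exact hM q ⟨hq, h⟩
    · have h2 := scalarMean_add_le hS hP hρ0 (sub_nonneg.2 h)
      rw [add_sub_cancel, ← hρ] at h2
      have h3 := hM ρ ⟨hρ0, le_rfl⟩
      nlinarith [sq_nonneg (q - ρ)]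
  have h2 : scalarMean P0 |m| m ≤ scalarMean P0 |m| |m| := by
    rcases abs_choice m with h | h
    · rw [h]
    · have := scalarMean_neg_le hS hP (abs_nonneg m)
      rwa [show -|m| = m by linarith] at this
  have h3 := h1 |m| (abs_nonneg m)
  rw [sq_abs] at h3
  linarith

end ScalarChannel

section Concentration

lemma abs_integral_le_sqrt {Ω : Type*} [MeasurableSpace Ω] {μ : Measure Ω} [IsProbabilityMeasure μ]
    {Y : Ω → ℝ} (hY : MemLp Y 2 μ) : ∫ ω, |Y ω - ∫ ω, Y ω ∂μ| ∂μ ≤ √(Var[Y; μ]) := by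
  have hZ : MemLp (fun ω => |Y ω - ∫ ω, Y ω ∂μ|) 2 μ := (hY.sub (memLp_const _)).abs
  refine Real.le_sqrt_of_sq_le ?_
  have h := variance_nonneg (fun ω => |Y ω - ∫ ω, Y ω ∂μ|) μ
  rw [variance_eq_sub hZ] at h
  rw [variance_eq_integral hY.aemeasurable]
  simp only [Pi.pow_apply, sq_abs] at h
  linarith

variable {μ : Measure ℝ} [IsProbabilityMeasure μ] {n : ℕ} {f : Fin n → ℝ → ℝ} {d : ℝ → ℝ}

lemma integrable_abs_sum_sub (hf : ∀ i, Integrable (f i) μ) :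
    Integrable (fun ω : Fin n → ℝ => |∑ i, (f i (ω i) - ∫ x, f i x ∂μ)|)
      (Measure.pi fun _ => μ) :=
  (integrable_finsetSum _ fun i _ => (integrable_comp_eval (μ := fun _ : Fin n => μ) (i := i)
    (hf i)).sub (integrable_const _)).abs

/-- Mean deviation of a sum of independent square-integrable variables. -/
lemma integral_abs_sum_sub_le (hf : ∀ i, Measurable (f i)) (hd : MemLp d 2 μ)
    (hfd : ∀ i, ∀ᵐ x ∂μ, |f i x| ≤ d x) :
    ∫ ω : Fin n → ℝ, |∑ i, (f i (ω i) - ∫ x, f i x ∂μ)| ∂(Measure.pi fun _ => μ) ≤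
      √(∫ x, d x ^ 2 ∂μ) * √n := by
  have hL : ∀ i, MemLp (f i) 2 μ := fun i => hd.of_le (hf i).aestronglyMeasurable (by
    filter_upwards [hfd i] with x hx
    rw [Real.norm_eq_abs, Real.norm_eq_abs]
    exact hx.trans (le_abs_self _))
  have hL' : ∀ i, MemLp (fun ω : Fin n → ℝ => f i (ω i)) 2 (Measure.pi fun _ => μ) := fun i =>
    (hL i).comp_measurePreserving (measurePreserving_eval (fun _ : Fin n => μ) i)
  have hY : MemLp (∑ i, fun ω : Fin n → ℝ => f i (ω i)) 2 (Measure.pi fun _ => μ) :=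
    memLp_finsetSum' _ fun i _ => hL' i
  have h := abs_integral_le_sqrt hY
  have hint : ∫ ω : Fin n → ℝ, (∑ i, fun ω : Fin n → ℝ => f i (ω i)) ω
      ∂(Measure.pi fun _ => μ) = ∑ i, ∫ x, f i x ∂μ := by
    simp only [Finset.sum_apply]
    rw [integral_finsetSum _ fun i _ => (hL' i).integrable (by norm_num)]
    exact Finset.sum_congr rfl fun i _ => integral_comp_eval (μ := fun _ : Fin n => μ)
      (hf i).aestronglyMeasurable
  rw [hint, variance_sum_pi hL] at h
  simp only [Finset.sum_apply, ← Finset.sum_sub_distrib] at h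
  refine h.trans ?_
  rw [← Real.sqrt_mul (integral_nonneg fun x => sq_nonneg _)]
  refine Real.sqrt_le_sqrt ?_
  have hV : ∀ i ∈ Finset.univ, Var[f i; μ] ≤ ∫ x, d x ^ 2 ∂μ := by
    intro i _
    refine (variance_le_expectation_sq (hf i).aestronglyMeasurable).trans ?_
    refine integral_mono_ae (hL i).integrable_sq hd.integrable_sq ?_
    filter_upwards [hfd i] with x hx
    simp only [Pi.pow_apply]
    rw [← sq_abs]
    exact pow_le_pow_left₀ (abs_nonneg _) hx 2
  refine (Finset.sum_le_sum hV).trans (le_of_eq ?_)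
  simp [mul_comm]

end Concentration

section ScalarConcentration

variable {P0 : Measure ℝ} [IsProbabilityMeasure P0] {S : ℝ}

/-- The mean log-partition function of the scalar Gaussian channel given the signal. -/
noncomputable def scalarLog (P0 : Measure ℝ) (q m X : ℝ) : ℝ :=
  ∫ z, Real.log (scalarPart P0 q m X z) ∂stdGauss

lemma memLp_scalarBound (S q m : ℝ) :
    MemLp (fun z => √q * S * |z| + q * S ^ 2 / 2 + |m| * S * S) 2 stdGauss := by
  have h : MemLp (fun z : ℝ => z) 2 stdGauss := memLp_id_gaussianReal (μ := 0) (v := 1) 2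
  exact ((h.abs.const_mul _).add (memLp_const _)).add (memLp_const _)

lemma abs_scalarLog_le (hS : 0 ≤ S) (hP : ∀ᵐ x ∂P0, |x| ≤ S) {q : ℝ} (hq : 0 ≤ q) (m : ℝ) {X : ℝ}
    (hX : |X| ≤ S) : |scalarLog P0 q m X| ≤
      ∫ z, (√q * S * |z| + q * S ^ 2 / 2 + |m| * S * S) ∂stdGauss := by
  refine (abs_integral_le_integral_abs).trans (integral_mono
    (integrable_log_scalarPart hP hq m X).abs
    ((memLp_scalarBound S q m).integrable (by norm_num)) fun z => ?_)
  refine (abs_log_scalarPart_le hP hq m X z).trans ?_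
  have := mul_le_mul_of_nonneg_left hX (mul_nonneg (abs_nonneg m) hS)
  linarith

lemma exists_scalar_deviation (hS : 0 ≤ S) (hP : ∀ᵐ x ∂P0, |x| ≤ S) {q : ℝ} (hq : 0 ≤ q)
    (m : ℝ) : ∃ c : ℝ, ∀ n : ℕ,
      (∀ X : Fin n → ℝ, (∀ i, |X i| ≤ S) →
        ∫ h, |∑ i, (Real.log (scalarPart P0 q m (X i) (h i)) - scalarLog P0 q m (X i))|
          ∂(gaussPi (Fin n)) ≤ c * √n) ∧
      ∫ X : Fin n → ℝ, |∑ i, (scalarLog P0 q m (X i) - scalarMean P0 q m)|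
        ∂(Measure.pi fun _ => P0) ≤ c * √n := by
  set d : ℝ → ℝ := fun z => √q * S * |z| + q * S ^ 2 / 2 + |m| * S * S with hd
  refine ⟨max √(∫ z, d z ^ 2 ∂stdGauss) √(∫ _, (∫ z, d z ∂stdGauss) ^ 2 ∂P0), fun n => ⟨?_, ?_⟩⟩
  · intro X hX
    refine (integral_abs_sum_sub_le (μ := stdGauss)
      (f := fun i z => Real.log (scalarPart P0 q m (X i) z)) (d := d) (fun i => ?_)
      (memLp_scalarBound S q m) fun i => .of_forall fun z => ?_).trans
      (mul_le_mul_of_nonneg_right (le_max_left _ _) (Real.sqrt_nonneg _))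
    · exact Real.measurable_log.comp ((measurable_scalarPart q m).comp
        (measurable_prodMk_left (x := X i)))
    · refine (abs_log_scalarPart_le hP hq m (X i) z).trans ?_
      have := mul_le_mul_of_nonneg_left (hX i) (mul_nonneg (abs_nonneg m) hS)
      simp only [hd]
      linarith
  · refine (integral_abs_sum_sub_le (μ := P0) (f := fun _ X => scalarLog P0 q m X)
      (d := fun _ => ∫ z, d z ∂stdGauss) (fun i => measurable_integral_log_scalarPart q m)
      (memLp_const _) fun i => ?_).trans
      (mul_le_mul_of_nonneg_right (le_max_right _ _) (Real.sqrt_nonneg _))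
    filter_upwards [hP] with x hx using abs_scalarLog_le hS hP hq m hx

end ScalarConcentration

section Weighted

variable {A Ω : Type*} [Fintype A] [MeasurableSpace Ω] {ν : Measure Ω} [IsProbabilityMeasure ν]
  {w : Ω → ℝ} {u : Ω → A → ℝ} {B : ℝ}

lemma exp_mul_gaussExp_bounds {y : ℝ} {v g : A → ℝ} (hy : |y| ≤ B) (hv : ∀ a, |v a| ≤ B) :
    Real.exp (-(B * ∑ a, |g a| + (Fintype.card A * B ^ 2 + B))) ≤ Real.exp y * gaussExp v g ∧
      Real.exp y * gaussExp v g ≤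
        Real.exp (B * ∑ a, |g a| + (Fintype.card A * B ^ 2 + B)) := by
  have h1 := abs_le.1 hy
  have h2 := abs_le.1 (abs_gaussExp_exponent_le (g := g) hv)
  unfold gaussExp
  rw [← Real.exp_add, Real.exp_le_exp, Real.exp_le_exp]
  constructor <;> linarith [h1.1, h1.2, h2.1, h2.2]

lemma measurable_exp_mul_gaussExp (hw : Measurable w) (hu : Measurable u) :
    Measurable (Function.uncurry fun (g : A → ℝ) σ => Real.exp (w σ) * gaussExp (u σ) g) :=
  (Real.measurable_exp.comp (hw.comp measurable_snd)).mul (measurable_gaussExp_uncurry hu)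

lemma integrable_exp_mul_gaussExp (hw : Measurable w) (hu : Measurable u)
    (hwB : ∀ᵐ σ ∂ν, |w σ| ≤ B) (huB : ∀ᵐ σ ∂ν, ∀ a, |u σ a| ≤ B) (g : A → ℝ) :
    Integrable (fun σ => Real.exp (w σ) * gaussExp (u σ) g) ν := by
  refine Integrable.of_bound ((measurable_exp_mul_gaussExp hw hu).comp
    (measurable_prodMk_left (x := g))).aestronglyMeasurable
    (Real.exp (B * ∑ a, |g a| + (Fintype.card A * B ^ 2 + B))) ?_
  filter_upwards [hwB, huB] with σ h1 h2
  rw [Real.norm_eq_abs, abs_of_pos (mul_pos (Real.exp_pos _) (gaussExp_pos _ _))]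
  exact (exp_mul_gaussExp_bounds h1 h2).2

lemma weighted_partition_bounds (hw : Measurable w) (hu : Measurable u)
    (hwB : ∀ᵐ σ ∂ν, |w σ| ≤ B) (huB : ∀ᵐ σ ∂ν, ∀ a, |u σ a| ≤ B) (g : A → ℝ) :
    Real.exp (-(B * ∑ a, |g a| + (Fintype.card A * B ^ 2 + B))) ≤
        ∫ σ, Real.exp (w σ) * gaussExp (u σ) g ∂ν ∧
      ∫ σ, Real.exp (w σ) * gaussExp (u σ) g ∂ν ≤
        Real.exp (B * ∑ a, |g a| + (Fintype.card A * B ^ 2 + B)) := by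
  have hi := integrable_exp_mul_gaussExp hw hu hwB huB g
  constructor
  · have := integral_mono_ae (integrable_const (μ := ν)
      (Real.exp (-(B * ∑ a, |g a| + (Fintype.card A * B ^ 2 + B))))) hi (by
        filter_upwards [hwB, huB] with σ h1 h2 using (exp_mul_gaussExp_bounds h1 h2).1)
    simpa using this
  · have := integral_mono_ae hi (integrable_const (μ := ν)
      (Real.exp (B * ∑ a, |g a| + (Fintype.card A * B ^ 2 + B)))) (by
        filter_upwards [hwB, huB] with σ h1 h2 using (exp_mul_gaussExp_bounds h1 h2).2)
    simpa using this

lemma integrable_log_weighted_partition (hw : Measurable w) (hu : Measurable u)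
    (hwB : ∀ᵐ σ ∂ν, |w σ| ≤ B) (huB : ∀ᵐ σ ∂ν, ∀ a, |u σ a| ≤ B) :
    Integrable (fun g => Real.log (∫ σ, Real.exp (w σ) * gaussExp (u σ) g ∂ν)) (gaussPi A) := by
  refine integrable_of_gauss_dom (C := Real.exp (Fintype.card A * B ^ 2 + B)) (K := B)
    (Real.measurable_log.comp (measurable_integral_param (measurable_exp_mul_gaussExp hw hu)))
    fun g => ?_
  have h := weighted_partition_bounds hw hu hwB huB g
  rw [← Real.exp_add, add_comm]
  exact (abs_log_le_of_exp_bounds h.1 h.2).trans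
    ((le_add_of_nonneg_right zero_le_one).trans (Real.add_one_le_exp _))

end Weighted

section Uniform

/-- The uniform distribution on `Fin (K + 1)`. -/
noncomputable def unifFin (K : ℕ) : Measure (Fin (K + 1)) :=
  (PMF.uniformOfFintype (Fin (K + 1))).toMeasure

instance (K : ℕ) : IsProbabilityMeasure (unifFin K) :=
  inferInstanceAs (IsProbabilityMeasure (PMF.uniformOfFintype (Fin (K + 1))).toMeasure)

lemma integral_unifFin_prod {Ω : Type*} [MeasurableSpace Ω] {μ : Measure Ω} [SFinite μ] {K : ℕ}
    {f : Fin (K + 1) × Ω → ℝ} (hf : Integrable f ((unifFin K).prod μ)) :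
    ∫ σ, f σ ∂((unifFin K).prod μ) = ((K : ℝ) + 1)⁻¹ * ∑ k, ∫ x, f (k, x) ∂μ := by
  rw [integral_prod _ hf, unifFin, PMF.integral_eq_sum, Finset.mul_sum]
  refine Finset.sum_congr rfl fun k _ => ?_
  have : ((K : ENNReal) + 1).toReal = K + 1 := by exact_mod_cast ENNReal.toReal_natCast (K + 1)
  simp [this]

end Uniform

section Grid

variable {P0 : Measure ℝ} [IsProbabilityMeasure P0] {S : ℝ} {n K : ℕ} {m : Fin (K + 1) → ℝ}

/-- The tilt that linearizes the squared overlap around the values `m`. -/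
noncomputable def gridTilt (m : Fin (K + 1) → ℝ) (X : Fin n → ℝ)
    (σ : Fin (K + 1) × (Fin n → ℝ)) : ℝ :=
  m σ.1 * ∑ i, σ.2 i * X i - n / 4 * m σ.1 ^ 2

/-- The spike field, with an additional component labelled by the grid point. -/
noncomputable def gridSpike (m : Fin (K + 1) → ℝ) (σ : Fin (K + 1) × (Fin n → ℝ)) :
    (Fin n × Fin n) ⊕ Unit → ℝ :=
  extSpikeVec n (√(n / 2) * |m σ.1|) σ.2

/-- The decoupled field at the grid point. -/
noncomputable def gridScalar (m : Fin (K + 1) → ℝ) (σ : Fin (K + 1) × (Fin n → ℝ)) :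
    Fin n → ℝ :=
  √|m σ.1| • σ.2

lemma measurable_grid_fst (m : Fin (K + 1) → ℝ) :
    Measurable fun σ : Fin (K + 1) × (Fin n → ℝ) => m σ.1 :=
  (Measurable.of_discrete (f := m)).comp measurable_fst

lemma measurable_gridTilt (m : Fin (K + 1) → ℝ) (X : Fin n → ℝ) : Measurable (gridTilt m X) := by
  unfold gridTilt
  have := measurable_grid_fst (n := n) m
  fun_prop

lemma measurable_gridSpike (m : Fin (K + 1) → ℝ) : Measurable (gridSpike (n := n) m) := by
  have := measurable_grid_fst (n := n) m
  unfold gridSpike extSpikeVec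
  exact measurable_sumElim ((measurable_spikeVec n).comp measurable_snd)
    (measurable_pi_lambda _ fun _ => by fun_prop)

lemma measurable_gridScalar (m : Fin (K + 1) → ℝ) : Measurable (gridScalar (n := n) m) := by
  have := measurable_grid_fst (n := n) m
  unfold gridScalar
  fun_prop

lemma ae_grid_abs_le (hP : ∀ᵐ x ∂P0, |x| ≤ S) (n K : ℕ) :
    ∀ᵐ σ ∂((unifFin K).prod (Measure.pi fun _ : Fin n => P0)), ∀ i, |σ.2 i| ≤ S :=
  Measure.quasiMeasurePreserving_snd.ae (ae_pi_abs_le hP n)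

lemma abs_sum_mul_le (hS : 0 ≤ S) {x X : Fin n → ℝ} (hx : ∀ i, |x i| ≤ S) (hX : ∀ i, |X i| ≤ S) :
    |∑ i, x i * X i| ≤ n * S ^ 2 := by
  refine (Finset.abs_sum_le_sum_abs _ _).trans ?_
  refine (Finset.sum_le_card_nsmul _ _ (S ^ 2) fun i _ => ?_).trans (by simp)
  rw [abs_mul, sq]
  exact mul_le_mul (hx i) (hX i) (abs_nonneg _) hS

/-- A uniform bound on the fields of the grid model. -/
noncomputable def gridBound (S : ℝ) (n : ℕ) : ℝ :=
  S ^ 2 * (n * S ^ 2) + n / 4 * (S ^ 2) ^ 2 + S ^ 2 + √(n / 2) * S ^ 2 + √(S ^ 2) * S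

lemma gridBound_nonneg (hS : 0 ≤ S) (n : ℕ) : 0 ≤ gridBound S n := by
  unfold gridBound
  positivity

lemma ae_abs_gridTilt_le (hS : 0 ≤ S) (hP : ∀ᵐ x ∂P0, |x| ≤ S) (hm : ∀ k, |m k| ≤ S ^ 2)
    {X : Fin n → ℝ} (hX : ∀ i, |X i| ≤ S) :
    ∀ᵐ σ ∂((unifFin K).prod (Measure.pi fun _ : Fin n => P0)),
      |gridTilt m X σ| ≤ gridBound S n := by
  filter_upwards [ae_grid_abs_le hP n K] with σ hσ
  unfold gridTilt gridBound
  refine (abs_sub _ _).trans ?_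
  rw [abs_mul, abs_of_nonneg (by positivity : 0 ≤ n / 4 * m σ.1 ^ 2), ← sq_abs (m σ.1)]
  have h1 := mul_le_mul (hm σ.1) (abs_sum_mul_le hS hσ hX) (abs_nonneg _) (sq_nonneg S)
  have h2 := mul_le_mul_of_nonneg_left (pow_le_pow_left₀ (abs_nonneg _) (hm σ.1) 2)
    (by positivity : (0 : ℝ) ≤ n / 4)
  have h3 : 0 ≤ S ^ 2 + √(n / 2) * S ^ 2 + √(S ^ 2) * S := by positivity
  linarith

lemma ae_abs_gridSpike_le (hn : 0 < n) (hS : 0 ≤ S) (hP : ∀ᵐ x ∂P0, |x| ≤ S)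
    (hm : ∀ k, |m k| ≤ S ^ 2) :
    ∀ᵐ σ ∂((unifFin K).prod (Measure.pi fun _ : Fin n => P0)), ∀ p,
      |gridSpike m σ p| ≤ gridBound S n := by
  filter_upwards [ae_grid_abs_le hP n K] with σ hσ p
  rcases p with p | p
  · refine (abs_spikeVec_le hn hS hσ p).trans ?_
    have h3 : 0 ≤ S ^ 2 * (n * S ^ 2) + n / 4 * (S ^ 2) ^ 2 + √(n / 2) * S ^ 2 + √(S ^ 2) * S := by
      positivity
    unfold gridBound
    linarith
  · simp only [gridSpike, extSpikeVec, Sum.elim_inr]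
    rw [abs_mul, abs_abs, abs_of_nonneg (Real.sqrt_nonneg _)]
    have h1 := mul_le_mul_of_nonneg_left (hm σ.1) (Real.sqrt_nonneg (n / 2))
    have h3 : 0 ≤ S ^ 2 * (n * S ^ 2) + n / 4 * (S ^ 2) ^ 2 + S ^ 2 + √(S ^ 2) * S := by
      positivity
    unfold gridBound
    linarith

lemma ae_abs_gridScalar_le (hP : ∀ᵐ x ∂P0, |x| ≤ S)
    (hm : ∀ k, |m k| ≤ S ^ 2) :
    ∀ᵐ σ ∂((unifFin K).prod (Measure.pi fun _ : Fin n => P0)), ∀ i,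
      |gridScalar m σ i| ≤ gridBound S n := by
  filter_upwards [ae_grid_abs_le hP n K] with σ hσ i
  simp only [gridScalar, Pi.smul_apply, smul_eq_mul]
  rw [abs_mul, abs_of_nonneg (Real.sqrt_nonneg _)]
  have h1 := mul_le_mul (Real.sqrt_le_sqrt (hm σ.1)) (hσ i) (abs_nonneg _) (Real.sqrt_nonneg _)
  have h3 : 0 ≤ S ^ 2 * (n * S ^ 2) + n / 4 * (S ^ 2) ^ 2 + S ^ 2 + √(n / 2) * S ^ 2 := by
    positivity
  unfold gridBound
  linarith

lemma gridScalar_cov_le (hn : 0 < n) (m : Fin (K + 1) → ℝ) (σ τ : Fin (K + 1) × (Fin n → ℝ)) :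
    ∑ i, gridScalar m σ i * gridScalar m τ i ≤ ∑ p, gridSpike m σ p * gridSpike m τ p := by
  have hn' : (0 : ℝ) < n := by exact_mod_cast hn
  set s := √|m σ.1| * √|m τ.1| with hs
  have hs2 : s ^ 2 = |m σ.1| * |m τ.1| := by
    rw [hs, mul_pow, Real.sq_sqrt (abs_nonneg _), Real.sq_sqrt (abs_nonneg _)]
  have e1 : ∑ i, gridScalar m σ i * gridScalar m τ i = s * ∑ i, σ.2 i * τ.2 i := by
    rw [Finset.mul_sum]
    refine Finset.sum_congr rfl fun i _ => ?_
    simp only [gridScalar, Pi.smul_apply, smul_eq_mul]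
    ring
  have e2 : √(n / 2) * |m σ.1| * (√(n / 2) * |m τ.1|) = n / 2 * s ^ 2 := by
    rw [hs2, mul_mul_mul_comm, Real.mul_self_sqrt (by positivity)]
  rw [e1]
  simp only [gridSpike, extSpikeVec, Fintype.sum_sum_type, Sum.elim_inl, Sum.elim_inr,
    sum_spikeVec_mul, Finset.univ_unique, Finset.sum_singleton, e2]
  set R := ∑ i, σ.2 i * τ.2 i
  have h3 : 0 ≤ ∑ i, (σ.2 i * τ.2 i) ^ 2 := Finset.sum_nonneg fun _ _ => sq_nonneg _
  have h4 : (R ^ 2 + ∑ i, (σ.2 i * τ.2 i) ^ 2) / (2 * n) + n / 2 * s ^ 2 - s * R =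
      ((R - n * s) ^ 2 + ∑ i, (σ.2 i * τ.2 i) ^ 2) / (2 * n) := by
    field_simp; ring
  have h5 : 0 ≤ ((R - n * s) ^ 2 + ∑ i, (σ.2 i * τ.2 i) ^ 2) / (2 * n) := by positivity
  linarith

lemma integral_log_gridSpike_le (hn : 0 < n) (hS : 0 ≤ S) (hP : ∀ᵐ x ∂P0, |x| ≤ S)
    (hm : ∀ k, |m k| ≤ S ^ 2) {X : Fin n → ℝ} (hX : ∀ i, |X i| ≤ S) :
    ∫ g, Real.log (∫ σ, Real.exp (gridTilt m X σ) * gaussExp (gridSpike m σ) g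
        ∂((unifFin K).prod (Measure.pi fun _ : Fin n => P0))) ∂(gaussPi ((Fin n × Fin n) ⊕ Unit)) ≤
      ∫ h, Real.log (∫ σ, Real.exp (gridTilt m X σ) * gaussExp (gridScalar m σ) h
        ∂((unifFin K).prod (Measure.pi fun _ : Fin n => P0))) ∂(gaussPi (Fin n)) := by
  have h := kahane_comparison isKahane_neg_log (gridBound_nonneg hS n) (measurable_gridTilt m X)
    (measurable_gridSpike m) (measurable_gridScalar m) (ae_abs_gridTilt_le hS hP hm hX)
    (ae_abs_gridSpike_le hn hS hP hm) (ae_abs_gridScalar_le hP hm) (gridScalar_cov_le hn m)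
  rw [integral_neg, integral_neg] at h
  exact neg_le_neg_iff.1 h

lemma gridTilt_scalar (X h x : Fin n → ℝ) (k : Fin (K + 1)) :
    Real.exp (gridTilt m X (k, x)) * gaussExp (gridScalar m (k, x)) h =
      Real.exp (-(n / 4 * m k ^ 2)) *
        Real.exp (∑ i, (√|m k| * h i * x i - |m k| * x i ^ 2 / 2 + m k * x i * X i)) := by
  unfold gaussExp gridTilt gridScalar
  rw [← Real.exp_add, ← Real.exp_add]
  congr 1
  rw [Finset.sum_add_distrib, Finset.sum_sub_distrib, Finset.mul_sum, Finset.sum_div]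
  simp only [Pi.smul_apply, smul_eq_mul, mul_pow, Real.sq_sqrt (abs_nonneg _)]
  have e1 : ∑ i, h i * (√|m k| * x i) = ∑ i, √|m k| * h i * x i :=
    Finset.sum_congr rfl fun i _ => by ring
  have e2 : ∑ i, m k * (x i * X i) = ∑ i, m k * x i * X i :=
    Finset.sum_congr rfl fun i _ => by ring
  rw [e1, e2]
  ring

lemma log_gridScalar_le (hS : 0 ≤ S) (hP : ∀ᵐ x ∂P0, |x| ≤ S) (hm : ∀ k, |m k| ≤ S ^ 2) {M : ℝ}
    (hM : ∀ m, scalarMean P0 |m| m - m ^ 2 / 4 ≤ M) {X : Fin n → ℝ} (hX : ∀ i, |X i| ≤ S)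
    (h : Fin n → ℝ) :
    Real.log (∫ σ, Real.exp (gridTilt m X σ) * gaussExp (gridScalar m σ) h
        ∂((unifFin K).prod (Measure.pi fun _ : Fin n => P0))) ≤
      n * M + ∑ k, (|∑ i, (Real.log (scalarPart P0 |m k| (m k) (X i) (h i)) -
        scalarLog P0 |m k| (m k) (X i))| +
        |∑ i, (scalarLog P0 |m k| (m k) (X i) - scalarMean P0 |m k| (m k))|) := by
  have hb := weighted_partition_bounds (measurable_gridTilt m X) (measurable_gridScalar m)
    (ae_abs_gridTilt_le hS hP hm hX) (ae_abs_gridScalar_le hP hm) h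
  have hi := integrable_exp_mul_gaussExp (measurable_gridTilt m X) (measurable_gridScalar m)
    (ae_abs_gridTilt_le hS hP hm hX) (ae_abs_gridScalar_le hP hm) h
  rw [Real.log_le_iff_le_exp ((Real.exp_pos _).trans_le hb.1), integral_unifFin_prod hi]
  simp_rw [gridTilt_scalar, integral_const_mul, integral_exp_sum_eq_prod]
  set D : Fin (K + 1) → ℝ := fun k =>
    |∑ i, (Real.log (scalarPart P0 |m k| (m k) (X i) (h i)) - scalarLog P0 |m k| (m k) (X i))| +
      |∑ i, (scalarLog P0 |m k| (m k) (X i) - scalarMean P0 |m k| (m k))| with hD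
  have hterm : ∀ k ∈ Finset.univ, Real.exp (-(n / 4 * m k ^ 2)) *
      ∏ i, scalarPart P0 |m k| (m k) (X i) (h i) ≤ Real.exp (n * M + ∑ k, D k) := by
    intro k _
    have e : ∏ i, scalarPart P0 |m k| (m k) (X i) (h i) =
        Real.exp (∑ i, Real.log (scalarPart P0 |m k| (m k) (X i) (h i))) := by
      rw [Real.exp_sum]
      exact Finset.prod_congr rfl fun i _ =>
        (Real.exp_log (scalarPart_pos hP (abs_nonneg _) _ _ _)).symm
    rw [e, ← Real.exp_add, Real.exp_le_exp]
    have h1 := le_abs_self (∑ i, (Real.log (scalarPart P0 |m k| (m k) (X i) (h i)) -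
      scalarLog P0 |m k| (m k) (X i)))
    have h2 := le_abs_self (∑ i, (scalarLog P0 |m k| (m k) (X i) - scalarMean P0 |m k| (m k)))
    have h3 : D k ≤ ∑ k, D k := Finset.single_le_sum (f := D)
      (fun k _ => add_nonneg (abs_nonneg _) (abs_nonneg _)) (Finset.mem_univ k)
    have h4 := mul_le_mul_of_nonneg_left (hM (m k)) (Nat.cast_nonneg n : (0 : ℝ) ≤ n)
    have h5 : ∑ i, (Real.log (scalarPart P0 |m k| (m k) (X i) (h i)) -
        scalarLog P0 |m k| (m k) (X i)) + ∑ i, (scalarLog P0 |m k| (m k) (X i) -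
        scalarMean P0 |m k| (m k)) = ∑ i, Real.log (scalarPart P0 |m k| (m k) (X i) (h i)) -
        n * scalarMean P0 |m k| (m k) := by
      rw [Finset.sum_sub_distrib, Finset.sum_sub_distrib]
      simp
    simp only [hD] at h3 ⊢
    linarith
  have hsum := Finset.sum_le_card_nsmul _ _ _ hterm
  rw [Finset.card_univ, Fintype.card_fin, nsmul_eq_mul, Nat.cast_add, Nat.cast_one] at hsum
  rw [inv_mul_le_iff₀ (by positivity)]
  exact hsum

end Grid

section UpperBound

variable {P0 : Measure ℝ} [IsProbabilityMeasure P0] {S : ℝ} {n K : ℕ} {m : Fin (K + 1) → ℝ} {δ : ℝ}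

lemma gaussExp_add {A : Type*} [Fintype A] (u g v : A → ℝ) :
    gaussExp u (g + v) = Real.exp (∑ a, u a * v a) * gaussExp u g := by
  unfold gaussExp
  rw [← Real.exp_add]
  congr 1
  simp only [Pi.add_apply, add_mul, Finset.sum_add_distrib]
  rw [Finset.sum_congr rfl fun a _ => mul_comm (v a) (u a)]
  ring

lemma gaussExp_planted_le (hn : 0 < n) (hS : 0 ≤ S) (hm : ∀ k, |m k| ≤ S ^ 2)
    (hcov : ∀ t, |t| ≤ S ^ 2 → ∃ k, |t - m k| ≤ δ) {x X : Fin n → ℝ}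
    (hx : ∀ i, |x i| ≤ S) (hX : ∀ i, |X i| ≤ S) (g : Fin n × Fin n → ℝ) (y : Unit → ℝ) :
    gaussExp (spikeVec n x) (g + spikeVec n X) ≤
      Real.exp (S ^ 4 / 2 + n * δ ^ 2 / 2 + √(n / 2) * S ^ 2 * |y ()|) *
        ∑ k, Real.exp (gridTilt m X (k, x)) * gaussExp (gridSpike m (k, x)) (Sum.elim g y) := by
  have hn' : (0 : ℝ) < n := by exact_mod_cast hn
  set T := ∑ i, x i * X i with hT
  obtain ⟨k, hk⟩ := hcov (T / n) (by
    rw [abs_div, abs_of_pos hn', div_le_iff₀ hn', mul_comm]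
    exact abs_sum_mul_le hS hx hX)
  have hk2 : (T - n * m k) ^ 2 / (2 * n) ≤ n * δ ^ 2 / 2 := by
    have e : (T - n * m k) ^ 2 / (2 * n) = n * (T / n - m k) ^ 2 / 2 := by field_simp
    have := pow_le_pow_left₀ (abs_nonneg _) hk 2
    rw [sq_abs] at this
    rw [e]
    nlinarith [mul_le_mul_of_nonneg_left this hn'.le]
  have hsq : ∑ i, (x i * X i) ^ 2 ≤ n * S ^ 4 := by
    refine (Finset.sum_le_card_nsmul _ _ (S ^ 4) fun i _ => ?_).trans (by simp)
    rw [mul_pow, ← sq_abs (x i), ← sq_abs (X i)]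
    have := mul_le_mul (pow_le_pow_left₀ (abs_nonneg _) (hx i) 2)
      (pow_le_pow_left₀ (abs_nonneg _) (hX i) 2) (by positivity) (by positivity)
    calc _ ≤ _ := this
      _ = S ^ 4 := by ring
  have hcov2 : ∑ p, spikeVec n x p * spikeVec n X p ≤
      S ^ 4 / 2 + n * δ ^ 2 / 2 + (m k * T - n / 2 * m k ^ 2) := by
    rw [sum_spikeVec_mul, ← hT, add_div]
    have e : T ^ 2 / (2 * n) = (T - n * m k) ^ 2 / (2 * n) + (m k * T - n / 2 * m k ^ 2) := by
      field_simp; ring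
    have : (∑ i, (x i * X i) ^ 2) / (2 * n) ≤ S ^ 4 / 2 := by
      rw [div_le_div_iff₀ (by positivity) (by norm_num)]
      nlinarith
    linarith
  have hy : -(√(n / 2) * S ^ 2 * |y ()|) ≤ y () * (√(n / 2) * |m k|) := by
    have h1 := mul_le_mul_of_nonneg_left (neg_abs_le (y ())) (by positivity : 0 ≤ √(n / 2) * |m k|)
    have h2 := mul_le_mul_of_nonneg_right (hm k) (by positivity : 0 ≤ √(n / 2) * |y ()|)
    nlinarith
  have hg : gaussExp (fun _ : Unit => √(n / 2) * |m k|) y =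
      Real.exp (y () * (√(n / 2) * |m k|) - n / 4 * m k ^ 2) := by
    unfold gaussExp
    simp only [Finset.univ_unique, Finset.sum_singleton, mul_pow, sq_abs]
    rw [Real.sq_sqrt (by positivity)]
    congr 1
    ring
  have hterm : gaussExp (spikeVec n x) (g + spikeVec n X) ≤
      Real.exp (S ^ 4 / 2 + n * δ ^ 2 / 2 + √(n / 2) * S ^ 2 * |y ()|) *
        (Real.exp (gridTilt m X (k, x)) * gaussExp (gridSpike m (k, x)) (Sum.elim g y)) := by
    simp only [gridSpike, extSpikeVec, gridTilt]
    rw [gaussExp_add, gaussExp_sumElim, hg, mul_comm (gaussExp (spikeVec n x) g), ← mul_assoc,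
      ← mul_assoc, ← Real.exp_add, ← Real.exp_add]
    refine mul_le_mul_of_nonneg_right (Real.exp_le_exp.2 ?_) (gaussExp_pos _ _).le
    linarith
  refine hterm.trans (mul_le_mul_of_nonneg_left ?_ (Real.exp_pos _).le)
  exact Finset.single_le_sum
    (f := fun k => Real.exp (gridTilt m X (k, x)) * gaussExp (gridSpike m (k, x)) (Sum.elim g y))
    (fun k _ => (mul_pos (Real.exp_pos _) (gaussExp_pos _ _)).le) (Finset.mem_univ k)

lemma forall_of_ae_unifFin {p : Fin (K + 1) → Prop} (h : ∀ᵐ k ∂(unifFin K), p k) (k) : p k := by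
  by_contra hk
  have h0 : unifFin K {k} = 0 := measure_mono_null (Set.singleton_subset_iff.2 hk) (ae_iff.1 h)
  rw [unifFin, PMF.toMeasure_apply_singleton _ _ (measurableSet_singleton k)] at h0
  simp at h0

lemma log_planted_le (hn : 0 < n) (hS : 0 ≤ S) (hP : ∀ᵐ x ∂P0, |x| ≤ S)
    (hm : ∀ k, |m k| ≤ S ^ 2) (hcov : ∀ t, |t| ≤ S ^ 2 → ∃ k, |t - m k| ≤ δ) {X : Fin n → ℝ}
    (hX : ∀ i, |X i| ≤ S) (g : Fin n × Fin n → ℝ) (y : Unit → ℝ) :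
    Real.log (∫ x, gaussExp (spikeVec n x) (g + spikeVec n X)
        ∂(Measure.pi fun _ : Fin n => P0)) ≤
      S ^ 4 / 2 + n * δ ^ 2 / 2 + √(n / 2) * S ^ 2 * |y ()| + Real.log (K + 1) +
        Real.log (∫ σ, Real.exp (gridTilt m X σ) * gaussExp (gridSpike m σ) (Sum.elim g y)
          ∂((unifFin K).prod (Measure.pi fun _ : Fin n => P0))) := by
  have hb := weighted_partition_bounds (measurable_gridTilt m X) (measurable_gridSpike m)
    (ae_abs_gridTilt_le hS hP hm hX) (ae_abs_gridSpike_le hn hS hP hm) (Sum.elim g y)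
  have hi := integrable_exp_mul_gaussExp (measurable_gridTilt m X) (measurable_gridSpike m)
    (ae_abs_gridTilt_le hS hP hm hX) (ae_abs_gridSpike_le hn hS hP hm) (Sum.elim g y)
  have hspike : ∀ᵐ x ∂(Measure.pi fun _ : Fin n => P0), ∀ p, |spikeVec n x p| ≤ S ^ 2 := by
    filter_upwards [ae_pi_abs_le hP n] with x hx using abs_spikeVec_le hn hS hx
  have hZ := (Real.exp_pos _).trans_le hb.1
  have hsec : ∀ k, Integrable (fun x => Real.exp (gridTilt m X (k, x)) *
      gaussExp (gridSpike m (k, x)) (Sum.elim g y)) (Measure.pi fun _ : Fin n => P0) := by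
    exact forall_of_ae_unifFin hi.prod_right_ae
  have hle : ∫ x, gaussExp (spikeVec n x) (g + spikeVec n X) ∂(Measure.pi fun _ : Fin n => P0) ≤
      Real.exp (S ^ 4 / 2 + n * δ ^ 2 / 2 + √(n / 2) * S ^ 2 * |y ()|) * ((K + 1) *
        ∫ σ, Real.exp (gridTilt m X σ) * gaussExp (gridSpike m σ) (Sum.elim g y)
          ∂((unifFin K).prod (Measure.pi fun _ : Fin n => P0))) := by
    rw [integral_unifFin_prod hi, mul_inv_cancel_left₀ (by positivity),
      ← integral_finsetSum _ fun k _ => hsec k, ← integral_const_mul]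
    refine integral_mono_ae (integrable_gaussExp_section (measurable_spikeVec n) hspike _)
      ((integrable_finsetSum _ fun k _ => hsec k).const_mul _) ?_
    filter_upwards [ae_pi_abs_le hP n] with x hx
    exact gaussExp_planted_le hn hS hm hcov hx hX g y
  have hpos : 0 < ∫ x, gaussExp (spikeVec n x) (g + spikeVec n X)
      ∂(Measure.pi fun _ : Fin n => P0) :=
    (Real.exp_pos _).trans_le (partition_bounds (measurable_spikeVec n) hspike _).1
  refine (Real.log_le_log hpos hle).trans (le_of_eq ?_)
  rw [Real.log_mul (Real.exp_pos _).ne' (by positivity), Real.log_exp,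
    Real.log_mul (by positivity) hZ.ne', add_assoc _ (Real.log (K + 1))]

lemma integral_log_planted_le (hn : 0 < n) (hS : 0 ≤ S) (hP : ∀ᵐ x ∂P0, |x| ≤ S)
    (hm : ∀ k, |m k| ≤ S ^ 2) (hcov : ∀ t, |t| ≤ S ^ 2 → ∃ k, |t - m k| ≤ δ) {X : Fin n → ℝ}
    (hX : ∀ i, |X i| ≤ S) :
    ∫ g, Real.log (∫ x, gaussExp (spikeVec n x) (g + spikeVec n X)
        ∂(Measure.pi fun _ : Fin n => P0)) ∂(gaussPi (Fin n × Fin n)) ≤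
      S ^ 4 / 2 + n * δ ^ 2 / 2 + √(n / 2) * S ^ 2 * ∫ z, |z| ∂stdGauss + Real.log (K + 1) +
        ∫ h, Real.log (∫ σ, Real.exp (gridTilt m X σ) * gaussExp (gridScalar m σ) h
          ∂((unifFin K).prod (Measure.pi fun _ : Fin n => P0))) ∂(gaussPi (Fin n)) := by
  have hspike : ∀ᵐ x ∂(Measure.pi fun _ : Fin n => P0), ∀ p, |spikeVec n x p| ≤ S ^ 2 := by
    filter_upwards [ae_pi_abs_le hP n] with x hx using abs_spikeVec_le hn hS hx
  have hL := (integrable_log_partition (measurable_spikeVec n) hspike (spikeVec n X)).comp_fst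
    (gaussPi Unit)
  have hR := ((measurePreserving_sumPiEquivProdPi_symm
    (X := fun _ : (Fin n × Fin n) ⊕ Unit => ℝ) fun _ => stdGauss).integrable_comp_emb
    (MeasurableEquiv.measurableEmbedding _)).2
    (integrable_log_weighted_partition (measurable_gridTilt m X) (measurable_gridSpike m)
      (ae_abs_gridTilt_le hS hP hm hX) (ae_abs_gridSpike_le hn hS hP hm))
  have hy : Integrable (fun y : Unit → ℝ => |y ()|) (gaussPi Unit) :=
    integrable_comp_eval (μ := fun _ : Unit => stdGauss) (i := ()) integrable_abs_stdGauss
  have hyi : ∫ y : Unit → ℝ, |y ()| ∂(gaussPi Unit) = ∫ z, |z| ∂stdGauss :=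
    integral_comp_eval (μ := fun _ : Unit => stdGauss) (i := ()) (f := fun z => |z|)
      integrable_abs_stdGauss.aestronglyMeasurable
  have hY := ((hy.comp_snd (gaussPi (Fin n × Fin n))).const_mul (√(n / 2) * S ^ 2))
  have hc : ∀ c : ℝ, Integrable (fun _ => c) ((gaussPi (Fin n × Fin n)).prod (gaussPi Unit)) :=
    fun c => integrable_const c
  have h := integral_mono hL
    ((((hc (S ^ 4 / 2 + n * δ ^ 2 / 2)).add hY).add (hc (Real.log (K + 1)))).add hR)
    fun p => log_planted_le hn hS hP hm hcov hX p.1 p.2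
  rw [integral_add' (((hc _).add hY).add (hc _)) hR, integral_add' ((hc _).add hY) (hc _),
    integral_add' (hc _) hY, integral_const_mul,
    integral_fun_fst (μ := gaussPi (Fin n × Fin n)) (ν := gaussPi Unit)
      (fun g => Real.log (∫ x, gaussExp (spikeVec n x) (g + spikeVec n X)
        ∂(Measure.pi fun _ : Fin n => P0))),
    integral_fun_snd (μ := gaussPi (Fin n × Fin n)) (ν := gaussPi Unit) (fun y => |y ()|), hyi] at h
  simp only [probReal_univ, integral_const, smul_eq_mul, one_mul] at h
  refine h.trans (add_le_add le_rfl ?_)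
  refine le_trans (le_of_eq ?_) (integral_log_gridSpike_le hn hS hP hm hX)
  rw [integral_gaussPi_sum]
  rfl

end UpperBound

section LowerBound

variable {P0 : Measure ℝ} [IsProbabilityMeasure P0] {S : ℝ}

lemma exists_neg_fws_le (hS : 0 ≤ S) (hP : ∀ᵐ x ∂P0, |x| ≤ S) {K : ℕ} {m : Fin (K + 1) → ℝ}
    (hm : ∀ k, |m k| ≤ S ^ 2) {δ : ℝ} (hcov : ∀ t, |t| ≤ S ^ 2 → ∃ k, |t - m k| ≤ δ) {M : ℝ}
    (hM : ∀ m, scalarMean P0 |m| m - m ^ 2 / 4 ≤ M) :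
    ∃ C : ℝ, ∀ n : ℕ, 0 < n → -(n * fws P0 n) ≤ n * (M + δ ^ 2 / 2) + C * √n := by
  choose c hc using fun k => exists_scalar_deviation hS hP (abs_nonneg (m k)) (m k)
  set a := ∫ z, |z| ∂stdGauss with ha
  have ha0 : 0 ≤ a := integral_nonneg fun z => abs_nonneg z
  refine ⟨S ^ 4 / 2 + Real.log (K + 1) + S ^ 2 * a + ∑ k, 2 * c k, fun n hn => ?_⟩
  have hn' : (0 : ℝ) < n := by exact_mod_cast hn
  set D : (k : Fin (K + 1)) → (Fin n → ℝ) → ℝ := fun k X =>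
    |∑ i, (scalarLog P0 |m k| (m k) (X i) - scalarMean P0 |m k| (m k))| with hD
  have hDi : ∀ k, Integrable (D k) (Measure.pi fun _ : Fin n => P0) := fun k =>
    integrable_abs_sum_sub (f := fun _ X => scalarLog P0 |m k| (m k) X)
      fun _ => integrable_integral_log_scalarPart hS hP (abs_nonneg _) _
  have hspike : ∀ᵐ x ∂(Measure.pi fun _ : Fin n => P0), ∀ p, |spikeVec n x p| ≤ S ^ 2 := by
    filter_upwards [ae_pi_abs_le hP n] with x hx using abs_spikeVec_le hn hS hx
  set R : ℝ := S ^ 4 / 2 + n * δ ^ 2 / 2 + √(n / 2) * S ^ 2 * a + Real.log (K + 1) with hR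
  have hX : ∀ X : Fin n → ℝ, (∀ i, |X i| ≤ S) →
      ∫ g, Real.log (∫ x, gaussExp (spikeVec n x) (g + spikeVec n X)
        ∂(Measure.pi fun _ : Fin n => P0)) ∂(gaussPi (Fin n × Fin n)) ≤
      (R + n * M + ∑ k, c k * √n) + ∑ k, D k X := by
    intro X hX
    refine (integral_log_planted_le hn hS hP hm hcov hX).trans ?_
    have hdev : ∀ k, Integrable (fun h : Fin n → ℝ =>
        |∑ i, (Real.log (scalarPart P0 |m k| (m k) (X i) (h i)) -
          scalarLog P0 |m k| (m k) (X i))|) (gaussPi (Fin n)) := fun k =>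
      integrable_abs_sum_sub
        (f := fun i z => Real.log (scalarPart P0 |m k| (m k) (X i) z))
        fun i => integrable_log_scalarPart hP (abs_nonneg _) _ _
    have hadd : ∀ k, Integrable (fun h : Fin n → ℝ =>
        |∑ i, (Real.log (scalarPart P0 |m k| (m k) (X i) (h i)) -
          scalarLog P0 |m k| (m k) (X i))| + D k X) (gaussPi (Fin n)) := fun k =>
      (hdev k).add (integrable_const _)
    have hsum := integrable_finsetSum Finset.univ fun k _ => hadd k
    have h1 := integral_mono
      (integrable_log_weighted_partition (measurable_gridTilt m X) (measurable_gridScalar m)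
        (ae_abs_gridTilt_le hS hP hm hX) (ae_abs_gridScalar_le hP hm))
      ((integrable_const (n * M)).add hsum) fun h => log_gridScalar_le hS hP hm hM hX h
    rw [integral_add' (integrable_const _) hsum,
      integral_finsetSum _ fun k _ => hadd k] at h1
    have h2 : ∀ k ∈ Finset.univ, ∫ h : Fin n → ℝ,
        (|∑ i, (Real.log (scalarPart P0 |m k| (m k) (X i) (h i)) -
          scalarLog P0 |m k| (m k) (X i))| + D k X) ∂(gaussPi (Fin n)) ≤ c k * √n + D k X := by
      intro k _
      rw [integral_add (hdev k) (integrable_const _)]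
      simpa using (hc k n).1 X hX
    have h3 := Finset.sum_le_sum h2
    rw [Finset.sum_add_distrib] at h3
    simp only [integral_const, probReal_univ, smul_eq_mul, one_mul] at h1
    simp only [hR]
    linarith
  have hDs : Integrable (fun X : Fin n → ℝ => ∑ k, D k X) (Measure.pi fun _ : Fin n => P0) :=
    integrable_finsetSum _ fun k _ => hDi k
  have hmono := integral_mono_ae (integrable_integral_log_planted (measurable_spikeVec n) hspike)
    ((integrable_const (R + n * M + ∑ k, c k * √n)).add hDs) (by
      filter_upwards [ae_pi_abs_le hP n] with X h using hX X h)
  rw [integral_add' (integrable_const _) hDs, integral_finsetSum _ fun k _ => hDi k] at hmono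
  simp only [integral_const, probReal_univ, smul_eq_mul, one_mul] at hmono
  have h4 := Finset.sum_le_sum fun k (_ : k ∈ Finset.univ) => (hc k n).2
  have e : -(n * fws P0 n) = ∫ X, ∫ g, Real.log (∫ x, gaussExp (spikeVec n x) (g + spikeVec n X)
        ∂(Measure.pi fun _ : Fin n => P0)) ∂(gaussPi (Fin n × Fin n))
        ∂(Measure.pi fun _ : Fin n => P0) := by
    rw [fws_eq]
    field_simp
  rw [e]
  refine hmono.trans ?_
  have hs1 : 1 ≤ √(n : ℝ) := Real.one_le_sqrt.2 (by exact_mod_cast hn)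
  have hs2 : √((n : ℝ) / 2) ≤ √n := Real.sqrt_le_sqrt (by linarith)
  have h5 := mul_le_mul_of_nonneg_right hs2 (by positivity : 0 ≤ S ^ 2 * a)
  have hlog : 0 ≤ Real.log ((K : ℝ) + 1) := Real.log_nonneg (by simp)
  have h6 := mul_le_mul_of_nonneg_left hs1
    (by positivity : 0 ≤ S ^ 4 / 2 + Real.log ((K : ℝ) + 1))
  have h7 : (∑ k, 2 * c k) * √n = ∑ k, c k * √n + ∑ k, c k * √n := by
    rw [← Finset.sum_add_distrib, Finset.sum_mul]
    exact Finset.sum_congr rfl fun k _ => by ring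
  simp only [hR]
  rw [add_mul, h7]
  linarith

lemma exists_grid (L : ℝ) {δ : ℝ} (hδ : 0 < δ) : ∃ (K : ℕ) (m : Fin (K + 1) → ℝ),
    (0 ≤ L → ∀ k, |m k| ≤ L) ∧ ∀ t, |t| ≤ L → ∃ k, |t - m k| ≤ δ := by
  obtain ⟨K, hK⟩ := exists_nat_gt (2 * L / δ)
  refine ⟨K, fun k => min L (-L + k * δ), fun hL k => ?_, fun t ht => ?_⟩
  · have : 0 ≤ (k : ℝ) * δ := by positivity
    exact abs_le.2 ⟨le_min (by linarith) (by linarith), min_le_left _ _⟩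
  · obtain ⟨h1, h2⟩ := abs_le.1 ht
    have h0 : 0 ≤ (t + L) / δ := div_nonneg (by linarith) hδ.le
    have hf1 := Nat.floor_le h0
    have hf2 := Nat.lt_floor_add_one ((t + L) / δ)
    rw [le_div_iff₀ hδ] at hf1
    rw [div_lt_iff₀ hδ] at hf2
    have hlt : ⌊(t + L) / δ⌋₊ < K + 1 := by
      refine Nat.lt_succ_of_le ((Nat.floor_le_floor ?_).trans (Nat.floor_le_of_le hK.le))
      exact div_le_div_of_nonneg_right (by linarith) hδ.le
    refine ⟨⟨_, hlt⟩, ?_⟩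
    simp only
    rw [min_eq_right (by linarith), abs_le]
    constructor <;> linarith

end LowerBound

/-- One-parameter replica-symmetric formula for the Wigner spike model:
`lim_{n→∞} f_n^ws = inf_{q∈[0,ρ]} f̃^pot(q)`. -/
theorem wignerSpike_one_parameter_formula (S : ℝ) (hS : 0 < S)
    (P0 : Measure ℝ) [IsProbabilityMeasure P0]
    (hsupp : ∀ᵐ x ∂P0, x ∈ Set.Icc (-S) S)
    (ρ : ℝ) (hρ : ρ = ∫ x, x ^ 2 ∂P0) :
    Filter.Tendsto (fun n : ℕ => fws P0 n) Filter.atTop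
      (nhds (sInf ((fun q => ftpotWS P0 q) '' Set.Icc 0 ρ))) := by
  have hP : ∀ᵐ x ∂P0, |x| ≤ S := by
    filter_upwards [hsupp] with x hx using abs_le.2 hx
  have hρ0 : 0 ≤ ρ := hρ ▸ integral_nonneg fun x => sq_nonneg x
  set I := sInf ((fun q => ftpotWS P0 q) '' Set.Icc 0 ρ)
  have hle : ∀ n : ℕ, 0 < n → fws P0 n ≤ I := fun n hn => by
    refine le_csInf ((Set.nonempty_Icc.2 hρ0).image _) ?_
    rintro _ ⟨q, hq, rfl⟩
    exact fws_le_ftpotWS hS.le hP hq.1 hn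
  have hM := scalarMean_sub_le hS.le hP (M := -I) fun q hq => by
    have hbdd : BddBelow ((fun q => ftpotWS P0 q) '' Set.Icc 0 ρ) := by
      refine ⟨fws P0 1, ?_⟩
      rintro _ ⟨q, hq, rfl⟩
      exact fws_le_ftpotWS hS.le hP hq.1 one_pos
    have h : I ≤ ftpotWS P0 q := csInf_le hbdd ⟨q, hρ ▸ hq, rfl⟩
    rw [ftpotWS_eq] at h
    linarith
  rw [tendsto_order]
  refine ⟨fun b hb => ?_, fun b hb => ?_⟩
  · obtain ⟨δ, hδ, hδ2⟩ : ∃ δ : ℝ, 0 < δ ∧ δ ^ 2 / 2 < I - b :=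
      ⟨√(I - b), Real.sqrt_pos.2 (sub_pos.2 hb), by
        rw [Real.sq_sqrt (sub_pos.2 hb).le]
        linarith⟩
    obtain ⟨K, m, hm, hcov⟩ := exists_grid (S ^ 2) hδ
    obtain ⟨C, hC⟩ := exists_neg_fws_le hS.le hP (hm (sq_nonneg S)) hcov hM
    have hlim : Filter.Tendsto (fun n : ℕ => √(n : ℝ)) Filter.atTop Filter.atTop :=
      Real.tendsto_sqrt_atTop.comp tendsto_natCast_atTop_atTop
    filter_upwards [hlim.eventually_gt_atTop (C / (I - b - δ ^ 2 / 2)),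
      Filter.eventually_gt_atTop 0] with n hn hn0
    have hs : 0 < √(n : ℝ) := Real.sqrt_pos.2 (by exact_mod_cast hn0)
    have hsq : √(n : ℝ) * √n = n := Real.mul_self_sqrt (Nat.cast_nonneg n)
    rw [div_lt_iff₀ (sub_pos.2 hδ2)] at hn
    have h1 := mul_lt_mul_of_pos_right hn hs
    have h2 := hC n hn0
    have h3 : (n : ℝ) * b < n * fws P0 n := by
      rw [mul_right_comm, hsq] at h1
      linarith
    exact lt_of_mul_lt_mul_left h3 (Nat.cast_nonneg n)
  · filter_upwards [Filter.eventually_gt_atTop 0] with n hn using (hle n hn).trans_lt hb
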